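/- arXiv:2103.10724 — 4 statements merged into one kernel-verified Lean document; each statement's English description precedes it below -/
import Mathlib

section
/- Let d ≥ 4 and let X:[0,T]×Ω→ℝ^d be a jointly measurable process such that there exists a constant c>0 with the following property: for all 0≤r<s≤T the law of X_s−X_r is absolutely continuous with respect to Lebesgue measure λ_d with a density p_{r,s} satisfying p_{r,s}(y) ≥ c·(s−r)^{−d/4}·exp(−‖y‖²/(c·(s−r)^{1/2})) for λ_d-almost every y∈ℝ^d. Then for every t∈(0,T], X has no square-integrable local time on [0,t]: there exists no jointly measurable function L:ℝ^d×Ω→[0,∞) such that almost surely L(·,ω) is a Lebesgue density of the occupation measure of s↦X_s(ω) on [0,t] and E[∫_{ℝ^d} L(x)² dx] < ∞. (Abstract form of Theorem 4.3: the solution of the non-linear stochastic heat equation admits such a Gaussian-type density lower bound.) -/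
open MeasureTheory Filter Set
open scoped ENNReal NNReal

noncomputable section

/-- The occupation measure with density `f` charges the `u`-neighbourhood of the diagonal by at
most twice the volume of a ball of radius `u` times the squared `L²` norm of `f`. -/
lemma withDensity_prod_dist_lt_le {E : Type*} [NormedAddCommGroup E] [MeasurableSpace E]
    [BorelSpace E] [SecondCountableTopology E] (μ : Measure E) [SFinite μ] [μ.IsAddLeftInvariant]
    {f : E → ℝ≥0∞} (hf : Measurable f) [SFinite (μ.withDensity f)] (u : ℝ) :
    ((μ.withDensity f).prod (μ.withDensity f)) {q : E × E | dist q.1 q.2 < u} ≤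
      2 * μ (Metric.ball 0 u) * ∫⁻ x, f x ^ 2 ∂μ := by
  have hD : MeasurableSet {q : E × E | dist q.1 q.2 < u} :=
    measurableSet_lt (measurable_fst.dist measurable_snd) measurable_const
  have hf₁ : Measurable fun z : E × E => f z.1 ^ 2 := (hf.comp measurable_fst).pow_const 2
  have hball (x : E) : μ (Metric.ball x u) = μ (Metric.ball 0 u) := by
    rw [← measure_preimage_add μ x (Metric.ball x u)]
    congr 1
    ext y
    simp [dist_eq_norm]
  have hfst : ∫⁻ z in {q : E × E | dist q.1 q.2 < u}, f z.1 ^ 2 ∂(μ.prod μ) =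
      μ (Metric.ball 0 u) * ∫⁻ x, f x ^ 2 ∂μ := by
    rw [← lintegral_indicator hD, lintegral_prod _
      (hf₁.indicator hD).aemeasurable,
      ← lintegral_const_mul _ (hf.pow_const 2)]
    refine lintegral_congr fun x => ?_
    have : (fun y => {q : E × E | dist q.1 q.2 < u}.indicator (fun z => f z.1 ^ 2) (x, y)) =
        (Metric.ball x u).indicator fun _ => f x ^ 2 := by
      ext y
      simp [indicator, dist_comm]
    rw [this, lintegral_indicator Metric.isOpen_ball.measurableSet, setLIntegral_const, hball,
      mul_comm]
  have hsnd : ∫⁻ z in {q : E × E | dist q.1 q.2 < u}, f z.2 ^ 2 ∂(μ.prod μ) =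
      μ (Metric.ball 0 u) * ∫⁻ x, f x ^ 2 ∂μ := by
    rw [← hfst, ← lintegral_indicator hD, ← lintegral_indicator hD, ← lintegral_prod_swap]
    refine lintegral_congr fun z => ?_
    simp [indicator, dist_comm]
  have hmul (a b : ℝ≥0∞) : a * b ≤ a ^ 2 + b ^ 2 := by
    rcases le_total a b with h | h
    · calc a * b ≤ b ^ 2 := by rw [sq]; gcongr
        _ ≤ _ := le_add_self
    · calc a * b ≤ a ^ 2 := by rw [sq]; gcongr
        _ ≤ _ := le_self_add
  rw [prod_withDensity hf hf, withDensity_apply _ hD]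
  calc ∫⁻ z in {q : E × E | dist q.1 q.2 < u}, f z.1 * f z.2 ∂(μ.prod μ)
      ≤ ∫⁻ z in {q : E × E | dist q.1 q.2 < u}, (f z.1 ^ 2 + f z.2 ^ 2) ∂(μ.prod μ) :=
        lintegral_mono fun z => hmul _ _
    _ = 2 * μ (Metric.ball 0 u) * ∫⁻ x, f x ^ 2 ∂μ := by
        rw [lintegral_add_left hf₁, hfst, hsnd]
        ring

/-- A path whose occupation measure has density `f` spends little time near itself. -/
lemma prod_dist_lt_le_of_map_eq_withDensity {α E : Type*} [MeasurableSpace α] (τ : Measure α)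
    [SFinite τ] [NormedAddCommGroup E] [MeasurableSpace E]
    [BorelSpace E] [SecondCountableTopology E] (μ : Measure E) [SFinite μ] [μ.IsAddLeftInvariant]
    {f : E → ℝ≥0∞} (hf : Measurable f) {θ : α → E} (hθ : Measurable θ)
    (h : τ.map θ = μ.withDensity f) (u : ℝ) :
    (τ.prod τ) {p | dist (θ p.1) (θ p.2) < u} ≤
      2 * μ (Metric.ball 0 u) * ∫⁻ x, f x ^ 2 ∂μ := by
  have hD : MeasurableSet {q : E × E | dist q.1 q.2 < u} :=
    measurableSet_lt (measurable_fst.dist measurable_snd) measurable_const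
  have : SFinite (μ.withDensity f) := h ▸ inferInstance
  refine le_trans (le_of_eq ?_) (withDensity_prod_dist_lt_le μ hf u)
  rw [← h, Measure.map_prod_map _ _ hθ hθ, Measure.map_apply (hθ.prodMap hθ) hD]
  rfl

/-- Averaging `prod_dist_lt_le_of_map_eq_withDensity` over a random path. -/
lemma lintegral_measure_dist_lt_le {α Ω E : Type*} [MeasurableSpace α] (τ : Measure α)
    [SFinite τ] [MeasurableSpace Ω] (P : Measure Ω) [SFinite P]
    [NormedAddCommGroup E] [MeasurableSpace E]
    [BorelSpace E] [SecondCountableTopology E] (μ : Measure E) [SFinite μ] [μ.IsAddLeftInvariant]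
    {X : α → Ω → E} (hX : Measurable (Function.uncurry X))
    {f : Ω → E → ℝ≥0∞} (hf : ∀ ω, Measurable (f ω))
    (h : ∀ᵐ ω ∂P, τ.map (fun s => X s ω) = μ.withDensity (f ω)) {u : ℝ}
    (hu : μ (Metric.ball 0 u) ≠ ∞) :
    ∫⁻ p, P {ω | dist (X p.1 ω) (X p.2 ω) < u} ∂(τ.prod τ) ≤
      2 * μ (Metric.ball 0 u) * ∫⁻ ω, ∫⁻ x, f ω x ^ 2 ∂μ ∂P := by
  have hS : MeasurableSet {z : (α × α) × Ω | dist (X z.1.1 z.2) (X z.1.2 z.2) < u} := by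
    refine measurableSet_lt (Measurable.dist ?_ ?_) measurable_const
    · exact hX.comp ((measurable_fst.comp measurable_fst).prodMk measurable_snd)
    · exact hX.comp ((measurable_snd.comp measurable_fst).prodMk measurable_snd)
  have h₁ := Measure.prod_apply (μ := τ.prod τ) (ν := P) hS
  have h₂ := Measure.prod_apply_symm (μ := τ.prod τ) (ν := P) hS
  calc ∫⁻ p, P {ω | dist (X p.1 ω) (X p.2 ω) < u} ∂(τ.prod τ)
      = ∫⁻ ω, (τ.prod τ) {p | dist (X p.1 ω) (X p.2 ω) < u} ∂P := h₁.symm.trans h₂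
    _ ≤ ∫⁻ ω, 2 * μ (Metric.ball 0 u) * ∫⁻ x, f ω x ^ 2 ∂μ ∂P := by
        refine lintegral_mono_ae ?_
        filter_upwards [h] with ω hω
        exact prod_dist_lt_le_of_map_eq_withDensity τ μ (hf ω)
          (hX.comp measurable_prodMk_right) hω u
    _ = _ := lintegral_const_mul' _ _ (by finiteness)

/-- A lower bound on the Lebesgue density on a ball gives a lower bound on the mass of that ball. -/
lemma ofReal_mul_le_of_le_rnDeriv {E : Type*} [MeasurableSpace E] {μ ν : Measure E}
    {s : Set E} (hs : MeasurableSet s) {g : E → ℝ} {a : ℝ}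
    (hg : ∀ᵐ y ∂μ, g y ≤ (ν.rnDeriv μ y).toReal) (ha : ∀ y ∈ s, a ≤ g y) :
    ENNReal.ofReal a * μ s ≤ ν s := by
  rw [← setLIntegral_const]
  refine le_trans ?_ (Measure.setLIntegral_rnDeriv_le (ν := μ) s)
  refine lintegral_mono_ae ((ae_restrict_iff' hs).2 ?_)
  filter_upwards [hg] with y hy hys
  exact (ENNReal.ofReal_le_ofReal ((ha y hys).trans hy)).trans ENNReal.ofReal_toReal_le

lemma lintegral_rpow_sub_eq_top {a s : ℝ} (hs : 0 < s) (ha : a ≤ -1) :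
    ∫⁻ r in Ioo 0 s, ENNReal.ofReal ((s - r) ^ a) = ∞ := by
  have hmp : MeasurePreserving (fun r : ℝ => s - r) := Measure.measurePreserving_sub_left volume s
  have hpre : (fun r : ℝ => s - r) ⁻¹' Ioo 0 s = Ioo 0 s := by
    ext r
    simp [and_comm]
  have hm : Measurable fun x : ℝ => ENNReal.ofReal (x ^ a) := by fun_prop
  have key := hmp.setLIntegral_comp_preimage (s := Ioo 0 s) measurableSet_Ioo hm
  rw [hpre] at key
  rw [key]
  by_contra hne
  have hint : IntegrableOn (fun x : ℝ => x ^ a) (Ioo 0 s) := by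
    refine (lintegral_ofReal_ne_top_iff_integrable (by fun_prop) ?_).1 hne
    exact (ae_restrict_iff' measurableSet_Ioo).2
      (Eventually.of_forall fun x hx => Real.rpow_nonneg hx.1.le a)
  have := (intervalIntegral.integrableOn_Ioo_rpow_iff hs).1 hint
  linarith

/-- The singular kernel `(s - r) ^ a` with `a ≤ -1` is not integrable on `r < s`. -/
lemma lintegral_prod_eq_top_of_rpow_le {t a : ℝ} (ht : 0 < t) (ha : a ≤ -1)
    {K : ℝ≥0∞} (hK : K ≠ 0) {g : ℝ × ℝ → ℝ≥0∞} (hg : Measurable g)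
    (hle : ∀ r s, 0 ≤ r → r < s → s ≤ t → K * ENNReal.ofReal ((s - r) ^ a) ≤ g (s, r)) :
    ∫⁻ p, g p ∂((volume.restrict (Icc 0 t)).prod (volume.restrict (Icc 0 t))) = ∞ := by
  rw [lintegral_prod _ hg.aemeasurable, eq_top_iff]
  calc (∞ : ℝ≥0∞) = ∫⁻ _ in Ioc 0 t, ∞ := by
        rw [setLIntegral_const, ENNReal.top_mul]
        simpa using ht
    _ ≤ ∫⁻ s in Ioc 0 t, ∫⁻ r in Icc 0 t, g (s, r) := by
        refine setLIntegral_mono' measurableSet_Ioc fun s hs => ?_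
        calc (∞ : ℝ≥0∞) = ∫⁻ r in Ioo 0 s, K * ENNReal.ofReal ((s - r) ^ a) := by
              rw [lintegral_const_mul _ (by fun_prop), lintegral_rpow_sub_eq_top hs.1 ha,
                ENNReal.mul_top hK]
          _ ≤ ∫⁻ r in Ioo 0 s, g (s, r) :=
              setLIntegral_mono' measurableSet_Ioo fun r hr => hle r s hr.1.le hr.2 hs.2
          _ ≤ ∫⁻ r in Icc 0 t, g (s, r) :=
              lintegral_mono_set fun r hr => ⟨hr.1.le, hr.2.le.trans hs.2⟩
    _ ≤ ∫⁻ s in Icc 0 t, ∫⁻ r in Icc 0 t, g (s, r) := lintegral_mono_set Ioc_subset_Icc_self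

/-- Let `d ≥ 4` and `X` be a jointly measurable process whose increments `X_s − X_r`
(for `0 ≤ r < s ≤ T`) have laws absolutely continuous w.r.t. Lebesgue measure with
densities bounded below by `c (s−r)^{−d/4} exp(−‖y‖²/(c (s−r)^{1/2}))`. Then for every
`t ∈ (0,T]`, `X` has no square-integrable local time on `[0,t]`. -/
theorem no_square_integrable_local_time_of_gaussian_lower_bound
    {Ω : Type*} [MeasurableSpace Ω] (P : Measure Ω) [IsProbabilityMeasure P]
    (d : ℕ) (hd : 4 ≤ d) (T : ℝ) (hT : 0 < T)
    (X : ℝ → Ω → EuclideanSpace ℝ (Fin d))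
    (hmeas : Measurable (Function.uncurry X))
    (hdens : ∃ c : ℝ, 0 < c ∧ ∀ r s : ℝ, 0 ≤ r → r < s → s ≤ T →
      (Measure.map (fun ω => X s ω - X r ω) P ≪
        (volume : Measure (EuclideanSpace ℝ (Fin d)))) ∧
      ∀ᵐ y ∂(volume : Measure (EuclideanSpace ℝ (Fin d))),
        c * (s - r) ^ (-(d : ℝ) / 4) *
            Real.exp (-‖y‖ ^ 2 / (c * (s - r) ^ ((1 : ℝ) / 2))) ≤
          ((Measure.map (fun ω => X s ω - X r ω) P).rnDeriv volume y).toReal) :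
    ∀ t : ℝ, 0 < t → t ≤ T →
      ¬ ∃ L : EuclideanSpace ℝ (Fin d) → Ω → ℝ,
          Measurable (Function.uncurry L) ∧ (∀ x ω, 0 ≤ L x ω) ∧
          (∀ᵐ ω ∂P,
            Measure.map (fun s => X s ω) (volume.restrict (Set.Icc 0 t)) =
              volume.withDensity (fun x => ENNReal.ofReal (L x ω))) ∧
          ∫⁻ ω, ∫⁻ x, ENNReal.ofReal ((L x ω) ^ 2) ∂volume ∂P < ⊤ := by
  obtain ⟨c, hc, hdens⟩ := hdens
  rintro t ht htT ⟨L, hL, hL0, hocc, hfin⟩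
  set τ : Measure ℝ := volume.restrict (Icc 0 t)
  obtain ⟨u, -, hu0, hu⟩ := exists_seq_strictAnti_tendsto (0 : ℝ)
  set V : ℕ → ℝ≥0∞ := fun n =>
    (volume : Measure (EuclideanSpace ℝ (Fin d))) (Metric.ball 0 (u n))
  have hV0 (n : ℕ) : V n ≠ 0 := (Metric.measure_ball_pos _ _ (hu0 n)).ne'
  have hVtop (n : ℕ) : V n ≠ ∞ := measure_ball_lt_top.ne
  set F : ℕ → ℝ × ℝ → ℝ≥0∞ := fun n p => (V n)⁻¹ * P {ω | dist (X p.1 ω) (X p.2 ω) < u n}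
  have hF (n : ℕ) : Measurable (F n) := by
    refine Measurable.const_mul ?_ _
    refine measurable_measure_prodMk_left
      (s := {z : (ℝ × ℝ) × Ω | dist (X z.1.1 z.2) (X z.1.2 z.2) < u n}) ?_
    refine measurableSet_lt (Measurable.dist ?_ ?_) measurable_const
    · exact hmeas.comp ((measurable_fst.comp measurable_fst).prodMk measurable_snd)
    · exact hmeas.comp ((measurable_snd.comp measurable_fst).prodMk measurable_snd)
  set M : ℝ≥0∞ := ∫⁻ ω, ∫⁻ x, ENNReal.ofReal ((L x ω) ^ 2) ∂volume ∂P
  have hupper (n : ℕ) : ∫⁻ p, F n p ∂(τ.prod τ) ≤ 2 * M := by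
    have h := lintegral_measure_dist_lt_le τ P volume hmeas
      (f := fun ω x => ENNReal.ofReal (L x ω))
      (fun ω => (hL.comp measurable_prodMk_right).ennreal_ofReal) hocc (hVtop n)
    simp_rw [← ENNReal.ofReal_pow (hL0 _ _)] at h
    rw [lintegral_const_mul' _ _ (ENNReal.inv_ne_top.2 (hV0 n))]
    calc _ ≤ (V n)⁻¹ * (2 * V n * M) := by gcongr
      _ = (V n)⁻¹ * V n * (2 * M) := by ring
      _ = 2 * M := by rw [ENNReal.inv_mul_cancel (hV0 n) (hVtop n), one_mul]
  have hlower (r s : ℝ) (hr : 0 ≤ r) (hrs : r < s) (hst : s ≤ t) :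
      ENNReal.ofReal (c * Real.exp (-1 / c)) * ENNReal.ofReal ((s - r) ^ (-(d : ℝ) / 4)) ≤
        liminf (fun n => F n (s, r)) atTop := by
    have hpos : 0 < s - r := sub_pos.2 hrs
    have hroot : 0 < (s - r) ^ ((1 : ℝ) / 2) := Real.rpow_pos_of_pos hpos _
    have hsmall : ∀ᶠ n in atTop, u n ^ 2 < (s - r) ^ ((1 : ℝ) / 2) := by
      have := hu.pow 2
      rw [zero_pow two_ne_zero] at this
      exact this.eventually (gt_mem_nhds hroot)
    refine le_liminf_of_le (by isBoundedDefault) ?_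
    filter_upwards [hsmall] with n hn
    have hmap : Measurable fun ω => X s ω - X r ω :=
      (hmeas.comp measurable_prodMk_left).sub (hmeas.comp measurable_prodMk_left)
    have hball := ofReal_mul_le_of_le_rnDeriv (a := c * Real.exp (-1 / c) *
        (s - r) ^ (-(d : ℝ) / 4)) (Metric.isOpen_ball (x := 0) (ε := u n)).measurableSet
      (hdens r s hr hrs (hst.trans htT)).2 (fun y hy => by
        have hy2 : ‖y‖ ^ 2 ≤ (s - r) ^ ((1 : ℝ) / 2) := by
          have : ‖y‖ < u n := by simpa using hy
          exact (pow_le_pow_left₀ (norm_nonneg y) this.le 2).trans hn.le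
        have hexp : -1 / c ≤ -‖y‖ ^ 2 / (c * (s - r) ^ ((1 : ℝ) / 2)) := by
          rw [div_le_div_iff₀ hc (mul_pos hc hroot)]
          nlinarith
        calc c * Real.exp (-1 / c) * (s - r) ^ (-(d : ℝ) / 4)
            = c * (s - r) ^ (-(d : ℝ) / 4) * Real.exp (-1 / c) := by ring
          _ ≤ _ := by gcongr)
    rw [Measure.map_apply hmap Metric.isOpen_ball.measurableSet,
      ENNReal.ofReal_mul (by positivity)] at hball
    have hset : (fun ω => X s ω - X r ω) ⁻¹' Metric.ball 0 (u n) =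
        {ω | dist (X s ω) (X r ω) < u n} := by
      ext ω
      simp [dist_eq_norm]
    rw [hset] at hball
    change _ ≤ (V n)⁻¹ * P {ω | dist (X s ω) (X r ω) < u n}
    rw [← ENNReal.div_eq_inv_mul, ENNReal.le_div_iff_mul_le (Or.inl (hV0 n)) (Or.inl (hVtop n))]
    exact hball
  have hd' : -(d : ℝ) / 4 ≤ -1 := by
    have : (4 : ℝ) ≤ d := by exact_mod_cast hd
    linarith
  have htop := lintegral_prod_eq_top_of_rpow_le ht hd'
    (ENNReal.ofReal_pos.2 (by positivity : 0 < c * Real.exp (-1 / c))).ne'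
    (Measurable.liminf hF) hlower
  have hle : ∫⁻ p, liminf (fun n => F n p) atTop ∂(τ.prod τ) ≤ 2 * M :=
    (lintegral_liminf_le hF).trans
      ((liminf_le_liminf (Eventually.of_forall hupper)).trans (liminf_const _).le)
  rw [htop] at hle
  exact absurd hle (not_le.2 (ENNReal.mul_lt_top (by simp) hfin))
end
end

section
/- Let α∈(0,1/2], let d ≤ ⌊1/α⌋−1, suppose that Y is α-LND on [0,T] and that Y_0=0 almost surely. Then there exists a function L:ℝ^d×[0,T]×Ω→ℝ such that: (i) for P-almost every ω the map (ξ,t)↦L(ξ,t,ω) is jointly continuous on ℝ^d×[0,T]; (ii) for every t∈[0,T], almost surely L(·,t,ω) is a Lebesgue density of the occupation measure of s↦Y_s(ω) on [0,t]; (iii) for every γ with 0<γ<1−dα there exist random variables η and δ, almost surely finite and positive, such that sup_{ξ∈ℝ^d}|L(ξ,t,ω)−L(ξ,s,ω)| ≤ η(ω)·|t−s|^γ for all s,t∈[0,T] with |t−s|<δ(ω). -/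
open MeasureTheory Filter Set
open scoped ENNReal NNReal RealInnerProductSpace

noncomputable section

/-- `Y` is `α`-LND on `[0,T]`. -/
def IsLND {Ω : Type*} [MeasurableSpace Ω] (P : Measure Ω) (d : ℕ)
    (Y : ℝ → Ω → EuclideanSpace ℝ (Fin d)) (T α : ℝ) : Prop :=
  ∀ m : ℕ, 2 ≤ m → ∀ k : Fin m → Fin d → ℕ, ∃ c : ℝ, 0 < c ∧
    ∀ v : Fin m → EuclideanSpace ℝ (Fin d), (∀ j l, v j l ≠ 0) →
      ∀ t : Fin (m + 1) → ℝ, t 0 = 0 → StrictMono t → t (Fin.last m) ≤ T →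
        ‖∫ ω, Complex.exp (Complex.I *
            ((∑ j : Fin m, (⟪v j, Y (t j.succ) ω - Y (t j.castSucc) ω⟫ : ℝ)) : ℂ)) ∂P‖ ≤
          c * ∏ j : Fin m, ∏ l : Fin d,
            (|v j l| ^ k j l)⁻¹ * ((t j.succ - t j.castSucc) ^ (α * (k j l : ℝ)))⁻¹

section HeatKernel

/-- The heat kernel on a finite-dimensional Euclidean space at time `a`. -/
def heatKernel {V : Type*} [NormedAddCommGroup V] [InnerProductSpace ℝ V] (a : ℝ) (z : V) : ℝ :=
  (4 * Real.pi * a) ^ (-(Module.finrank ℝ V : ℝ) / 2) * Real.exp (-(1 / (4 * a)) * ‖z‖ ^ 2)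

/-- An upper bound for the heat kernel at time `a`. -/
def heatBound (V : Type*) [NormedAddCommGroup V] [InnerProductSpace ℝ V] (a : ℝ) : ℝ :=
  (4 * Real.pi * a) ^ (-(Module.finrank ℝ V : ℝ) / 2)

variable {V : Type*} [NormedAddCommGroup V] [InnerProductSpace ℝ V]

lemma heatKernel_nonneg {a : ℝ} (ha : 0 < a) (z : V) : 0 ≤ heatKernel a z := by
  unfold heatKernel; positivity

lemma heatBound_nonneg {a : ℝ} (ha : 0 < a) : 0 ≤ heatBound V a := by
  unfold heatBound; positivity

lemma heatKernel_le {a : ℝ} (ha : 0 < a) (z : V) : heatKernel a z ≤ heatBound V a := by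
  unfold heatKernel heatBound
  apply mul_le_of_le_one_right (by positivity)
  rw [Real.exp_le_one_iff]
  have : 0 ≤ 1 / (4 * a) * ‖z‖ ^ 2 := by positivity
  linarith

lemma continuous_heatKernel (a : ℝ) : Continuous (heatKernel a : V → ℝ) := by
  unfold heatKernel; fun_prop

variable [FiniteDimensional ℝ V] [MeasurableSpace V] [BorelSpace V]

lemma integral_heatKernel {a : ℝ} (ha : 0 < a) : ∫ z : V, heatKernel a z = 1 := by
  unfold heatKernel
  rw [integral_const_mul, GaussianFourier.integral_rexp_neg_mul_sq_norm (by positivity),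
    show Real.pi / (1 / (4 * a)) = 4 * Real.pi * a by field_simp, neg_div,
    ← Real.rpow_add (by positivity)]
  simp

lemma integrable_heatKernel {a : ℝ} (ha : 0 < a) : Integrable (heatKernel a : V → ℝ) := by
  by_contra h
  have := integral_heatKernel (V := V) ha
  rw [integral_undef h] at this
  exact zero_ne_one this

lemma heatKernel_fourier {a : ℝ} (ha : 0 < a) (z : V) :
    (heatKernel a z : ℂ) = ((2 * Real.pi) ^ (-(Module.finrank ℝ V : ℝ)) : ℝ) *
      ∫ u : V, Complex.exp (Complex.I * (⟪u, z⟫ : ℝ)) * (Real.exp (-a * ‖u‖ ^ 2) : ℝ) := by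
  have h := GaussianFourier.integral_cexp_neg_mul_sq_norm_add (V := V) (b := (a : ℂ))
    (by simpa using ha) Complex.I z
  have h2 : ∫ u : V, Complex.exp (Complex.I * (⟪u, z⟫ : ℝ)) * (Real.exp (-a * ‖u‖ ^ 2) : ℝ)
      = ∫ v : V, Complex.exp (-(a : ℂ) * ‖v‖ ^ 2 + Complex.I * (⟪z, v⟫ : ℝ)) := by
    congr 1; ext u
    rw [real_inner_comm, add_comm, Complex.exp_add]
    push_cast
    rfl
  rw [h2, h]
  have h3 : ((Real.pi : ℂ) / (a : ℂ)) ^ ((Module.finrank ℝ V : ℂ) / 2) =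
      ((Real.pi / a) ^ ((Module.finrank ℝ V : ℝ) / 2) : ℝ) := by
    rw [Complex.ofReal_cpow (by positivity)]
    push_cast; rfl
  have h4 : Complex.exp (Complex.I ^ 2 * (‖z‖ : ℂ) ^ 2 / (4 * (a : ℂ))) =
      (Real.exp (-(1 / (4 * a)) * ‖z‖ ^ 2) : ℝ) := by
    push_cast
    congr 1
    rw [Complex.I_sq]
    ring
  rw [h3, h4, ← Complex.ofReal_mul, ← Complex.ofReal_mul]
  congr 1
  rw [← mul_assoc]
  unfold heatKernel
  congr 1
  have e1 : (2 * Real.pi) ^ (-(Module.finrank ℝ V : ℝ)) =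
      ((2 * Real.pi) ^ (2 : ℝ)) ^ (-(Module.finrank ℝ V : ℝ) / 2) := by
    rw [← Real.rpow_mul (by positivity)]; congr 1; ring
  have e2 : (Real.pi / a) ^ ((Module.finrank ℝ V : ℝ) / 2) =
      (a / Real.pi) ^ (-(Module.finrank ℝ V : ℝ) / 2) := by
    rw [neg_div, Real.rpow_neg (by positivity), ← Real.inv_rpow (by positivity), inv_div]
  rw [e1, e2, ← Real.mul_rpow (by positivity) (by positivity)]
  congr 1
  rw [Real.rpow_two]
  field_simp
  ring

lemma heatKernel_conv {r s : ℝ} (hr : 0 < r) (hs : 0 < s) (x : V) :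
    ∫ z : V, heatKernel r z * heatKernel s (x - z) = heatKernel (r + s) x := by
  have hb : 0 < 1 / (4 * r) + 1 / (4 * s) := by positivity
  have h := GaussianFourier.integral_cexp_neg_mul_sq_norm_add (V := V)
    (b := ((1 / (4 * r) + 1 / (4 * s) : ℝ) : ℂ)) (by rw [Complex.ofReal_re]; exact hb)
    ((1 / (2 * s) : ℝ) : ℂ) x
  have h1 : ∀ v : V, Complex.exp (-((1 / (4 * r) + 1 / (4 * s) : ℝ) : ℂ) * ‖v‖ ^ 2 +
      ((1 / (2 * s) : ℝ) : ℂ) * (⟪x, v⟫ : ℝ)) =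
      ((Real.exp (-(1 / (4 * r) + 1 / (4 * s)) * ‖v‖ ^ 2 + 1 / (2 * s) * ⟪x, v⟫) : ℝ) : ℂ) := by
    intro v; push_cast; rfl
  simp_rw [h1] at h
  rw [integral_complex_ofReal] at h
  have h3 : ((Real.pi : ℂ) / ((1 / (4 * r) + 1 / (4 * s) : ℝ) : ℂ)) ^
      ((Module.finrank ℝ V : ℂ) / 2) =
      ((Real.pi / (1 / (4 * r) + 1 / (4 * s))) ^ ((Module.finrank ℝ V : ℝ) / 2) : ℝ) := by
    rw [Complex.ofReal_cpow (by positivity)]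
    push_cast; rfl
  have h4 : Complex.exp (((1 / (2 * s) : ℝ) : ℂ) ^ 2 * (‖x‖ : ℂ) ^ 2 /
      (4 * ((1 / (4 * r) + 1 / (4 * s) : ℝ) : ℂ))) =
      (Real.exp ((1 / (2 * s)) ^ 2 * ‖x‖ ^ 2 / (4 * (1 / (4 * r) + 1 / (4 * s)))) : ℝ) := by
    push_cast; rfl
  rw [h3, h4, ← Complex.ofReal_mul] at h
  have h5 := Complex.ofReal_injective h
  have h6 : ∀ z : V, heatKernel r z * heatKernel s (x - z) =
      (heatBound V r * heatKernel s x) *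
        Real.exp (-(1 / (4 * r) + 1 / (4 * s)) * ‖z‖ ^ 2 + 1 / (2 * s) * ⟪x, z⟫) := by
    intro z
    unfold heatKernel heatBound
    rw [mul_mul_mul_comm, ← Real.exp_add, mul_assoc _ (_ * _) _, mul_assoc _ (Real.exp _) _,
      ← Real.exp_add, ← mul_assoc]
    congr 2
    rw [norm_sub_sq_real]
    field_simp
    ring
  simp_rw [h6]
  rw [integral_const_mul, h5]
  unfold heatKernel heatBound
  have e2 : (Real.pi / (1 / (4 * r) + 1 / (4 * s))) ^ ((Module.finrank ℝ V : ℝ) / 2) =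
      ((1 / (4 * r) + 1 / (4 * s)) / Real.pi) ^ (-(Module.finrank ℝ V : ℝ) / 2) := by
    rw [neg_div, Real.rpow_neg (by positivity), ← Real.inv_rpow (by positivity), inv_div]
  rw [e2]
  have e3 : (4 * Real.pi * (r + s)) ^ (-(Module.finrank ℝ V : ℝ) / 2) =
      (4 * Real.pi * r) ^ (-(Module.finrank ℝ V : ℝ) / 2) *
      (4 * Real.pi * s) ^ (-(Module.finrank ℝ V : ℝ) / 2) *
      ((1 / (4 * r) + 1 / (4 * s)) / Real.pi) ^ (-(Module.finrank ℝ V : ℝ) / 2) := by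
    rw [← Real.mul_rpow (by positivity) (by positivity),
      ← Real.mul_rpow (by positivity) (by positivity)]
    congr 1
    field_simp
    ring
  rw [e3]
  have e4 : Real.exp (-(1 / (4 * (r + s))) * ‖x‖ ^ 2) = Real.exp (-(1 / (4 * s)) * ‖x‖ ^ 2) *
      Real.exp ((1 / (2 * s)) ^ 2 * ‖x‖ ^ 2 / (4 * (1 / (4 * r) + 1 / (4 * s)))) := by
    rw [← Real.exp_add]
    congr 1
    field_simp
    ring
  rw [e4]
  ring

lemma tendsto_heatKernel_integral {f : V → ℝ} (hf : Integrable f) (hc : Continuous f)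
    {s : ℕ → ℝ} (hs : ∀ n, 0 < s n) (hs0 : Tendsto s atTop (nhds 0)) (y : V) :
    Tendsto (fun n => ∫ x : V, f x * heatKernel (s n) (x - y)) atTop (nhds (f y)) := by
  have h := Real.tendsto_integral_gaussian_smul' (V := V) (E := ℂ) (f := fun x => (f x : ℂ))
    hf.ofReal (v := y) (by fun_prop)
  have hc : Tendsto (fun n => 1 / (4 * Real.pi ^ 2 * s n)) atTop atTop := by
    simp_rw [one_div]
    apply Tendsto.inv_tendsto_nhdsGT_zero
    rw [tendsto_nhdsWithin_iff]
    refine ⟨by simpa using hs0.const_mul (4 * Real.pi ^ 2), Eventually.of_forall fun n => ?_⟩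
    have := hs n
    simp only [mem_Ioi]
    positivity
  have h2 := h.comp hc
  have h3 := (Complex.continuous_re.tendsto _).comp h2
  refine h3.congr fun n => ?_
  have hn := hs n
  simp only [Function.comp]
  have h4 : ∀ w : V, (((Real.pi : ℂ) * ((1 / (4 * Real.pi ^ 2 * s n) : ℝ) : ℂ)) ^
      ((Module.finrank ℝ V : ℂ) / 2) * Complex.exp (-(Real.pi : ℂ) ^ 2 *
      ((1 / (4 * Real.pi ^ 2 * s n) : ℝ) : ℂ) * (‖y - w‖ : ℂ) ^ 2)) • (f w : ℂ) =
      ((f w * heatKernel (s n) (w - y) : ℝ) : ℂ) := by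
    intro w
    have e1 : ((Real.pi : ℂ) * ((1 / (4 * Real.pi ^ 2 * s n) : ℝ) : ℂ)) ^
      ((Module.finrank ℝ V : ℂ) / 2) = (heatBound V (s n) : ℂ) := by
      unfold heatBound
      rw [neg_div, Real.rpow_neg (by positivity), ← Real.inv_rpow (by positivity),
        Complex.ofReal_cpow (by positivity), ← Complex.ofReal_mul]
      congr 2
      · field_simp
      · push_cast; rfl
    have e2 : Complex.exp (-(Real.pi : ℂ) ^ 2 *
      ((1 / (4 * Real.pi ^ 2 * s n) : ℝ) : ℂ) * (‖y - w‖ : ℂ) ^ 2) =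
      (Real.exp (-(1 / (4 * s n)) * ‖w - y‖ ^ 2) : ℝ) := by
      rw [norm_sub_rev]
      push_cast
      congr 1
      field_simp
    rw [e1, e2, smul_eq_mul, ← Complex.ofReal_mul, ← Complex.ofReal_mul, mul_comm]
    rfl
  have h5 := integral_congr_ae (μ := volume) (Eventually.of_forall h4)
  rw [h5, integral_complex_ofReal, Complex.ofReal_re]

end HeatKernel

section IteratedIntegrals

lemma lintegral_pi_fin_succ {X : Type*} [MeasurableSpace X] (μ : Measure X) [SigmaFinite μ] {n : ℕ}
    {F : (Fin (n + 1) → X) → ℝ≥0∞} (hF : Measurable F) :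
    ∫⁻ u, F u ∂(Measure.pi fun _ => μ) =
      ∫⁻ y : Fin n → X, ∫⁻ x, F (Fin.cons x y) ∂μ ∂(Measure.pi fun _ => μ) := by
  have h := (measurePreserving_piFinSuccAbove (fun _ : Fin (n + 1) => μ) 0).symm
  rw [← h.lintegral_comp hF]
  refine (lintegral_prod_symm' (μ := μ) (ν := Measure.pi fun _ : Fin n => μ) _
    (hF.comp h.measurable)).trans ?_
  simp [MeasurableEquiv.piFinSuccAbove, Fin.insertNthEquiv]

lemma lintegral_fin_prod {X : Type*} [MeasurableSpace X] (μ : Measure X) [SigmaFinite μ] {n : ℕ}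
    {h : Fin n → X → ℝ≥0∞} (hh : ∀ j, Measurable (h j)) :
    ∫⁻ u, ∏ j, h j (u j) ∂(Measure.pi fun _ => μ) = ∏ j, ∫⁻ v, h j v ∂μ := by
  induction n with
  | zero => simp
  | succ n ih =>
    rw [lintegral_pi_fin_succ μ (by fun_prop)]
    simp only [Fin.prod_univ_succ, Fin.cons_zero, Fin.cons_succ]
    have : ∀ y : Fin n → X, ∫⁻ x, h 0 x * ∏ j : Fin n, h j.succ (y j) ∂μ =
        (∫⁻ x, h 0 x ∂μ) * ∏ j : Fin n, h j.succ (y j) := fun y =>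
      lintegral_mul_const _ (hh 0)
    simp_rw [this]
    rw [lintegral_const_mul _ (by fun_prop), ih (fun j => hh j.succ)]

lemma lintegral_prod_suffix_sum {V : Type*} [AddCommGroup V] [MeasurableSpace V] [MeasurableAdd₂ V]
    (μ : Measure V) [SigmaFinite μ] [μ.IsAddRightInvariant] {n : ℕ}
    {h : Fin n → V → ℝ≥0∞} (hh : ∀ j, Measurable (h j)) :
    ∫⁻ u, ∏ j, h j (∑ i, if j ≤ i then u i else 0) ∂(Measure.pi fun _ => μ) =
      ∏ j, ∫⁻ v, h j v ∂μ := by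
  have meas : ∀ {n : ℕ} (j : Fin n),
      Measurable (fun u : Fin n → V => ∑ i, if j ≤ i then u i else 0) := by
    intro n j
    refine Finset.measurable_sum _ fun i _ => ?_
    split_ifs <;> fun_prop
  induction n with
  | zero => simp
  | succ n ih =>
    have hm : ∀ {n : ℕ} {h : Fin n → V → ℝ≥0∞}, (∀ j, Measurable (h j)) →
        Measurable fun u : Fin n → V => ∏ j, h j (∑ i, if j ≤ i then u i else 0) :=
      fun hh => Finset.measurable_prod _ fun j _ => (hh j).comp (meas j)
    rw [lintegral_pi_fin_succ μ (hm hh)]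
    have e : ∀ (y : Fin n → V) (x : V),
        ∏ j, h j (∑ i, if j ≤ i then (Fin.cons x y : Fin (n + 1) → V) i else 0) =
        h 0 (x + ∑ i, y i) * ∏ j : Fin n, h j.succ (∑ i, if j ≤ i then y i else 0) := by
      intro y x
      rw [Fin.prod_univ_succ]
      simp [Fin.sum_univ_succ]
    simp_rw [e]
    have : ∀ y : Fin n → V, ∫⁻ x, h 0 (x + ∑ i, y i) *
          ∏ j : Fin n, h j.succ (∑ i, if j ≤ i then y i else 0) ∂μ =
        (∫⁻ x, h 0 x ∂μ) * ∏ j : Fin n, h j.succ (∑ i, if j ≤ i then y i else 0) := fun y => by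
      have := (hh 0).comp (measurable_add_const (∑ i, y i))
      rw [lintegral_mul_const _ (by exact this), lintegral_add_right_eq_self (h 0)]
    simp_rw [this]
    rw [lintegral_const_mul _ (hm fun j => hh j.succ),
      ih (fun j => hh j.succ), Fin.prod_univ_succ]

lemma lintegral_chain_le {X : Type*} [MeasurableSpace X] (μ : Measure X) [SigmaFinite μ]
    {k : X → X → ℝ≥0∞} (hk : Measurable (Function.uncurry k)) {A : ℝ≥0∞}
    (hA : ∀ t, ∫⁻ s, k s t ∂μ ≤ A) (n : ℕ) :
    ∫⁻ t : Fin (n + 1) → X, ∏ j : Fin n, k (t j.castSucc) (t j.succ) ∂(Measure.pi fun _ => μ) ≤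
      μ univ * A ^ n := by
  have meas : ∀ n : ℕ, Measurable (fun t : Fin (n + 1) → X =>
      ∏ j : Fin n, k (t j.castSucc) (t j.succ)) := fun n =>
    Finset.measurable_prod _ fun j _ => show Measurable (Function.uncurry k ∘ fun t : Fin (n + 1) → X =>
      (t j.castSucc, t j.succ)) from hk.comp ((measurable_pi_apply j.castSucc).prodMk (measurable_pi_apply j.succ))
  induction n with
  | zero => simp [Measure.pi_univ]
  | succ n ih =>
    rw [lintegral_pi_fin_succ μ (meas _)]
    have e : ∀ (y : Fin (n + 1) → X) (x : X),
        ∏ j : Fin (n + 1), k ((Fin.cons x y : Fin (n + 2) → X) j.castSucc)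
          ((Fin.cons x y : Fin (n + 2) → X) j.succ) =
        k x (y 0) * ∏ j : Fin n, k (y j.castSucc) (y j.succ) := by
      intro y x
      rw [Fin.prod_univ_succ]
      simp
    simp_rw [e]
    calc _ = ∫⁻ y : Fin (n + 1) → X, (∫⁻ x, k x (y 0) ∂μ) *
          ∏ j : Fin n, k (y j.castSucc) (y j.succ) ∂(Measure.pi fun _ => μ) := by
          congr 1; ext y
          exact lintegral_mul_const _ (hk.comp (measurable_id.prodMk measurable_const))
      _ ≤ ∫⁻ y : Fin (n + 1) → X, A *
          ∏ j : Fin n, k (y j.castSucc) (y j.succ) ∂(Measure.pi fun _ => μ) := by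
          gcongr with y
          exact hA _
      _ = A * ∫⁻ y : Fin (n + 1) → X,
          ∏ j : Fin n, k (y j.castSucc) (y j.succ) ∂(Measure.pi fun _ => μ) :=
          lintegral_const_mul _ (meas n)
      _ ≤ A * (μ univ * A ^ n) := by gcongr
      _ = μ univ * A ^ (n + 1) := by ring

lemma lintegral_abs_rpow_neg_le {β ℓ : ℝ} (hβ0 : 0 ≤ β) (hβ : β < 1) (hℓ : 0 < ℓ) (a t : ℝ) :
    ∫⁻ s in Ioc a (a + ℓ), ENNReal.ofReal (|t - s| ^ (-β)) ≤
      ENNReal.ofReal (3 / (1 - β) * ℓ ^ (1 - β)) := by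
  have h1 : 0 < 1 - β := by linarith
  have hpos : ∫⁻ r in Ioc 0 ℓ, ENNReal.ofReal (|r| ^ (-β)) =
      ENNReal.ofReal (ℓ ^ (1 - β) / (1 - β)) := by
    have hi : IntegrableOn (fun r : ℝ => r ^ (-β)) (Ioc 0 ℓ) :=
      (intervalIntegrable_iff_integrableOn_Ioc_of_le hℓ.le).1
        (intervalIntegral.intervalIntegrable_rpow' (by linarith))
    have hv : ∫ r in Ioc 0 ℓ, r ^ (-β) = ℓ ^ (1 - β) / (1 - β) := by
      rw [← intervalIntegral.integral_of_le hℓ.le, integral_rpow (Or.inl (by linarith)),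
        Real.zero_rpow (by linarith)]
      ring_nf
    rw [← hv, ofReal_integral_eq_lintegral_ofReal hi]
    · refine setLIntegral_congr_fun measurableSet_Ioc fun r hr => ?_
      simp only [abs_of_pos hr.1]
    · filter_upwards [ae_restrict_mem measurableSet_Ioc] with r hr
      exact Real.rpow_nonneg hr.1.le _
  have hneg : ∫⁻ r in Ico (-ℓ) 0, ENNReal.ofReal (|r| ^ (-β)) =
      ENNReal.ofReal (ℓ ^ (1 - β) / (1 - β)) := by
    rw [← hpos, ← (Measure.measurePreserving_neg (volume : Measure ℝ)).setLIntegral_comp_preimage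
      measurableSet_Ico (by fun_prop)]
    simp
  have hz : ∫⁻ r in Icc (-ℓ) ℓ, ENNReal.ofReal (|r| ^ (-β)) ≤
      ENNReal.ofReal (ℓ ^ (1 - β) / (1 - β)) + ENNReal.ofReal (ℓ ^ (1 - β) / (1 - β)) := by
    have hs : (Icc (-ℓ) ℓ : Set ℝ) =ᵐ[volume] (Ico (-ℓ) 0 ∪ Ioc 0 ℓ : Set ℝ) := by
      have : (Icc (-ℓ) ℓ : Set ℝ) = Ico (-ℓ) 0 ∪ Icc 0 ℓ :=
        (Ico_union_Icc_eq_Icc (by linarith) hℓ.le).symm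
      rw [this]
      exact (ae_eq_refl _).union Ioc_ae_eq_Icc.symm
    rw [setLIntegral_congr hs]
    refine (lintegral_union_le _ _ _).trans ?_
    rw [hpos, hneg]
  have key : ∀ s, ENNReal.ofReal (|t - s| ^ (-β)) ≤
      (Icc (-ℓ) ℓ).indicator (fun r => ENNReal.ofReal (|r| ^ (-β))) (t - s) +
        ENNReal.ofReal (ℓ ^ (-β)) := by
    intro s
    by_cases hs : t - s ∈ Icc (-ℓ) ℓ
    · rw [indicator_of_mem hs]
      exact le_self_add
    · rw [indicator_of_notMem hs, zero_add]
      apply ENNReal.ofReal_le_ofReal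
      apply Real.rpow_le_rpow_of_nonpos hℓ _ (by linarith)
      by_contra hc
      push Not at hc
      exact hs (abs_le.1 hc.le)
  calc _ ≤ ∫⁻ s in Ioc a (a + ℓ), ((Icc (-ℓ) ℓ).indicator
            (fun r => ENNReal.ofReal (|r| ^ (-β))) (t - s) + ENNReal.ofReal (ℓ ^ (-β))) :=
        lintegral_mono key
    _ = (∫⁻ s in Ioc a (a + ℓ), (Icc (-ℓ) ℓ).indicator
            (fun r => ENNReal.ofReal (|r| ^ (-β))) (t - s)) +
          ENNReal.ofReal (ℓ ^ (-β)) * ENNReal.ofReal ℓ := by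
        rw [lintegral_add_right _ measurable_const]
        simp
    _ ≤ (∫⁻ s, (Icc (-ℓ) ℓ).indicator
            (fun r => ENNReal.ofReal (|r| ^ (-β))) (t - s)) +
          ENNReal.ofReal (ℓ ^ (-β)) * ENNReal.ofReal ℓ := by
        gcongr
        exact Measure.restrict_le_self
    _ = (∫⁻ r in Icc (-ℓ) ℓ, ENNReal.ofReal (|r| ^ (-β))) +
          ENNReal.ofReal (ℓ ^ (-β) * ℓ) := by
        rw [lintegral_sub_left_eq_self (fun s => (Icc (-ℓ) ℓ).indicator
            (fun r => ENNReal.ofReal (|r| ^ (-β))) s), lintegral_indicator measurableSet_Icc,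
            ENNReal.ofReal_mul (by positivity)]
    _ ≤ (ENNReal.ofReal (ℓ ^ (1 - β) / (1 - β)) + ENNReal.ofReal (ℓ ^ (1 - β) / (1 - β))) +
          ENNReal.ofReal (ℓ ^ (1 - β) / (1 - β)) := by
        gcongr
        rw [← Real.rpow_add_one hℓ.ne', show -β + 1 = 1 - β by ring, le_div_iff₀ h1]
        have : 0 ≤ ℓ ^ (1 - β) := by positivity
        nlinarith
    _ = ENNReal.ofReal (3 / (1 - β) * ℓ ^ (1 - β)) := by
        rw [← ENNReal.ofReal_add (by positivity) (by positivity),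
          ← ENNReal.ofReal_add (by positivity) (by positivity)]
        congr 1
        ring

lemma exists_lintegral_japanese_le (M : ℝ) (hM : 1 ≤ M) : ∃ C : ℝ, 0 < C ∧
    ∀ p : ℝ, 0 ≤ p → p ≤ 1 / 4 → ∀ b : ℝ, 0 < b → b ≤ M →
      ∫⁻ x : ℝ, ENNReal.ofReal ((1 + x ^ 2) ^ p * (2 / (1 + (x * b) ^ 2))) ≤
        ENNReal.ofReal (C * b ^ (-(1 + 2 * p))) := by
  have hint : Integrable (fun x : ℝ => (1 + ‖x‖ ^ 2) ^ (-(3 / 2 : ℝ) / 2)) :=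
    integrable_rpow_neg_one_add_norm_sq (by norm_num [Module.finrank_self])
  set J := ∫ x : ℝ, (1 + ‖x‖ ^ 2) ^ (-(3 / 2 : ℝ) / 2) with hJ
  have hJ0 : 0 ≤ J := integral_nonneg fun x => by positivity
  refine ⟨2 * M ^ (1 / 2 : ℝ) * (J + 1), by positivity, fun p hp0 hp b hb hbM => ?_⟩
  have hMb : 1 ≤ M / b := by rwa [le_div_iff₀ hb, one_mul]
  have hpt : ∀ x : ℝ, (1 + x ^ 2) ^ p * (2 / (1 + (x * b) ^ 2)) ≤
      2 * (M / b) ^ (2 * p) * (1 + ‖x * b‖ ^ 2) ^ (-(3 / 2 : ℝ) / 2) := by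
    intro x
    have h1 : 1 + x ^ 2 ≤ (M / b) ^ 2 * (1 + (x * b) ^ 2) := by
      have e : (M / b) ^ 2 * (1 + (x * b) ^ 2) = (M / b) ^ 2 + M ^ 2 * x ^ 2 := by
        field_simp
      rw [e]
      have : 1 ≤ (M / b) ^ 2 := one_le_pow₀ hMb
      have : 1 ≤ M ^ 2 := one_le_pow₀ hM
      nlinarith [sq_nonneg x]
    have h2 : (1 + x ^ 2) ^ p ≤ (M / b) ^ (2 * p) * (1 + (x * b) ^ 2) ^ p := by
      refine (Real.rpow_le_rpow (by positivity) h1 hp0).trans_eq ?_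
      rw [Real.mul_rpow (by positivity) (by positivity), ← Real.rpow_natCast (M / b) 2,
        ← Real.rpow_mul (by positivity)]
      norm_num
    have h3 : (1 + (x * b) ^ 2) ^ p * (1 / (1 + (x * b) ^ 2)) ≤
        (1 + ‖x * b‖ ^ 2) ^ (-(3 / 2 : ℝ) / 2) := by
      have hy : 1 ≤ 1 + (x * b) ^ 2 := by nlinarith [sq_nonneg (x * b)]
      rw [one_div, ← Real.rpow_neg_one, ← Real.rpow_add (by positivity), Real.norm_eq_abs, sq_abs]
      exact Real.rpow_le_rpow_of_exponent_le hy (by linarith)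
    calc _ = 2 * ((1 + x ^ 2) ^ p * (1 / (1 + (x * b) ^ 2))) := by ring
      _ ≤ 2 * (((M / b) ^ (2 * p) * (1 + (x * b) ^ 2) ^ p) * (1 / (1 + (x * b) ^ 2))) := by
          gcongr
      _ = 2 * (M / b) ^ (2 * p) * ((1 + (x * b) ^ 2) ^ p * (1 / (1 + (x * b) ^ 2))) := by ring
      _ ≤ _ := by gcongr
  refine (lintegral_mono fun x => ENNReal.ofReal_le_ofReal (hpt x)).trans ?_
  rw [← ofReal_integral_eq_lintegral_ofReal]
  · apply ENNReal.ofReal_le_ofReal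
    rw [integral_const_mul, Measure.integral_comp_mul_right
      (fun x : ℝ => (1 + ‖x‖ ^ 2) ^ (-(3 / 2 : ℝ) / 2)), ← hJ, abs_of_pos (inv_pos.2 hb),
      smul_eq_mul, Real.div_rpow (by positivity) hb.le]
    have e1 : b ^ (-(1 + 2 * p)) = b⁻¹ * (b ^ (2 * p))⁻¹ := by
      rw [neg_add, Real.rpow_add hb, Real.rpow_neg_one, Real.rpow_neg hb.le]
    have e2 : M ^ (2 * p) ≤ M ^ (1 / 2 : ℝ) :=
      Real.rpow_le_rpow_of_exponent_le hM (by linarith)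
    rw [e1]
    calc 2 * (M ^ (2 * p) / b ^ (2 * p)) * (b⁻¹ * J)
        = 2 * M ^ (2 * p) * J * (b⁻¹ * (b ^ (2 * p))⁻¹) := by ring
      _ ≤ 2 * M ^ (1 / 2 : ℝ) * (J + 1) * (b⁻¹ * (b ^ (2 * p))⁻¹) := by
          gcongr
          linarith
  · exact (hint.comp_mul_right' hb.ne').const_mul _
  · exact Eventually.of_forall fun x => by positivity

end IteratedIntegrals

section LocalNondeterminism

lemma inv_pow_mul_inv_rpow_le {x Δ α : ℝ} (hx : x ≠ 0) (hΔ : 0 < Δ) :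
    ((|x| ^ (if 1 < |x| * Δ ^ α then 2 else 0))⁻¹ *
      (Δ ^ (α * ((if 1 < |x| * Δ ^ α then 2 else 0 : ℕ) : ℝ)))⁻¹) ≤ 2 / (1 + (x * Δ ^ α) ^ 2) := by
  have hpos : 0 < Δ ^ α := Real.rpow_pos_of_pos hΔ α
  have hx' : 0 < |x| := abs_pos.2 hx
  have e : (x * Δ ^ α) ^ 2 = (|x| * Δ ^ α) ^ 2 := by rw [mul_pow, mul_pow, sq_abs]
  rw [e]
  split_ifs with h
  · have : Δ ^ (α * ((2 : ℕ) : ℝ)) = (Δ ^ α) ^ 2 := by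
      rw [Real.rpow_mul hΔ.le, Real.rpow_natCast]
    rw [this, ← mul_inv, ← mul_pow, inv_eq_one_div, div_le_div_iff₀ (by positivity) (by positivity)]
    nlinarith
  · push Not at h
    have h0 : 0 ≤ |x| * Δ ^ α := by positivity
    simp only [pow_zero, Nat.cast_zero, mul_zero, Real.rpow_zero, inv_one, mul_one]
    rw [le_div_iff₀ (by positivity)]
    nlinarith

lemma IsLND.exists_norm_charFun_le {Ω : Type*} [MeasurableSpace Ω] {P : Measure Ω}
    [IsProbabilityMeasure P] {d : ℕ} {Y : ℝ → Ω → EuclideanSpace ℝ (Fin d)} {T α : ℝ}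
    (hY : ∀ t, Measurable (Y t)) (hLND : IsLND P d Y T α) {n : ℕ} (hn : 1 ≤ n) :
    ∃ C : ℝ, 0 < C ∧ ∀ w : Fin n → EuclideanSpace ℝ (Fin d), ∀ τ : Fin (n + 1) → ℝ, 0 < τ 0 →
      StrictMono τ → τ (Fin.last n) ≤ T →
        ‖∫ ω, Complex.exp (((∑ j : Fin n,
            ⟪w j, Y (τ j.succ) ω - Y (τ j.castSucc) ω⟫ : ℝ) : ℂ) * Complex.I) ∂P‖ ≤
          C * ∏ j : Fin n, ∏ l : Fin d,
            2 / (1 + (w j l * (τ j.succ - τ j.castSucc) ^ α) ^ 2) := by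
  choose c hc0 hc using hLND (n + 1) (by omega)
  let K : (Fin n → Fin d → Bool) → Fin (n + 1) → Fin d → ℕ :=
    fun b => Fin.cons (fun _ => 0) (fun j l => if b j l then 2 else 0)
  refine ⟨∑ b, c (K b), Finset.sum_pos (fun b _ => hc0 _) Finset.univ_nonempty,
    fun w τ hτ0 hτ hτT => ?_⟩
  set t : Fin (n + 2) → ℝ := Fin.cons 0 τ with ht
  have htmono : StrictMono t := by
    rw [Fin.strictMono_iff_lt_succ]
    intro i
    refine Fin.cases ?_ (fun j => ?_) i
    · simpa [ht] using hτ0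
    · simpa [ht, ← Fin.succ_castSucc] using hτ (Fin.castSucc_lt_succ (i := j))
  have hΔ : ∀ j : Fin n, 0 < τ j.succ - τ j.castSucc := fun j =>
    sub_pos.2 (hτ (Fin.castSucc_lt_succ (i := j)))
  have main : ∀ v : Fin (n + 1) → EuclideanSpace ℝ (Fin d), (∀ j l, v j l ≠ 0) →
      ‖∫ ω, Complex.exp (((∑ j : Fin (n + 1),
            ⟪v j, Y (t j.succ) ω - Y (t j.castSucc) ω⟫ : ℝ) : ℂ) * Complex.I) ∂P‖ ≤
          (∑ b, c (K b)) * ∏ j : Fin n, ∏ l : Fin d,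
            2 / (1 + (v j.succ l * (τ j.succ - τ j.castSucc) ^ α) ^ 2) := by
    intro v hv
    let b : Fin n → Fin d → Bool :=
      fun j l => decide (1 < |v j.succ l| * (τ j.succ - τ j.castSucc) ^ α)
    have h := hc (K b) v hv t (by simp [ht]) htmono
      (by rw [ht, ← Fin.succ_last, Fin.cons_succ]; exact hτT)
    have e : (fun ω => Complex.exp (((∑ j : Fin (n + 1),
            ⟪v j, Y (t j.succ) ω - Y (t j.castSucc) ω⟫ : ℝ) : ℂ) * Complex.I)) =
        fun ω => Complex.exp (Complex.I * ((∑ j : Fin (n + 1),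
          (⟪v j, Y (t j.succ) ω - Y (t j.castSucc) ω⟫ : ℝ)) : ℂ)) := by
      ext ω; rw [mul_comm]; push_cast; rfl
    rw [e]
    refine h.trans ?_
    have hprod : (∏ j : Fin (n + 1), ∏ l : Fin d,
            (|v j l| ^ K b j l)⁻¹ * ((t j.succ - t j.castSucc) ^ (α * (K b j l : ℝ)))⁻¹) ≤
        ∏ j : Fin n, ∏ l : Fin d,
            2 / (1 + (v j.succ l * (τ j.succ - τ j.castSucc) ^ α) ^ 2) := by
      rw [Fin.prod_univ_succ]
      have h0 : (∏ l : Fin d, (|v 0 l| ^ K b 0 l)⁻¹ *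
          ((t (Fin.succ 0) - t (Fin.castSucc 0)) ^ (α * (K b 0 l : ℝ)))⁻¹) = 1 := by
        simp [K]
      rw [h0, one_mul]
      refine Finset.prod_le_prod (fun j _ => Finset.prod_nonneg fun l _ => ?_)
        (fun j _ => Finset.prod_le_prod (fun l _ => ?_) fun l _ => ?_)
      · have := sub_pos.2 (htmono (Fin.castSucc_lt_succ (i := j.succ)))
        positivity
      · have := sub_pos.2 (htmono (Fin.castSucc_lt_succ (i := j.succ)))
        positivity
      · have := inv_pow_mul_inv_rpow_le (α := α) (hv j.succ l) (hΔ j)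
        simpa [K, b, ht, ← Fin.succ_castSucc] using this
    have hle : c (K b) ≤ ∑ b, c (K b) :=
      Finset.single_le_sum (f := fun b => c (K b)) (fun b _ => (hc0 _).le) (Finset.mem_univ b)
    calc _ ≤ c (K b) * ∏ j : Fin n, ∏ l : Fin d,
            2 / (1 + (v j.succ l * (τ j.succ - τ j.castSucc) ^ α) ^ 2) :=
          mul_le_mul_of_nonneg_left hprod (hc0 _).le
      _ ≤ _ := mul_le_mul_of_nonneg_right hle
          (Finset.prod_nonneg fun j _ => Finset.prod_nonneg fun l _ => by positivity)
  -- perturb the frequencies to have nonzero coordinates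
  let o : EuclideanSpace ℝ (Fin d) := WithLp.toLp 2 (fun _ => 1)
  let v : ℝ → Fin (n + 1) → EuclideanSpace ℝ (Fin d) := fun ε j =>
    (Fin.cons 0 w : Fin (n + 1) → EuclideanSpace ℝ (Fin d)) j + ε • o
  have hv : ∀ᶠ ε in nhdsWithin (0 : ℝ) {0}ᶜ, ∀ j l, v ε j l ≠ 0 := by
    rw [eventually_all]; intro j
    rw [eventually_all]; intro l
    set x := (Fin.cons 0 w : Fin (n + 1) → EuclideanSpace ℝ (Fin d)) j l with hx
    have hval : ∀ ε, v ε j l = x + ε := fun ε => by simp [v, o, hx]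
    simp_rw [hval]
    by_cases hx0 : x = 0
    · filter_upwards [self_mem_nhdsWithin] with ε hε
      rw [hx0, zero_add]; exact hε
    · have : ∀ᶠ ε in nhds (0 : ℝ), x + ε ≠ 0 :=
        (Continuous.continuousAt (by fun_prop)).eventually_ne (by simpa using hx0)
      exact this.filter_mono nhdsWithin_le_nhds
  have hcont1 : Continuous fun ε => ‖∫ ω, Complex.exp (((∑ j : Fin (n + 1),
            ⟪v ε j, Y (t j.succ) ω - Y (t j.castSucc) ω⟫ : ℝ) : ℂ) * Complex.I) ∂P‖ := by
    refine continuous_norm.comp (continuous_of_dominated (bound := fun _ => 1) ?_ ?_ ?_ ?_)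
    · intro ε
      apply Measurable.aestronglyMeasurable
      fun_prop
    · intro ε
      refine Eventually.of_forall fun ω => ?_
      rw [Complex.norm_exp_ofReal_mul_I]
    · exact integrable_const _
    · refine Eventually.of_forall fun ω => ?_
      fun_prop
  have hcont2 : Continuous fun ε => (∑ b, c (K b)) * ∏ j : Fin n, ∏ l : Fin d,
            2 / (1 + (v ε j.succ l * (τ j.succ - τ j.castSucc) ^ α) ^ 2) := by
    refine continuous_const.mul (continuous_finsetProd _ fun j _ =>
      continuous_finsetProd _ fun l _ => ?_)
    refine Continuous.div continuous_const ?_ (fun ε => by positivity)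
    fun_prop
  have hlim := le_of_tendsto_of_tendsto
    ((hcont1.tendsto 0).mono_left (nhdsWithin_le_nhds (s := {0}ᶜ)))
    ((hcont2.tendsto 0).mono_left (nhdsWithin_le_nhds (s := {0}ᶜ)))
    (hv.mono fun ε hε => main (v ε) hε)
  simpa [v, Fin.sum_univ_succ, ht, ← Fin.succ_castSucc] using hlim

end LocalNondeterminism

section FourierBound

lemma sub_eq_sum_increments {V : Type*} [AddCommGroup V] {n : ℕ} (y : Fin (n + 1) → V) (i : Fin n) :
    y i.succ - y 0 = ∑ j : Fin n, if j ≤ i then y j.succ - y j.castSucc else 0 := by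
  induction n with
  | zero => exact i.elim0
  | succ n ih =>
    rw [Fin.sum_univ_succ]
    refine Fin.cases ?_ (fun k => ?_) i
    · simp
    · have := ih (fun j => y j.succ) k
      simp only [Fin.zero_le, if_true, Fin.succ_le_succ_iff, Fin.castSucc_zero,
        ← Fin.succ_castSucc, ← this, Fin.succ_zero_eq_one]
      abel

lemma sum_inner_sub_zero {V : Type*} [NormedAddCommGroup V] [InnerProductSpace ℝ V] {n : ℕ}
    (u : Fin n → V) (y : Fin (n + 1) → V) :
    ∑ i, ⟪u i, y i.succ - y 0⟫ =
      ∑ j : Fin n, ⟪∑ i, if j ≤ i then u i else 0, y j.succ - y j.castSucc⟫ := by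
  simp_rw [sub_eq_sum_increments y, inner_sum, sum_inner]
  rw [Finset.sum_comm]
  refine Finset.sum_congr rfl fun j _ => Finset.sum_congr rfl fun i _ => ?_
  split_ifs <;> simp

lemma prod_norm_sq_le_prod_suffix {V : Type*} [NormedAddCommGroup V] {n : ℕ} (u : Fin n → V) :
    (1 + ‖∑ i, u i‖ ^ 2) * ∏ j, ‖u j‖ ^ 2 ≤
      2 ^ n * ∏ j, (1 + ‖∑ i, if j ≤ i then u i else 0‖ ^ 2) ^ 2 := by
  induction n with
  | zero => simp
  | succ n ih =>
    have h := ih (fun j => u j.succ)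
    rw [Fin.prod_univ_succ, Fin.prod_univ_succ]
    simp only [Fin.zero_le, if_true, Fin.sum_univ_succ (fun i => u i)]
    have e : ∀ j : Fin n, (∑ i, if j.succ ≤ i then u i else 0) =
        ∑ i : Fin n, if j ≤ i then u i.succ else 0 := by
      intro j; simp [Fin.sum_univ_succ]
    simp_rw [e]
    set S := ∑ i : Fin n, u i.succ
    set Q := ∏ j : Fin n, (1 + ‖∑ i : Fin n, if j ≤ i then u i.succ else 0‖ ^ 2) ^ 2
    set R := ∏ j : Fin n, ‖u j.succ‖ ^ 2
    have hx : ‖u 0‖ ^ 2 ≤ 2 * (1 + ‖u 0 + S‖ ^ 2) * (1 + ‖S‖ ^ 2) := by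
      have h1 : ‖u 0‖ ≤ ‖u 0 + S‖ + ‖S‖ := by
        simpa using norm_sub_le (u 0 + S) S
      have h2 : ‖u 0‖ ^ 2 ≤ (‖u 0 + S‖ + ‖S‖) ^ 2 := by gcongr
      nlinarith [sq_nonneg (‖u 0 + S‖ - ‖S‖), mul_nonneg (sq_nonneg ‖u 0 + S‖) (sq_nonneg ‖S‖)]
    have hR : 0 ≤ R := Finset.prod_nonneg fun j _ => by positivity
    calc (1 + ‖u 0 + S‖ ^ 2) * (‖u 0‖ ^ 2 * R)
        ≤ (1 + ‖u 0 + S‖ ^ 2) * ((2 * (1 + ‖u 0 + S‖ ^ 2) * (1 + ‖S‖ ^ 2)) * R) := by gcongr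
      _ = 2 * (1 + ‖u 0 + S‖ ^ 2) ^ 2 * ((1 + ‖S‖ ^ 2) * R) := by ring
      _ ≤ 2 * (1 + ‖u 0 + S‖ ^ 2) ^ 2 * (2 ^ n * Q) := by gcongr
      _ = _ := by ring

lemma one_add_sum_le_prod {ι : Type*} (s : Finset ι) {x : ι → ℝ} (hx : ∀ i, 0 ≤ x i) :
    1 + ∑ i ∈ s, x i ≤ ∏ i ∈ s, (1 + x i) := by
  classical
  induction s using Finset.induction_on with
  | empty => simp
  | insert a s ha ih =>
    rw [Finset.sum_insert ha, Finset.prod_insert ha]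
    have h1 : 0 ≤ ∑ i ∈ s, x i := Finset.sum_nonneg fun i _ => hx i
    nlinarith [hx a, mul_nonneg (hx a) h1]

lemma prod_abs_le_of_le_norm_sq_rpow {d n : ℕ} {D κ : ℝ} (hD : 0 ≤ D) (hκ0 : 0 ≤ κ) (hκ : κ ≤ 1)
    {g : EuclideanSpace ℝ (Fin d) → ℝ} (hg : ∀ u, |g u| ≤ D * (‖u‖ ^ 2) ^ κ)
    (u : Fin n → EuclideanSpace ℝ (Fin d)) :
    ∏ j, |g (u j)| ≤ 2 ^ n * D ^ n *
      ∏ j, ∏ l, (1 + (∑ i, if j ≤ i then u i else 0 : EuclideanSpace ℝ (Fin d)) l ^ 2) ^ (2 * κ) := by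
  have h1 : ∏ j, |g (u j)| ≤ D ^ n * (∏ j, ‖u j‖ ^ 2) ^ κ := by
    calc ∏ j, |g (u j)| ≤ ∏ j, D * (‖u j‖ ^ 2) ^ κ :=
          Finset.prod_le_prod (fun _ _ => abs_nonneg _) fun j _ => hg _
      _ = D ^ n * (∏ j, ‖u j‖ ^ 2) ^ κ := by
          rw [Finset.prod_mul_distrib, Real.finsetProd_rpow _ _ (fun j _ => by positivity)]
          simp
  have h2 : ∏ j, ‖u j‖ ^ 2 ≤
      2 ^ n * ∏ j, (1 + ‖∑ i, if j ≤ i then u i else 0‖ ^ 2) ^ 2 := by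
    refine le_trans ?_ (prod_norm_sq_le_prod_suffix u)
    have : 0 ≤ ∏ j, ‖u j‖ ^ 2 := Finset.prod_nonneg fun j _ => by positivity
    nlinarith [mul_nonneg (sq_nonneg ‖∑ i, u i‖) this]
  have h3 : (∏ j, ‖u j‖ ^ 2) ^ κ ≤ 2 ^ n *
      ∏ j, ∏ l, (1 + (∑ i, if j ≤ i then u i else 0 : EuclideanSpace ℝ (Fin d)) l ^ 2) ^ (2 * κ) := by
    refine (Real.rpow_le_rpow (Finset.prod_nonneg fun j _ => by positivity) h2 hκ0).trans ?_
    rw [Real.mul_rpow (by positivity) (Finset.prod_nonneg fun j _ => by positivity),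
      ← Real.finsetProd_rpow _ _ (fun j _ => by positivity)]
    have e1 : ((2 : ℝ) ^ n) ^ κ ≤ 2 ^ n := by
      conv_rhs => rw [← Real.rpow_one ((2 : ℝ) ^ n)]
      exact Real.rpow_le_rpow_of_exponent_le (one_le_pow₀ (by norm_num)) hκ
    refine mul_le_mul e1 (Finset.prod_le_prod (fun j _ => by positivity) fun j _ => ?_)
      (Finset.prod_nonneg fun j _ => by positivity) (by positivity)
    rw [← Real.rpow_natCast _ 2, ← Real.rpow_mul (by positivity),
      Real.finsetProd_rpow _ _ (fun l _ => by positivity)]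
    refine Real.rpow_le_rpow (by positivity) ?_ (by positivity)
    rw [EuclideanSpace.norm_sq_eq]
    simp_rw [Real.norm_eq_abs, sq_abs]
    exact one_add_sum_le_prod _ fun i => sq_nonneg _
  calc _ ≤ _ := h1
    _ ≤ _ := mul_le_mul_of_nonneg_left h3 (by positivity)
    _ = _ := by ring

lemma lintegral_euclidean_prod {d : ℕ} {h : ℝ → ℝ≥0∞} (hh : Measurable h) :
    ∫⁻ v : EuclideanSpace ℝ (Fin d), ∏ l, h (v l) = (∫⁻ x, h x) ^ d := by
  have := (PiLp.volume_preserving_ofLp (Fin d)).lintegral_comp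
    (f := fun v : Fin d → ℝ => ∏ l, h (v l)) (by fun_prop)
  rw [this]
  have h2 := lintegral_fin_prod (volume : Measure ℝ) (n := d) (h := fun _ => h) (fun _ => hh)
  rw [volume_pi, h2]
  simp

lemma IsLND.exists_norm_integral_prod_le {Ω : Type*} [MeasurableSpace Ω] {P : Measure Ω}
    [IsProbabilityMeasure P] {d : ℕ} {Y : ℝ → Ω → EuclideanSpace ℝ (Fin d)} {T α : ℝ}
    (hα0 : 0 < α)
    (hY : ∀ t, Measurable (Y t)) (hLND : IsLND P d Y T α) {n : ℕ} (hn : 1 ≤ n) {κ : ℝ}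
    (hκ0 : 0 ≤ κ) (hκ : κ ≤ 1 / 8) :
    ∃ C : ℝ, 0 < C ∧ ∀ (f g : EuclideanSpace ℝ (Fin d) → ℝ) (D : ℝ), 0 ≤ D →
      (∀ u, |g u| ≤ D * (‖u‖ ^ 2) ^ κ) → Integrable g →
      (∀ z, (f z : ℂ) = ∫ u, Complex.exp ((⟪u, z⟫ : ℝ) * Complex.I) * (g u : ℂ)) →
      ∀ (τ : Fin (n + 1) → ℝ), 0 < τ 0 → StrictMono τ → τ (Fin.last n) ≤ T →
      ∀ x, |∫ ω, ∏ j : Fin n, f (x - (Y (τ j.succ) ω - Y (τ 0) ω)) ∂P| ≤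
        C * D ^ n * ∏ j : Fin n, (τ j.succ - τ j.castSucc) ^ (-(d * α * (1 + 4 * κ))) := by
  obtain ⟨C0, hC0, hchar⟩ := hLND.exists_norm_charFun_le hY hn
  obtain ⟨C1, hC1, hjap⟩ := exists_lintegral_japanese_le (max 1 (T ^ α)) (le_max_left _ _)
  refine ⟨C0 * 2 ^ n * (C1 ^ d) ^ n, by positivity, ?_⟩
  intro f g D hD hg hgi hf τ hτ0 hτ hτT x
  have hΔ : ∀ j : Fin n, 0 < τ j.succ - τ j.castSucc := fun j =>
    sub_pos.2 (hτ (Fin.castSucc_lt_succ (i := j)))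
  have hΔT : ∀ j : Fin n, τ j.succ - τ j.castSucc ≤ T := fun j => by
    have h1 : τ j.succ ≤ τ (Fin.last n) := hτ.monotone (Fin.le_last _)
    have h2 : τ 0 ≤ τ j.castSucc := hτ.monotone (Fin.zero_le _)
    linarith
  -- Fourier representation of the product
  let Φ : Ω → (Fin n → EuclideanSpace ℝ (Fin d)) → ℂ := fun ω u =>
    ∏ j, (Complex.exp ((⟪u j, x - (Y (τ j.succ) ω - Y (τ 0) ω)⟫ : ℝ) * Complex.I) * (g (u j) : ℂ))
  have hrep : ∀ ω, ((∏ j : Fin n, f (x - (Y (τ j.succ) ω - Y (τ 0) ω)) : ℝ) : ℂ) =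
      ∫ u, Φ ω u := by
    intro ω
    rw [integral_fintype_prod_volume_eq_prod (fun (j : Fin n) (v : EuclideanSpace ℝ (Fin d)) =>
      Complex.exp ((⟪v, x - (Y (τ j.succ) ω - Y (τ 0) ω)⟫ : ℝ) * Complex.I) * (g v : ℂ))]
    push_cast
    exact Finset.prod_congr rfl fun j _ => hf _
  have hΦnorm : ∀ ω u, ‖Φ ω u‖ = ∏ j, |g (u j)| := by
    intro ω u
    simp only [Φ, norm_prod, norm_mul, Complex.norm_exp_ofReal_mul_I, one_mul, Complex.norm_real,
      Real.norm_eq_abs]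
  have hgpi : Integrable fun u : Fin n → EuclideanSpace ℝ (Fin d) => ∏ j, |g (u j)| :=
    Integrable.fintype_prod (f := fun (_ : Fin n) v => |g v|) (fun _ => hgi.abs)
  have hΦint : Integrable (Function.uncurry Φ) (P.prod volume) := by
    refine Integrable.mono' (hgpi.comp_snd P) ?_ (Eventually.of_forall fun p => ?_)
    · refine Finset.aestronglyMeasurable_fun_prod _ fun j _ => ?_
      refine AEStronglyMeasurable.mul ?_ ?_
      · apply Measurable.aestronglyMeasurable
        fun_prop
      · have hq : Measure.QuasiMeasurePreserving (fun p : Ω × (Fin n → EuclideanSpace ℝ (Fin d)) =>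
            p.2 j) (P.prod volume) volume :=
          (Measure.quasiMeasurePreserving_eval _ j).comp Measure.quasiMeasurePreserving_snd
        exact (hgi.ofReal.aestronglyMeasurable.comp_quasiMeasurePreserving hq)
    · exact (hΦnorm p.1 p.2).le
  have hswap : ((∫ ω, ∏ j : Fin n, f (x - (Y (τ j.succ) ω - Y (τ 0) ω)) ∂P : ℝ) : ℂ) =
      ∫ u, ∫ ω, Φ ω u ∂P := by
    rw [← integral_complex_ofReal, ← integral_integral_swap hΦint]
    exact integral_congr_ae (Eventually.of_forall hrep)
  -- pointwise bound in the frequencies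
  let S : Fin n → (Fin n → EuclideanSpace ℝ (Fin d)) → EuclideanSpace ℝ (Fin d) := fun j u =>
    ∑ i, if j ≤ i then u i else 0
  have hinner : ∀ u, ‖∫ ω, Φ ω u ∂P‖ ≤ (∏ j, |g (u j)|) * (C0 * ∏ j : Fin n, ∏ l : Fin d,
      2 / (1 + (S j u l * (τ j.succ - τ j.castSucc) ^ α) ^ 2)) := by
    intro u
    have e : ∀ ω, Φ ω u = (∏ j, (Complex.exp ((⟪u j, x⟫ : ℝ) * Complex.I) * (g (u j) : ℂ))) *
        Complex.exp (((∑ j : Fin n,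
            ⟪-(S j u), Y (τ j.succ) ω - Y (τ j.castSucc) ω⟫ : ℝ) : ℂ) * Complex.I) := by
      intro ω
      have h1 : (∑ j : Fin n, ⟪-(S j u), Y (τ j.succ) ω - Y (τ j.castSucc) ω⟫ : ℝ) =
          ∑ j, -⟪u j, Y (τ j.succ) ω - Y (τ 0) ω⟫ := by
        have := sum_inner_sub_zero u (fun j => Y (τ j) ω)
        rw [Finset.sum_neg_distrib, this]
        simp_rw [inner_neg_left, Finset.sum_neg_distrib]
        rfl
      rw [h1, Complex.ofReal_sum, Finset.sum_mul, Complex.exp_sum, ← Finset.prod_mul_distrib]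
      refine Finset.prod_congr rfl fun j _ => ?_
      rw [inner_sub_right, mul_right_comm, ← Complex.exp_add]
      congr 2
      push_cast
      ring
    simp_rw [e]
    rw [integral_const_mul, norm_mul]
    have h2 : ‖∏ j, (Complex.exp ((⟪u j, x⟫ : ℝ) * Complex.I) * (g (u j) : ℂ))‖ =
        ∏ j, |g (u j)| := by
      simp only [norm_prod, norm_mul, Complex.norm_exp_ofReal_mul_I, one_mul, Complex.norm_real,
        Real.norm_eq_abs]
    rw [h2]
    refine mul_le_mul_of_nonneg_left ?_ (Finset.prod_nonneg fun j _ => abs_nonneg _)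
    have := hchar (fun j => -(S j u)) τ hτ0 hτ hτT
    simpa using this
  let h : Fin n → ℝ → ℝ≥0∞ := fun j y => ENNReal.ofReal
    ((1 + y ^ 2) ^ (2 * κ) * (2 / (1 + (y * (τ j.succ - τ j.castSucc) ^ α) ^ 2)))
  have hh : ∀ j, Measurable (h j) := fun j => by fun_prop
  have hpt : ∀ u, ‖∫ ω, Φ ω u ∂P‖ₑ ≤ ENNReal.ofReal (C0 * 2 ^ n * D ^ n) *
      ∏ j, ∏ l, h j (S j u l) := by
    intro u
    rw [← ofReal_norm]
    have hb := prod_abs_le_of_le_norm_sq_rpow hD hκ0 (by linarith) hg u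
    calc ENNReal.ofReal ‖∫ ω, Φ ω u ∂P‖ ≤ ENNReal.ofReal ((C0 * 2 ^ n * D ^ n) *
          ∏ j, ∏ l, ((1 + (S j u l) ^ 2) ^ (2 * κ) *
            (2 / (1 + (S j u l * (τ j.succ - τ j.castSucc) ^ α) ^ 2)))) := by
          apply ENNReal.ofReal_le_ofReal
          refine (hinner u).trans ((mul_le_mul_of_nonneg_right hb ?_).trans_eq ?_)
          · exact mul_nonneg hC0.le
              (Finset.prod_nonneg fun j _ => Finset.prod_nonneg fun l _ => by positivity)
          · simp_rw [Finset.prod_mul_distrib, S]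
            ring
      _ = _ := by
          rw [ENNReal.ofReal_mul (by positivity), ENNReal.ofReal_prod_of_nonneg
            (fun j _ => Finset.prod_nonneg fun l _ => by positivity)]
          congr 1
          refine Finset.prod_congr rfl fun j _ => ?_
          rw [ENNReal.ofReal_prod_of_nonneg (fun l _ => by positivity)]
  have hfin : ∫⁻ u, ‖∫ ω, Φ ω u ∂P‖ₑ ≤ ENNReal.ofReal (C0 * 2 ^ n * (C1 ^ d) ^ n * D ^ n *
      ∏ j : Fin n, (τ j.succ - τ j.castSucc) ^ (-(d * α * (1 + 4 * κ)))) := by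
    calc ∫⁻ u, ‖∫ ω, Φ ω u ∂P‖ₑ ≤ ∫⁻ u, ENNReal.ofReal (C0 * 2 ^ n * D ^ n) *
          ∏ j, ∏ l, h j (S j u l) := lintegral_mono hpt
      _ = ENNReal.ofReal (C0 * 2 ^ n * D ^ n) * ∏ j, (∫⁻ y, h j y) ^ d := by
          rw [lintegral_const_mul' _ _ ENNReal.ofReal_ne_top]
          congr 1
          have := lintegral_prod_suffix_sum (volume : Measure (EuclideanSpace ℝ (Fin d)))
            (h := fun j v => ∏ l, h j (v l)) (fun j => by fun_prop)
          rw [volume_pi, this]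
          exact Finset.prod_congr rfl fun j _ => lintegral_euclidean_prod (hh j)
      _ ≤ ENNReal.ofReal (C0 * 2 ^ n * D ^ n) *
          ∏ j : Fin n, (ENNReal.ofReal (C1 * ((τ j.succ - τ j.castSucc) ^ α) ^
            (-(1 + 2 * (2 * κ))))) ^ d := by
          gcongr with j
          refine hjap (2 * κ) (by positivity) (by linarith) _ (Real.rpow_pos_of_pos (hΔ j) _) ?_
          exact le_max_of_le_right (Real.rpow_le_rpow (hΔ j).le (hΔT j) hα0.le)
      _ = _ := by
          have e : ∀ j : Fin n, (ENNReal.ofReal (C1 * ((τ j.succ - τ j.castSucc) ^ α) ^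
              (-(1 + 2 * (2 * κ))))) ^ d = ENNReal.ofReal (C1 ^ d *
                (τ j.succ - τ j.castSucc) ^ (-(d * α * (1 + 4 * κ)))) := by
            intro j
            rw [← ENNReal.ofReal_pow (mul_nonneg hC1.le (Real.rpow_nonneg
              (Real.rpow_nonneg (hΔ j).le _) _)), mul_pow, ← Real.rpow_mul (hΔ j).le,
              ← Real.rpow_natCast (_ ^ (_ : ℝ)) d, ← Real.rpow_mul (hΔ j).le]
            congr 3
            ring
          simp_rw [e]
          rw [← ENNReal.ofReal_prod_of_nonneg (fun j _ => mul_nonneg (by positivity)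
            (Real.rpow_nonneg (hΔ j).le _)), ← ENNReal.ofReal_mul (by positivity),
            Finset.prod_mul_distrib]
          congr 1
          simp only [Finset.prod_const, Finset.card_univ, Fintype.card_fin]
          ring
  have hnn : 0 ≤ C0 * 2 ^ n * (C1 ^ d) ^ n * D ^ n *
      ∏ j : Fin n, (τ j.succ - τ j.castSucc) ^ (-(d * α * (1 + 4 * κ))) :=
    mul_nonneg (by positivity) (Finset.prod_nonneg fun j _ => Real.rpow_nonneg (hΔ j).le _)
  refine (ENNReal.ofReal_le_ofReal_iff hnn).1 ?_
  rw [← Real.norm_eq_abs, ← Complex.norm_real, hswap, ofReal_norm]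
  exact (enorm_integral_le_lintegral_enorm _).trans hfin

end FourierBound

section MomentBound

lemma abs_prod_le_abs_mul_pow {X : Type*} {f : X → ℝ} {M : ℝ} (hM : ∀ x, |f x| ≤ M) {n : ℕ}
    (y : Fin (n + 1) → X) : |∏ j, f (y j)| ≤ |f (y 0)| * M ^ n := by
  rw [Fin.prod_univ_succ, abs_mul, Finset.abs_prod]
  gcongr
  calc ∏ j : Fin n, |f (y j.succ)| ≤ ∏ _j : Fin n, M :=
        Finset.prod_le_prod (fun _ _ => abs_nonneg _) (fun _ _ => hM _)
    _ = M ^ n := by simp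

variable {Ω : Type*} [MeasurableSpace Ω] {P : Measure Ω} [IsProbabilityMeasure P]
  {E : Type*} [NormedAddCommGroup E] [InnerProductSpace ℝ E] [FiniteDimensional ℝ E]
  [MeasurableSpace E] [BorelSpace E]

lemma measurePreserving_prod_sub {Z : Ω → E} (hZ : Measurable Z) :
    MeasurePreserving (fun z : Ω × E => (z.1, z.2 - Z z.1)) (P.prod volume) (P.prod volume) := by
  refine (MeasurePreserving.id P).skew_product (g := fun ω x => x - Z ω) ?_ ?_
  · show Measurable fun z : Ω × E => z.2 - Z z.1
    fun_prop
  · exact Eventually.of_forall fun ω => (measurePreserving_sub_right volume (Z ω)).map_eq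

lemma integrable_prod_comp_sub {f : E → ℝ} (hfi : Integrable f) {Z : Ω → E} (hZ : Measurable Z) :
    Integrable (fun z : Ω × E => f (z.2 - Z z.1)) (P.prod volume) :=
  (measurePreserving_prod_sub hZ).integrable_comp_of_integrable (hfi.comp_snd P)

lemma integrable_prod_prod_comp_sub {f : E → ℝ} (hfi : Integrable f) (hfc : Continuous f) {M : ℝ}
    (hM : ∀ x, |f x| ≤ M) {n : ℕ} {Z : Fin (n + 1) → Ω → E} (hZ : ∀ j, Measurable (Z j)) :
    Integrable (fun z : Ω × E => ∏ j, f (z.2 - Z j z.1)) (P.prod volume) := by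
  refine ((integrable_prod_comp_sub (P := P) hfi (hZ 0)).abs.mul_const (M ^ n)).mono'
    ?_ (Eventually.of_forall fun z => ?_)
  · have := hfc.measurable
    have : ∀ j, Measurable (Z j) := hZ
    exact Measurable.aestronglyMeasurable (by fun_prop)
  · exact abs_prod_le_abs_mul_pow hM _

lemma abs_integral_prod_le_of_strictMono {f : E → ℝ} (hfi : Integrable f) (hfc : Continuous f)
    {M : ℝ} (hM : ∀ x, |f x| ≤ M) {n : ℕ} {Z : Fin (n + 1) → Ω → E} (hZ : ∀ j, Measurable (Z j))
    {B : ℝ} (hB : ∀ x, |∫ ω, ∏ j : Fin n, f (x - (Z j.succ ω - Z 0 ω)) ∂P| ≤ B) :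
    |∫ z : Ω × E, ∏ j, f (z.2 - Z j z.1) ∂(P.prod volume)| ≤ (∫ x, |f x|) * B := by
  have hm := hfc.measurable
  have hint : Integrable (Function.uncurry fun (ω : Ω) (x : E) =>
      f x * ∏ j : Fin n, f (x - (Z j.succ ω - Z 0 ω))) (P.prod volume) := by
    refine ((hfi.comp_snd P).abs.mul_const (M ^ n)).mono' ?_ (Eventually.of_forall fun z => ?_)
    · refine Measurable.aestronglyMeasurable ?_
      simp only [Function.uncurry_def]
      fun_prop
    · simpa [Fin.prod_univ_succ, Function.uncurry_def, abs_mul, Finset.abs_prod] using abs_prod_le_abs_mul_pow hM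
        (Fin.cons z.2 fun j : Fin n => z.2 - (Z j.succ z.1 - Z 0 z.1))
  have key : ∫ z : Ω × E, ∏ j, f (z.2 - Z j z.1) ∂(P.prod volume) =
      ∫ x, f x * ∫ ω, ∏ j : Fin n, f (x - (Z j.succ ω - Z 0 ω)) ∂P := by
    rw [integral_prod _ (integrable_prod_prod_comp_sub hfi hfc hM hZ)]
    simp_rw [← integral_const_mul]
    rw [← integral_integral_swap hint]
    refine integral_congr_ae (Eventually.of_forall fun ω => ?_)
    simp only
    rw [← integral_add_right_eq_self _ (Z 0 ω)]
    refine integral_congr_ae (Eventually.of_forall fun x => ?_)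
    simp only [Fin.prod_univ_succ, add_sub_cancel_right]
    congr 1
    refine Finset.prod_congr rfl fun j _ => ?_
    congr 1
    abel
  rw [key, ← integral_mul_const, ← Real.norm_eq_abs]
  refine norm_integral_le_of_norm_le (hfi.abs.mul_const B) (Eventually.of_forall fun x => ?_)
  rw [Real.norm_eq_abs, abs_mul]
  exact mul_le_mul_of_nonneg_left (hB x) (abs_nonneg _)

lemma abs_integral_prod_le_sum_perm {f : E → ℝ} (hfi : Integrable f) (hfc : Continuous f)
    {M : ℝ} (hM : ∀ x, |f x| ≤ M) {Y : ℝ → Ω → E} (hY : ∀ t, Measurable (Y t)) {n : ℕ} {B β T : ℝ}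
    (hB0 : 0 ≤ B)
    (hB : ∀ τ : Fin (n + 1) → ℝ, 0 < τ 0 → StrictMono τ → τ (Fin.last n) ≤ T → ∀ x,
      |∫ ω, ∏ j : Fin n, f (x - (Y (τ j.succ) ω - Y (τ 0) ω)) ∂P| ≤
        B * ∏ j : Fin n, (τ j.succ - τ j.castSucc) ^ (-β))
    {t : Fin (n + 1) → ℝ} (htinj : Function.Injective t) (ht : ∀ j, t j ∈ Ioc 0 T) :
    |∫ z : Ω × E, ∏ j, f (z.2 - Y (t j) z.1) ∂(P.prod volume)| ≤
      (∫ x, |f x|) * B * ∑ σ : Equiv.Perm (Fin (n + 1)),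
        ∏ j : Fin n, |t (σ j.castSucc) - t (σ j.succ)| ^ (-β) := by
  set σ := Tuple.sort t
  have hmono : StrictMono (t ∘ σ) :=
    (Tuple.monotone_sort t).strictMono_of_injective (htinj.comp σ.injective)
  have hperm : ∀ z : Ω × E, ∏ j, f (z.2 - Y (t j) z.1) = ∏ j, f (z.2 - Y ((t ∘ σ) j) z.1) :=
    fun z => (Equiv.prod_comp σ fun j => f (z.2 - Y (t j) z.1)).symm
  simp_rw [hperm]
  refine (abs_integral_prod_le_of_strictMono hfi hfc hM (fun j => hY _)
    (hB (t ∘ σ) (ht _).1 hmono (ht _).2)).trans ?_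
  rw [← mul_assoc]
  refine mul_le_mul_of_nonneg_left ?_ (mul_nonneg (integral_nonneg fun _ => abs_nonneg _) hB0)
  refine le_trans (le_of_eq ?_) (Finset.single_le_sum (f := fun σ : Equiv.Perm (Fin (n + 1)) =>
    ∏ j : Fin n, |t (σ j.castSucc) - t (σ j.succ)| ^ (-β))
    (fun _ _ => Finset.prod_nonneg fun _ _ => by positivity) (Finset.mem_univ σ))
  refine Finset.prod_congr rfl fun j _ => ?_
  congr 1
  have := hmono (Fin.castSucc_lt_succ (i := j))
  simp only [Function.comp_apply] at this ⊢
  rw [abs_sub_comm, abs_of_pos (sub_pos.2 this)]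

lemma ae_injective_pi_restrict {ι : Type*} [Fintype ι] (s : Set ℝ) :
    ∀ᵐ t ∂(Measure.pi fun _ : ι => (volume : Measure ℝ).restrict s), Function.Injective t := by
  classical
  have h : ∀ i j : ι, i ≠ j → ∀ᵐ t ∂(volume : Measure (ι → ℝ)), t i ≠ t j := by
    intro i j hij
    have hker : (LinearMap.ker (LinearMap.proj (R := ℝ) (φ := fun _ : ι => ℝ) i -
        LinearMap.proj j)) ≠ ⊤ := by
      intro htop
      have : Pi.single i (1 : ℝ) ∈ LinearMap.ker (LinearMap.proj (R := ℝ) (φ := fun _ : ι => ℝ) i -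
        LinearMap.proj j) := htop ▸ Submodule.mem_top
      simp [LinearMap.mem_ker, Ne.symm hij] at this
    have := Measure.addHaar_submodule (volume : Measure (ι → ℝ)) _ hker
    rw [ae_iff]
    convert this using 2
    ext t
    simp [LinearMap.mem_ker, sub_eq_zero]
  have h' : ∀ᵐ t ∂(volume : Measure (ι → ℝ)), Function.Injective t := by
    have : ∀ᵐ t ∂(volume : Measure (ι → ℝ)), ∀ i j : ι, i ≠ j → t i ≠ t j := by
      simp only [ae_all_iff]
      exact h
    filter_upwards [this] with t ht i j hij
    by_contra hne
    exact ht i j hne hij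
  rw [← Measure.restrict_pi_pi, ← volume_pi]
  exact ae_restrict_of_ae h'

lemma lintegral_sum_perm_le (μ : Measure ℝ) [SigmaFinite μ] {β : ℝ} {A : ℝ≥0∞}
    (hA : ∀ t, ∫⁻ s, ENNReal.ofReal (|t - s| ^ (-β)) ∂μ ≤ A) (n : ℕ) :
    ∫⁻ t : Fin (n + 1) → ℝ, ∑ σ : Equiv.Perm (Fin (n + 1)),
        ∏ j : Fin n, ENNReal.ofReal (|t (σ j.castSucc) - t (σ j.succ)| ^ (-β))
          ∂(Measure.pi fun _ => μ) ≤ (n + 1).factorial * (μ univ * A ^ n) := by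
  rw [lintegral_finsetSum _ fun σ _ => by fun_prop]
  have : ∀ σ : Equiv.Perm (Fin (n + 1)), ∫⁻ t : Fin (n + 1) → ℝ,
      ∏ j : Fin n, ENNReal.ofReal (|t (σ j.castSucc) - t (σ j.succ)| ^ (-β))
          ∂(Measure.pi fun _ => μ) ≤ μ univ * A ^ n := by
    intro σ
    have hmp := measurePreserving_piCongrLeft (fun _ : Fin (n + 1) => μ) σ.symm
    have := hmp.lintegral_comp (f := fun t : Fin (n + 1) → ℝ =>
      ∏ j : Fin n, ENNReal.ofReal (|t j.castSucc - t j.succ| ^ (-β))) (by fun_prop)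
    have hc := lintegral_chain_le μ (k := fun s t => ENNReal.ofReal (|s - t| ^ (-β)))
      (by simp only [Function.uncurry_def]; fun_prop) (A := A)
      (fun t => by simpa [abs_sub_comm] using hA t) n
    rw [← this] at hc
    refine le_trans (le_of_eq ?_) hc
    refine lintegral_congr fun t => Finset.prod_congr rfl fun j _ => ?_
    have e : ∀ i, MeasurableEquiv.piCongrLeft (fun _ => ℝ) σ.symm t i = t (σ i) := fun i => by
      conv_lhs => rw [← σ.symm_apply_apply i]
      exact MeasurableEquiv.piCongrLeft_apply_apply (β := fun _ => ℝ) σ.symm t (σ i)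
    simp only [e]
  refine (Finset.sum_le_sum fun σ _ => this σ).trans ?_
  simp [Fintype.card_perm]

/-- Moment bound for the smoothed occupation density of an interval. -/
lemma lintegral_enorm_occupation_pow_le {f : E → ℝ} (hfi : Integrable f) (hfc : Continuous f)
    {M : ℝ} (hM : ∀ x, |f x| ≤ M) {Y : ℝ → Ω → E} (hmeas : Measurable (Function.uncurry Y)) {n : ℕ}
    (hn : Even (n + 1)) {B β T : ℝ} (hβ0 : 0 ≤ β) (hβ : β < 1)
    (hB0 : 0 ≤ B)
    (hB : ∀ τ : Fin (n + 1) → ℝ, 0 < τ 0 → StrictMono τ → τ (Fin.last n) ≤ T → ∀ x,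
      |∫ ω, ∏ j : Fin n, f (x - (Y (τ j.succ) ω - Y (τ 0) ω)) ∂P| ≤
        B * ∏ j : Fin n, (τ j.succ - τ j.castSucc) ^ (-β))
    {a ℓ : ℝ} (ha : 0 ≤ a) (hℓ : 0 < ℓ) (hT : a + ℓ ≤ T) :
    ∫⁻ z : Ω × E, ‖∫ s in Ioc a (a + ℓ), f (z.2 - Y s z.1)‖ₑ ^ (n + 1) ∂(P.prod volume) ≤
      ENNReal.ofReal ((∫ x, |f x|) * B) * ((n + 1).factorial *
        (ENNReal.ofReal ℓ * ENNReal.ofReal (3 / (1 - β) * ℓ ^ (1 - β)) ^ n)) := by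
  have hY : ∀ t, Measurable (Y t) := fun t => hmeas.comp measurable_prodMk_left
  have hm := hfc.measurable
  set μ : Measure ℝ := volume.restrict (Ioc a (a + ℓ)) with hμ
  set π : Measure (Fin (n + 1) → ℝ) := Measure.pi fun _ => μ with hπ
  let F : Ω × E → (Fin (n + 1) → ℝ) → ℝ := fun z t => ∏ j, f (z.2 - Y (t j) z.1)
  have hFm : Measurable (Function.uncurry F) := by
    have : ∀ j : Fin (n + 1), Measurable fun p : (Ω × E) × (Fin (n + 1) → ℝ) =>
        Y (p.2 j) p.1.1 := fun j =>
      hmeas.comp (f := fun p : (Ω × E) × (Fin (n + 1) → ℝ) => (p.2 j, p.1.1)) (by fun_prop)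
    simp only [F, Function.uncurry_def]
    fun_prop
  have hFi : Integrable (Function.uncurry F) ((P.prod volume).prod π) := by
    have h0 : Integrable (fun p : (Ω × E) × (Fin (n + 1) → ℝ) => f (p.1.2 - Y (p.2 0) p.1.1))
        ((P.prod volume).prod π) := by
      have : Measurable fun p : (Ω × E) × (Fin (n + 1) → ℝ) => Y (p.2 0) p.1.1 :=
        hmeas.comp (f := fun p : (Ω × E) × (Fin (n + 1) → ℝ) => (p.2 0, p.1.1)) (by fun_prop)
      rw [integrable_prod_iff' (Measurable.aestronglyMeasurable (by fun_prop))]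
      refine ⟨Eventually.of_forall fun t => integrable_prod_comp_sub hfi (hY (t 0)), ?_⟩
      have : ∀ t : Fin (n + 1) → ℝ, ∫ z : Ω × E, ‖f (z.2 - Y (t 0) z.1)‖ ∂(P.prod volume) =
          ∫ x, |f x| := by
        intro t
        rw [integral_prod _ (integrable_prod_comp_sub hfi (hY (t 0))).norm]
        have : ∀ ω, ∫ x, |f (x - Y (t 0) ω)| = ∫ x, |f x| :=
          fun ω => integral_sub_right_eq_self (fun x => |f x|) _
        simp [this]
      simp_rw [this]
      exact integrable_const _
    refine (h0.abs.mul_const (M ^ n)).mono' hFm.aestronglyMeasurable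
      (Eventually.of_forall fun p => ?_)
    exact abs_prod_le_abs_mul_pow hM _
  have hpow : ∀ z : Ω × E, (∫ s, f (z.2 - Y s z.1) ∂μ) ^ (n + 1) = ∫ t, F z t ∂π := by
    intro z
    have := integral_fintype_prod_eq_pow (𝕜 := ℝ) (μ := μ) (ι := Fin (n + 1)) (fun s => f (z.2 - Y s z.1))
    simp only [Fintype.card_fin] at this
    exact this.symm
  calc ∫⁻ z : Ω × E, ‖∫ s, f (z.2 - Y s z.1) ∂μ‖ₑ ^ (n + 1) ∂(P.prod volume)
      = ∫⁻ z : Ω × E, ENNReal.ofReal (∫ t, F z t ∂π) ∂(P.prod volume) := by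
        refine lintegral_congr fun z => ?_
        rw [← hpow, ← ofReal_norm, ← ENNReal.ofReal_pow (norm_nonneg _), ← norm_pow,
          Real.norm_of_nonneg (hn.pow_nonneg _)]
    _ = ENNReal.ofReal (∫ z : Ω × E, ∫ t, F z t ∂π ∂(P.prod volume)) := by
        exact (ofReal_integral_eq_lintegral_ofReal hFi.integral_prod_left
          (Eventually.of_forall fun z => by
            simp only [Function.uncurry_apply_pair, ← hpow]; exact hn.pow_nonneg _)).symm
    _ = ENNReal.ofReal (∫ t, ∫ z : Ω × E, F z t ∂(P.prod volume) ∂π) := by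
        rw [integral_integral_swap hFi]
    _ ≤ ∫⁻ t, ‖∫ z : Ω × E, F z t ∂(P.prod volume)‖ₑ ∂π := by
        refine (ENNReal.ofReal_le_ofReal (le_abs_self _)).trans ?_
        rw [← Real.norm_eq_abs, ofReal_norm]
        exact enorm_integral_le_lintegral_enorm _
    _ ≤ ∫⁻ t, ENNReal.ofReal ((∫ x, |f x|) * B) * ∑ σ : Equiv.Perm (Fin (n + 1)),
        ∏ j : Fin n, ENNReal.ofReal (|t (σ j.castSucc) - t (σ j.succ)| ^ (-β)) ∂π := by
        have hmem : ∀ᵐ t ∂π, ∀ j, t j ∈ Ioc 0 T := by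
          rw [hπ, hμ, ← Measure.restrict_pi_pi]
          filter_upwards [ae_restrict_mem (MeasurableSet.univ_pi fun _ => measurableSet_Ioc)]
            with t ht j
          have := ht j (mem_univ j)
          exact ⟨ha.trans_lt this.1, this.2.trans hT⟩
        refine lintegral_mono_ae ?_
        filter_upwards [hmem, ae_injective_pi_restrict (Ioc a (a + ℓ))] with t ht hinj
        have := abs_integral_prod_le_sum_perm hfi hfc hM hY hB0 hB hinj ht
        rw [← ofReal_norm, Real.norm_eq_abs]
        refine (ENNReal.ofReal_le_ofReal this).trans_eq ?_
        rw [ENNReal.ofReal_mul (mul_nonneg (integral_nonneg fun _ => abs_nonneg _) hB0),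
          ENNReal.ofReal_sum_of_nonneg fun _ _ => Finset.prod_nonneg fun _ _ => by positivity]
        congr 1
        refine Finset.sum_congr rfl fun σ _ => ?_
        rw [ENNReal.ofReal_prod_of_nonneg fun _ _ => by positivity]
    _ ≤ _ := by
        rw [lintegral_const_mul' _ _ ENNReal.ofReal_ne_top]
        gcongr
        refine (lintegral_sum_perm_le μ (A := ENNReal.ofReal (3 / (1 - β) * ℓ ^ (1 - β)))
          (fun t => lintegral_abs_rpow_neg_le hβ0 hβ hℓ a t) n).trans_eq ?_
        simp [hμ]

end MomentBound

section SmoothedOccupation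

variable {E : Type*} [NormedAddCommGroup E] [InnerProductSpace ℝ E]

/-- The occupation measure of the path `y` on the time set `S`, convolved with the heat kernel at
time `a`, evaluated at `x`. -/
def smoothOcc [MeasurableSpace E] (y : ℝ → E) (a : ℝ) (S : Set ℝ) (x : E) : ℝ :=
  ∫ s in S, heatKernel a (x - y s)

/-- The difference of the heat kernels at times `3 * s / 4` and `s / 4`. -/
def heatDiff (s : ℝ) (z : E) : ℝ := heatKernel (3 * s / 4) z - heatKernel (s / 4) z

lemma continuous_heatDiff (s : ℝ) : Continuous (heatDiff s : E → ℝ) :=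
  (continuous_heatKernel _).sub (continuous_heatKernel _)

lemma abs_heatDiff_le {s : ℝ} (hs : 0 < s) (z : E) :
    |heatDiff s z| ≤ heatBound E (3 * s / 4) + heatBound E (s / 4) := by
  refine (abs_sub _ _).trans ?_
  rw [abs_of_nonneg (heatKernel_nonneg (by positivity) _),
    abs_of_nonneg (heatKernel_nonneg (by positivity) _)]
  exact add_le_add (heatKernel_le (by positivity) _) (heatKernel_le (by positivity) _)

variable [FiniteDimensional ℝ E] [MeasurableSpace E] [BorelSpace E]

lemma integrable_heatDiff {s : ℝ} (hs : 0 < s) : Integrable (heatDiff s : E → ℝ) :=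
  (integrable_heatKernel (by positivity)).sub (integrable_heatKernel (by positivity))

lemma integral_abs_heatDiff_le {s : ℝ} (hs : 0 < s) : ∫ z : E, |heatDiff s z| ≤ 2 := by
  have h1 : Integrable (heatKernel (3 * s / 4) : E → ℝ) := integrable_heatKernel (by positivity)
  have h2 : Integrable (heatKernel (s / 4) : E → ℝ) := integrable_heatKernel (by positivity)
  calc ∫ z : E, |heatDiff s z| ≤ ∫ z : E, (heatKernel (3 * s / 4) z + heatKernel (s / 4) z) := by
        refine integral_mono (integrable_heatDiff hs).abs (h1.add h2) fun z => ?_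
        refine (abs_sub _ _).trans ?_
        rw [abs_of_nonneg (heatKernel_nonneg (by positivity) _),
          abs_of_nonneg (heatKernel_nonneg (by positivity) _)]
    _ = 2 := by
        rw [integral_add h1 h2, integral_heatKernel (by positivity),
          integral_heatKernel (by positivity)]
        norm_num

lemma exp_neg_sub_exp_neg_abs_le {s v κ : ℝ} (hs : 0 < s) (hv : 0 ≤ v) (hκ0 : 0 ≤ κ) (hκ : κ ≤ 1) :
    |Real.exp (-(3 * s / 4) * v) - Real.exp (-(s / 4) * v)| ≤ s ^ κ * v ^ κ := by
  rw [← Real.mul_rpow hs.le hv]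
  have hsv : 0 ≤ s * v := by positivity
  have hle : Real.exp (-(3 * s / 4) * v) ≤ Real.exp (-(s / 4) * v) :=
    Real.exp_le_exp.2 (by nlinarith)
  rw [abs_sub_comm, abs_of_nonneg (sub_nonneg.2 hle)]
  have h1 : Real.exp (-(s / 4) * v) ≤ 1 := Real.exp_le_one_iff.2 (by nlinarith)
  have h0 : 0 < Real.exp (-(3 * s / 4) * v) := Real.exp_pos _
  rcases le_total 1 (s * v) with h | h
  · exact (by linarith : _ ≤ (1 : ℝ)).trans (Real.one_le_rpow h hκ0)
  · have h2 : 1 - 3 * s / 4 * v ≤ Real.exp (-(3 * s / 4) * v) := by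
      simpa [neg_mul] using Real.one_sub_le_exp_neg (3 * s / 4 * v)
    have h3 : s * v ≤ (s * v) ^ κ := by
      rcases hsv.eq_or_lt with h0 | h0
      · rw [← h0]; exact Real.rpow_nonneg le_rfl _
      · simpa using Real.rpow_le_rpow_of_exponent_ge h0 h hκ
    nlinarith

lemma integrable_exp_neg_mul_norm_sq {a : ℝ} (ha : 0 < a) :
    Integrable fun u : E => Real.exp (-a * ‖u‖ ^ 2) := by
  have := (integrable_heatKernel (V := E) (a := 1 / (4 * a)) (by positivity)).const_mul
    (((4 * Real.pi * (1 / (4 * a))) ^ (-(Module.finrank ℝ E : ℝ) / 2))⁻¹)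
  refine this.congr (Eventually.of_forall fun u => ?_)
  have hne : (4 * Real.pi * (1 / (4 * a))) ^ (-(Module.finrank ℝ E : ℝ) / 2) ≠ 0 := by
    positivity
  simp only [heatKernel]
  rw [inv_mul_cancel_left₀ hne]
  congr 2
  field_simp

lemma heatDiff_fourier {s : ℝ} (hs : 0 < s) (z : E) :
    (heatDiff s z : ℂ) = ∫ u : E, Complex.exp ((⟪u, z⟫ : ℝ) * Complex.I) *
      (((2 * Real.pi) ^ (-(Module.finrank ℝ E : ℝ)) *
        (Real.exp (-(3 * s / 4) * ‖u‖ ^ 2) - Real.exp (-(s / 4) * ‖u‖ ^ 2)) : ℝ) : ℂ) := by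
  have hi : ∀ a : ℝ, 0 < a → Integrable fun u : E =>
      Complex.exp (Complex.I * (⟪u, z⟫ : ℝ)) * (Real.exp (-a * ‖u‖ ^ 2) : ℝ) := by
    intro a ha
    refine (integrable_exp_neg_mul_norm_sq ha).mono' (by fun_prop) (Eventually.of_forall fun u => le_of_eq ?_)
    rw [norm_mul, mul_comm Complex.I, Complex.norm_exp_ofReal_mul_I, one_mul, Complex.norm_real,
      Real.norm_of_nonneg (Real.exp_pos _).le]
  rw [heatDiff, Complex.ofReal_sub, heatKernel_fourier (by positivity),
    heatKernel_fourier (by positivity), ← mul_sub, ← integral_sub (hi _ (by positivity))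
      (hi _ (by positivity)), ← integral_const_mul]
  refine integral_congr_ae (Eventually.of_forall fun u => ?_)
  simp only [Complex.ofReal_mul, Complex.ofReal_sub, mul_comm Complex.I]
  ring

/-- Jensen's inequality for the average against the heat kernel, followed by a sup bound. -/
lemma enorm_integral_heatKernel_mul_pow_le {r : ℝ} (hr : 0 < r) {X : E → ℝ} (hX : Measurable X)
    (x : E) {m : ℕ} (hm : 1 ≤ m) :
    ‖∫ z, heatKernel r z * X (x - z)‖ₑ ^ m ≤
      ENNReal.ofReal (heatBound E r) * ∫⁻ z, ‖X z‖ₑ ^ m := by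
  have hk : Measurable fun z : E => ENNReal.ofReal (heatKernel r z) :=
    (continuous_heatKernel r).measurable.ennreal_ofReal
  set μ : Measure E := volume.withDensity fun z => ENNReal.ofReal (heatKernel r z) with hμ
  have : IsProbabilityMeasure μ := by
    refine ⟨?_⟩
    rw [hμ, withDensity_apply _ MeasurableSet.univ, Measure.restrict_univ,
      ← ofReal_integral_eq_lintegral_ofReal (integrable_heatKernel hr)
        (Eventually.of_forall fun z => heatKernel_nonneg hr z), integral_heatKernel hr]
    simp
  have hXx : Measurable fun z => X (x - z) := hX.comp (measurable_const.sub measurable_id)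
  have h1 : ‖∫ z, heatKernel r z * X (x - z)‖ₑ ≤ ∫⁻ z, ‖X (x - z)‖ₑ ∂μ := by
    refine (enorm_integral_le_lintegral_enorm _).trans_eq ?_
    rw [hμ, lintegral_withDensity_eq_lintegral_mul _ hk hXx.enorm]
    refine lintegral_congr fun z => ?_
    rw [enorm_mul, Real.enorm_of_nonneg (heatKernel_nonneg hr z)]
    rfl
  have h2 : (∫⁻ z, ‖X (x - z)‖ₑ ∂μ) ^ m ≤ ∫⁻ z, ‖X (x - z)‖ₑ ^ m ∂μ := by
    have hle := eLpNorm_le_eLpNorm_of_exponent_le (μ := μ) (p := 1) (q := ((m : ℝ≥0) : ℝ≥0∞))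
      (by exact_mod_cast hm) hXx.aestronglyMeasurable
    have hpow := eLpNorm_nnreal_pow_eq_lintegral (μ := μ) (f := fun z => X (x - z))
      (p := (m : ℝ≥0)) (by exact_mod_cast (by omega : m ≠ 0))
    simp only [NNReal.coe_natCast, ENNReal.rpow_natCast] at hpow
    rw [← hpow, ← eLpNorm_one_eq_lintegral_enorm]
    gcongr
  calc ‖∫ z, heatKernel r z * X (x - z)‖ₑ ^ m ≤ (∫⁻ z, ‖X (x - z)‖ₑ ∂μ) ^ m := by gcongr
    _ ≤ ∫⁻ z, ‖X (x - z)‖ₑ ^ m ∂μ := h2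
    _ = ∫⁻ z, ENNReal.ofReal (heatKernel r z) * ‖X (x - z)‖ₑ ^ m := by
        rw [hμ, lintegral_withDensity_eq_lintegral_mul _ hk (hXx.enorm.pow_const m)]
        rfl
    _ ≤ ∫⁻ z, ENNReal.ofReal (heatBound E r) * ‖X (x - z)‖ₑ ^ m := by
        gcongr with z
        exact heatKernel_le hr z
    _ = _ := by
        rw [lintegral_const_mul' _ _ ENNReal.ofReal_ne_top,
          lintegral_sub_left_eq_self (fun z => ‖X z‖ₑ ^ m) x]

lemma integrableOn_heatKernel_sub {y : ℝ → E} (hy : Measurable y) {a : ℝ} (ha : 0 < a) {S : Set ℝ}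
    (hS : volume S ≠ ∞) (x : E) : IntegrableOn (fun s => heatKernel a (x - y s)) S := by
  have := (continuous_heatKernel (V := E) a).measurable
  refine (integrableOn_const (C := heatBound E a) hS).mono'
    (Measurable.aestronglyMeasurable (by fun_prop)) (Eventually.of_forall fun s => ?_)
  rw [Real.norm_of_nonneg (heatKernel_nonneg ha _)]
  exact heatKernel_le ha _

lemma smoothOcc_sub_half {y : ℝ → E} (hy : Measurable y) {s : ℝ} (hs : 0 < s) {S : Set ℝ}
    (hS : volume S ≠ ∞) (x : E) :
    smoothOcc y s S x - smoothOcc y (s / 2) S x =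
      ∫ z, heatKernel (s / 4) z * ∫ r in S, heatDiff s (x - z - y r) := by
  have hs4 : 0 < s / 4 := by positivity
  have hs34 : 0 < 3 * s / 4 := by positivity
  have hfin : IsFiniteMeasure (volume.restrict S) := isFiniteMeasure_restrict.2 hS
  have hd := (continuous_heatDiff (E := E) s).measurable
  have hk := (continuous_heatKernel (V := E) (s / 4)).measurable
  have hint : Integrable (Function.uncurry fun (z : E) (r : ℝ) =>
      heatKernel (s / 4) z * heatDiff s (x - z - y r)) (volume.prod (volume.restrict S)) := by
    refine (((integrable_heatKernel (V := E) hs4).comp_fst (volume.restrict S)).mul_const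
      (heatBound E (3 * s / 4) + heatBound E (s / 4))).mono'
      (Measurable.aestronglyMeasurable ?_) (Eventually.of_forall fun p => ?_)
    · simp only [Function.uncurry_def]
      fun_prop
    · simp only [Function.uncurry_def, norm_mul, Real.norm_eq_abs]
      rw [abs_of_nonneg (heatKernel_nonneg hs4 _)]
      exact mul_le_mul_of_nonneg_left (abs_heatDiff_le hs _) (heatKernel_nonneg hs4 _)
  simp_rw [← integral_const_mul]
  rw [integral_integral_swap hint, smoothOcc, smoothOcc, ← integral_sub
    (integrableOn_heatKernel_sub hy hs hS x) (integrableOn_heatKernel_sub hy (by positivity) hS x)]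
  refine integral_congr_ae (Eventually.of_forall fun r => ?_)
  simp only
  have hmul : ∀ a : ℝ, 0 < a → Integrable fun z : E =>
      heatKernel (s / 4) z * heatKernel a (x - y r - z) := by
    intro a ha
    have := (continuous_heatKernel (V := E) a).measurable
    refine ((integrable_heatKernel (V := E) hs4).mul_const (heatBound E a)).mono'
      (Measurable.aestronglyMeasurable (by fun_prop)) (Eventually.of_forall fun z => ?_)
    rw [norm_mul, Real.norm_of_nonneg (heatKernel_nonneg hs4 _),
      Real.norm_of_nonneg (heatKernel_nonneg ha _)]
    exact mul_le_mul_of_nonneg_left (heatKernel_le ha _) (heatKernel_nonneg hs4 _)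
  have e : ∀ z : E, heatKernel (s / 4) z * heatDiff s (x - z - y r) =
      heatKernel (s / 4) z * heatKernel (3 * s / 4) (x - y r - z) -
        heatKernel (s / 4) z * heatKernel (s / 4) (x - y r - z) := by
    intro z
    rw [heatDiff, sub_right_comm]
    ring
  simp_rw [e]
  rw [integral_sub (hmul _ hs34) (hmul _ hs4), heatKernel_conv hs4 hs34, heatKernel_conv hs4 hs4]
  congr 2 <;> ring

lemma enorm_smoothOcc_sub_half_pow_le {y : ℝ → E} (hy : Measurable y) {s : ℝ} (hs : 0 < s)
    {S : Set ℝ} (hS : volume S ≠ ∞) (x : E) {m : ℕ} (hm : 1 ≤ m) :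
    ‖smoothOcc y s S x - smoothOcc y (s / 2) S x‖ₑ ^ m ≤ ENNReal.ofReal (heatBound E (s / 4)) *
      ∫⁻ z, ‖∫ r in S, heatDiff s (z - y r)‖ₑ ^ m := by
  rw [smoothOcc_sub_half hy hs hS]
  have hfin : IsFiniteMeasure (volume.restrict S) := isFiniteMeasure_restrict.2 hS
  have hd := (continuous_heatDiff (E := E) s).measurable
  refine enorm_integral_heatKernel_mul_pow_le (X := fun z => ∫ r in S, heatDiff s (z - y r))
    (by positivity) ?_ x hm
  refine (StronglyMeasurable.integral_prod_right (Measurable.stronglyMeasurable ?_)).measurable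
  simp only [Function.uncurry_def]
  fun_prop

end SmoothedOccupation

section AlmostSureIncrement

variable {Ω : Type*} [MeasurableSpace Ω] {P : Measure Ω} [IsProbabilityMeasure P]
  {d : ℕ} {Y : ℝ → Ω → EuclideanSpace ℝ (Fin d)} {T α : ℝ}

lemma IsLND.exists_lintegral_heatDiff_pow_le (hα0 : 0 < α)
    (hmeas : Measurable (Function.uncurry Y)) (hLND : IsLND P d Y T α) {n : ℕ} (hn : 1 ≤ n)
    (hne : Even (n + 1)) {κ : ℝ} (hκ0 : 0 ≤ κ) (hκ : κ ≤ 1 / 8)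
    (hβ : d * α * (1 + 4 * κ) < 1) :
    ∃ C : ℝ, 0 < C ∧ ∀ s : ℝ, 0 < s → ∀ a ℓ : ℝ, 0 ≤ a → 0 < ℓ → a + ℓ ≤ T →
      ∫⁻ ω, ∫⁻ x : EuclideanSpace ℝ (Fin d),
        ‖∫ r in Ioc a (a + ℓ), heatDiff s (x - Y r ω)‖ₑ ^ (n + 1) ∂volume ∂P ≤
        ENNReal.ofReal (C * (s ^ κ) ^ n * (ℓ * (ℓ ^ (1 - d * α * (1 + 4 * κ))) ^ n)) := by
  have hY : ∀ t, Measurable (Y t) := fun t => hmeas.comp measurable_prodMk_left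
  obtain ⟨C, hC, hbound⟩ := hLND.exists_norm_integral_prod_le hα0 hY hn hκ0 hκ
  set β := d * α * (1 + 4 * κ) with hβdef
  have hβ0 : 0 ≤ β := by positivity
  have h1β : 0 < 1 - β := by linarith
  set c : ℝ := (2 * Real.pi) ^ (-(Module.finrank ℝ (EuclideanSpace ℝ (Fin d)) : ℝ)) with hc
  have hc0 : 0 < c := by positivity
  refine ⟨2 * (C * c ^ n) * ((n + 1).factorial * (3 / (1 - β)) ^ n), by positivity, ?_⟩
  intro s hs a ℓ ha hℓ hT
  have hsκ : 0 ≤ s ^ κ := by positivity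
  have hB := hbound (heatDiff s) (fun u => c *
      (Real.exp (-(3 * s / 4) * ‖u‖ ^ 2) - Real.exp (-(s / 4) * ‖u‖ ^ 2))) (c * s ^ κ)
    (by positivity)
    (fun u => by
      rw [abs_mul, abs_of_pos hc0, mul_assoc]
      exact mul_le_mul_of_nonneg_left
        (exp_neg_sub_exp_neg_abs_le hs (by positivity) hκ0 (by linarith)) hc0.le)
    (((integrable_exp_neg_mul_norm_sq (by positivity)).sub
      (integrable_exp_neg_mul_norm_sq (by positivity))).const_mul c)
    (heatDiff_fourier hs)
  have hmom := lintegral_enorm_occupation_pow_le (P := P) (integrable_heatDiff hs)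
    (continuous_heatDiff s) (abs_heatDiff_le hs) hmeas hne hβ0 hβ
    (B := C * (c * s ^ κ) ^ n) (by positivity) hB ha hℓ hT
  have hm := (continuous_heatDiff (E := EuclideanSpace ℝ (Fin d)) s).measurable
  rw [lintegral_prod _ (Measurable.aemeasurable ?_)] at hmom
  · refine hmom.trans ?_
    have hfac : (((n + 1).factorial : ℕ) : ℝ≥0∞) = ENNReal.ofReal ((n + 1).factorial : ℝ) := by
      simp
    rw [hfac, ← ENNReal.ofReal_pow (by positivity), ← ENNReal.ofReal_mul hℓ.le,
      ← ENNReal.ofReal_mul (by positivity), ← ENNReal.ofReal_mul (by positivity)]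
    refine ENNReal.ofReal_le_ofReal ?_
    calc _ ≤ 2 * (C * (c * s ^ κ) ^ n) *
          ((n + 1).factorial * (ℓ * (3 / (1 - β) * ℓ ^ (1 - β)) ^ n)) := by
          gcongr
          exact integral_abs_heatDiff_le hs
      _ = _ := by
          rw [mul_pow, mul_pow]
          ring
  · refine (StronglyMeasurable.integral_prod_right
      (f := fun (z : Ω × EuclideanSpace ℝ (Fin d)) (r : ℝ) => heatDiff s (z.2 - Y r z.1))
      (Measurable.stronglyMeasurable ?_)).measurable.enorm.pow_const _
    have : Measurable fun p : (Ω × EuclideanSpace ℝ (Fin d)) × ℝ => Y p.2 p.1.1 :=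
      hmeas.comp (f := fun p : (Ω × EuclideanSpace ℝ (Fin d)) × ℝ => (p.2, p.1.1)) (by fun_prop)
    simp only [Function.uncurry_def]
    fun_prop

lemma measurable_lintegral_heatDiff_pow (hmeas : Measurable (Function.uncurry Y)) (s : ℝ)
    (S : Set ℝ) (m : ℕ) :
    Measurable fun ω => ∫⁻ x, ‖∫ r in S, heatDiff s (x - Y r ω)‖ₑ ^ m := by
  have hm := (continuous_heatDiff (E := EuclideanSpace ℝ (Fin d)) s).measurable
  refine Measurable.lintegral_prod_right
    (f := fun ω x => ‖∫ r in S, heatDiff s (x - Y r ω)‖ₑ ^ m) ?_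
  refine (StronglyMeasurable.integral_prod_right
    (f := fun (z : Ω × EuclideanSpace ℝ (Fin d)) (r : ℝ) => heatDiff s (z.2 - Y r z.1))
    (Measurable.stronglyMeasurable ?_)).measurable.enorm.pow_const _
  have : Measurable fun p : (Ω × EuclideanSpace ℝ (Fin d)) × ℝ => Y p.2 p.1.1 :=
    hmeas.comp (f := fun p : (Ω × EuclideanSpace ℝ (Fin d)) × ℝ => (p.2, p.1.1)) (by fun_prop)
  simp only [Function.uncurry_def]
  fun_prop

lemma exists_moment_exponents {b γ D : ℝ} (hb : 0 ≤ b) (hγ0 : 0 < γ) (hγ : γ < 1 - b) :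
    ∃ κ : ℝ, 0 ≤ κ ∧ κ ≤ 1 / 8 ∧ b * (1 + 4 * κ) < 1 ∧ ∃ n : ℕ, 1 ≤ n ∧ Even (n + 1) ∧
      D ≤ κ * n ∧ γ * (n + 1) + 1 ≤ n * (1 - b * (1 + 4 * κ)) := by
  set e := 1 - b - γ with he
  have he0 : 0 < e := by linarith
  set κ := min (1 / 8) (e / (8 * (b + 1))) with hκ
  have hκ0 : 0 < κ := lt_min (by norm_num) (by positivity)
  have hbκ : b * (4 * κ) ≤ e / 2 := by
    have h1 : κ ≤ e / (8 * (b + 1)) := min_le_right _ _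
    rw [le_div_iff₀ (by positivity)] at h1
    nlinarith
  obtain ⟨K, hK⟩ := exists_nat_ge (max (D / κ) ((γ + 1) / (e / 2)))
  have hK1 : D ≤ K * κ := by
    rw [← div_le_iff₀ hκ0]; exact (le_max_left _ _).trans hK
  have hK2 : γ + 1 ≤ K * (e / 2) := by
    rw [← div_le_iff₀ (by positivity)]; exact (le_max_right _ _).trans hK
  have hKn : (0 : ℝ) ≤ K := Nat.cast_nonneg K
  refine ⟨κ, hκ0.le, min_le_left _ _, by nlinarith, 2 * K + 1, by omega, ⟨K + 1, by ring⟩, ?_, ?_⟩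
  · push_cast
    nlinarith
  · push_cast
    nlinarith

lemma heatBound_le_two_pow (n : ℕ) :
    heatBound (EuclideanSpace ℝ (Fin d)) ((1 / 2) ^ n / 4) ≤ (2 ^ d) ^ n := by
  have hs : (0 : ℝ) < (1 / 2) ^ n := by positivity
  have hs1 : (1 / 2 : ℝ) ^ n ≤ 1 := pow_le_one₀ (by norm_num) (by norm_num)
  have hpi : 1 ≤ Real.pi := by linarith [Real.pi_gt_three]
  rw [heatBound, finrank_euclideanSpace_fin]
  calc (4 * Real.pi * ((1 / 2) ^ n / 4)) ^ (-(d : ℝ) / 2)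
      ≤ ((1 / 2 : ℝ) ^ n) ^ (-(d : ℝ) / 2) := by
        refine Real.rpow_le_rpow_of_nonpos hs (by nlinarith) ?_
        have : (0 : ℝ) ≤ d := Nat.cast_nonneg d
        linarith
    _ ≤ ((1 / 2 : ℝ) ^ n) ^ (-(d : ℝ)) := by
        refine Real.rpow_le_rpow_of_exponent_ge hs hs1 ?_
        have : (0 : ℝ) ≤ d := Nat.cast_nonneg d
        linarith
    _ = (2 ^ d) ^ n := by
        rw [Real.rpow_neg hs.le, Real.rpow_natCast, ← inv_pow, ← inv_pow, ← pow_mul, ← pow_mul,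
          mul_comm]
        norm_num

lemma IsLND.ae_exists_dyadic_bound (hα0 : 0 < α) (hT : 0 < T)
    (hmeas : Measurable (Function.uncurry Y)) (hLND : IsLND P d Y T α) {γ : ℝ} (hγ0 : 0 < γ)
    (hγ : γ < 1 - d * α) :
    ∀ᵐ ω ∂P, ∃ η : ℝ, 0 < η ∧ ∃ q : ℝ, 0 < q ∧ q < 1 ∧ ∀ n k j : ℕ, j < 2 ^ k → ∀ x,
      |smoothOcc (fun s => Y s ω) ((1 / 2) ^ n)
          (Ioc (j * (T * (1 / 2) ^ k)) (j * (T * (1 / 2) ^ k) + T * (1 / 2) ^ k)) x -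
        smoothOcc (fun s => Y s ω) ((1 / 2) ^ (n + 1))
          (Ioc (j * (T * (1 / 2) ^ k)) (j * (T * (1 / 2) ^ k) + T * (1 / 2) ^ k)) x| ≤
        η * q ^ n * ((1 / 2) ^ k) ^ γ := by
  obtain ⟨κ, hκ0, hκ, hβ, N, hN, hNe, hN1, hN2⟩ := exists_moment_exponents (D := d + 2)
    (by positivity : 0 ≤ d * α) hγ0 hγ
  obtain ⟨C, hC, hmom⟩ := hLND.exists_lintegral_heatDiff_pow_le hα0 hmeas hN hNe hκ0 hκ hβ
  set β := d * α * (1 + 4 * κ) with hβdef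
  set m := N + 1 with hm
  let s : ℕ → ℝ := fun n => (1 / 2) ^ n
  have hs : ∀ n, 0 < s n := fun n => by positivity
  have hs1 : ∀ n, s n ≤ 1 := fun n => pow_le_one₀ (by norm_num) (by norm_num)
  let I : ℕ → ℕ → Set ℝ := fun k j => Ioc (j * (T * s k)) (j * (T * s k) + T * s k)
  let A : ℕ → ℕ → ℕ → Ω → ℝ≥0∞ := fun n k j ω => ∫⁻ x, ‖∫ r in I k j, heatDiff (s n) (x - Y r ω)‖ₑ ^ m
  let w : ℕ → ℕ → ℝ := fun n k => (2 ^ (d + 1)) ^ n * (s k ^ (γ * m))⁻¹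
  have hw : ∀ n k, 0 < w n k := fun n k => by
    have := hs k
    positivity
  have hAm : ∀ n k j, Measurable (A n k j) := fun n k j =>
    measurable_lintegral_heatDiff_pow hmeas _ _ _
  let W : Ω → ℝ≥0∞ := fun ω => ∑' p : ℕ × ℕ, ∑ j ∈ Finset.range (2 ^ p.2),
    ENNReal.ofReal (w p.1 p.2) * A p.1 p.2 j ω
  have hWm : Measurable W := by
    refine Measurable.tsum fun p => ?_
    fun_prop
  set C' := C * (T * (T ^ (1 - β)) ^ N) with hC'
  have hC'0 : 0 < C' := by positivity
  have hterm : ∀ n k j, j < 2 ^ k → ENNReal.ofReal (w n k) * ∫⁻ ω, A n k j ω ∂P ≤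
      ENNReal.ofReal (C' * (s n * (s k * s k))) := by
    intro n k j hj
    have hsk := hs k
    have hsn := hs n
    have hjk : (j : ℝ) + 1 ≤ 2 ^ k := by exact_mod_cast hj
    have h2k : (2 : ℝ) ^ k * s k = 1 := by simp [s]
    have hle : (j : ℝ) * (T * s k) + T * s k ≤ T := by
      have : ((j : ℝ) + 1) * s k ≤ 1 :=
        (mul_le_mul_of_nonneg_right hjk hsk.le).trans_eq h2k
      nlinarith
    refine (mul_le_mul_right (hmom (s n) hsn (j * (T * s k)) (T * s k) (by positivity)
      (by positivity) hle) _).trans ?_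
    rw [← ENNReal.ofReal_mul (hw n k).le]
    refine ENNReal.ofReal_le_ofReal ?_
    have e1 : (s n ^ κ) ^ N ≤ s n ^ (d + 2) := by
      rw [← Real.rpow_natCast (s n ^ κ), ← Real.rpow_mul hsn.le, ← Real.rpow_natCast (s n)]
      refine Real.rpow_le_rpow_of_exponent_ge hsn (hs1 n) ?_
      push_cast; exact hN1
    have e2 : s k * (s k ^ (1 - β)) ^ N ≤ s k ^ (γ * m) * (s k * s k) := by
      rw [← Real.rpow_natCast (s k ^ (1 - β)), ← Real.rpow_mul hsk.le, mul_left_comm]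
      refine mul_le_mul_of_nonneg_left ?_ hsk.le
      conv_rhs => rw [← Real.rpow_add_one hsk.ne']
      refine Real.rpow_le_rpow_of_exponent_ge hsk (hs1 k) ?_
      rw [hm]; push_cast; linarith
    have e3 : ((2 : ℝ) ^ (d + 1)) ^ n * s n ^ (d + 2) = s n := by
      rw [pow_succ (s n), ← mul_assoc, ← pow_mul, mul_comm (d + 1), pow_mul, ← mul_pow]
      simp [s]
    calc w n k * (C * (s n ^ κ) ^ N * (T * s k * ((T * s k) ^ (1 - β)) ^ N))
        = C' * ((2 ^ (d + 1)) ^ n * (s n ^ κ) ^ N) *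
          ((s k ^ (γ * m))⁻¹ * (s k * (s k ^ (1 - β)) ^ N)) := by
          rw [Real.mul_rpow hT.le hsk.le, mul_pow]
          simp only [w, hC']
          ring
      _ ≤ C' * ((2 ^ (d + 1)) ^ n * s n ^ (d + 2)) *
          ((s k ^ (γ * m))⁻¹ * (s k ^ (γ * m) * (s k * s k))) := by gcongr
      _ = _ := by
          rw [e3, inv_mul_cancel_left₀ (by positivity)]
          ring
  have hWfin : ∫⁻ ω, W ω ∂P ≠ ∞ := by
    have hsum : Summable fun p : ℕ × ℕ => C' * (s p.1 * s p.2) :=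
      (summable_geometric_two.mul_of_nonneg summable_geometric_two
        (fun n => (hs n).le) (fun n => (hs n).le)).mul_left C'
    refine ne_top_of_le_ne_top hsum.tsum_ofReal_ne_top ?_
    rw [lintegral_tsum fun p => Measurable.aemeasurable (by fun_prop)]
    refine ENNReal.tsum_le_tsum fun p => ?_
    rw [lintegral_finsetSum _ fun j _ => by fun_prop]
    calc ∑ j ∈ Finset.range (2 ^ p.2), ∫⁻ ω, ENNReal.ofReal (w p.1 p.2) * A p.1 p.2 j ω ∂P
        ≤ ∑ j ∈ Finset.range (2 ^ p.2), ENNReal.ofReal (C' * (s p.1 * (s p.2 * s p.2))) := by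
          refine Finset.sum_le_sum fun j hj => ?_
          rw [lintegral_const_mul _ (hAm _ _ _)]
          exact hterm _ _ _ (Finset.mem_range.1 hj)
      _ = _ := by
          have h2k : (2 : ℝ) ^ p.2 * s p.2 = 1 := by simp [s]
          rw [Finset.sum_const, Finset.card_range, nsmul_eq_mul, ← ENNReal.ofReal_natCast,
            ← ENNReal.ofReal_mul (by positivity)]
          congr 1
          push_cast
          linear_combination C' * s p.1 * s p.2 * h2k
  filter_upwards [ae_lt_top hWm hWfin] with ω hω
  have hY : Measurable fun r => Y r ω := hmeas.comp measurable_prodMk_right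
  set q : ℝ := (1 / 2 : ℝ) ^ ((m : ℝ)⁻¹) with hq
  have hm0 : m ≠ 0 := by omega
  have hqm : q ^ m = 1 / 2 := Real.rpow_inv_natCast_pow (by norm_num) hm0
  set η : ℝ := (W ω).toReal + 1 with hη
  have hη1 : 1 ≤ η := by simp [hη]
  refine ⟨η, by linarith, q, by positivity,
    Real.rpow_lt_one (by norm_num) (by norm_num) (by positivity), ?_⟩
  intro n k j hj x
  have hAW : ENNReal.ofReal (w n k) * A n k j ω ≤ ENNReal.ofReal η := by
    calc ENNReal.ofReal (w n k) * A n k j ω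
        ≤ ∑ j ∈ Finset.range (2 ^ k), ENNReal.ofReal (w n k) * A n k j ω :=
          Finset.single_le_sum (f := fun j => ENNReal.ofReal (w n k) * A n k j ω)
            (fun _ _ => zero_le) (Finset.mem_range.2 hj)
      _ ≤ W ω := ENNReal.le_tsum (f := fun p : ℕ × ℕ => ∑ j ∈ Finset.range (2 ^ p.2),
            ENNReal.ofReal (w p.1 p.2) * A p.1 p.2 j ω) (n, k)
      _ = ENNReal.ofReal (W ω).toReal := (ENNReal.ofReal_toReal hω.ne).symm
      _ ≤ ENNReal.ofReal η := ENNReal.ofReal_le_ofReal (by simp [hη])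
  have hmain := enorm_smoothOcc_sub_half_pow_le hY (hs n) (S := I k j) (by simp [I]) x
    (m := m) (by omega)
  have hsk := hs k
  have hsn := hs n
  have hid : ((2 : ℝ) ^ d) ^ n = s n * s k ^ (γ * m) * w n k := by
    simp only [w]
    have h2 : s n * (2 : ℝ) ^ n = 1 := by simp [s]
    have h3 : s k ^ (γ * m) * (s k ^ (γ * m))⁻¹ = 1 := mul_inv_cancel₀ (by positivity)
    rw [pow_succ, mul_pow]
    linear_combination (-(2 ^ d) ^ n : ℝ) * s n * 2 ^ n * h3 - (2 ^ d) ^ n * h2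
  have hfin : ‖smoothOcc (fun s => Y s ω) (s n) (I k j) x -
      smoothOcc (fun s => Y s ω) (s n / 2) (I k j) x‖ₑ ^ m ≤
      ENNReal.ofReal (s n * s k ^ (γ * m) * η) := by
    refine hmain.trans ?_
    calc ENNReal.ofReal (heatBound (EuclideanSpace ℝ (Fin d)) (s n / 4)) * A n k j ω
        ≤ ENNReal.ofReal ((2 ^ d) ^ n) * A n k j ω := by
          gcongr
          exact heatBound_le_two_pow n
      _ = ENNReal.ofReal (s n * s k ^ (γ * m)) * (ENNReal.ofReal (w n k) * A n k j ω) := by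
          rw [hid, ENNReal.ofReal_mul (by positivity), mul_assoc]
      _ ≤ ENNReal.ofReal (s n * s k ^ (γ * m)) * ENNReal.ofReal η := by gcongr
      _ = _ := by rw [← ENNReal.ofReal_mul (by positivity)]
  rw [← ofReal_norm, ← ENNReal.ofReal_pow (norm_nonneg _),
    ENNReal.ofReal_le_ofReal_iff (by positivity), Real.norm_eq_abs] at hfin
  have hsucc : (1 / 2 : ℝ) ^ (n + 1) = s n / 2 := by simp only [s, pow_succ]; ring
  rw [hsucc]
  refine (pow_le_pow_iff_left₀ (abs_nonneg _) (by positivity) hm0).1 (hfin.trans ?_)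
  have hηm : η ≤ η ^ m := le_self_pow₀ hη1 hm0
  rw [mul_pow, mul_pow, ← pow_mul, mul_comm n m, pow_mul, hqm, ← Real.rpow_natCast (_ ^ γ),
    ← Real.rpow_mul hsk.le]
  calc s n * s k ^ (γ * m) * η ≤ s n * s k ^ (γ * m) * η ^ m := by gcongr
    _ = _ := by simp only [s]; ring

end AlmostSureIncrement

section DyadicIncrement

variable {E : Type*} [NormedAddCommGroup E] [InnerProductSpace ℝ E] [MeasurableSpace E]

/-- The `j`-th dyadic interval of generation `k` in `(0, T]`. -/
def dyadicIoc (T : ℝ) (k j : ℕ) : Set ℝ :=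
  Ioc (j * (T * (1 / 2) ^ k)) (j * (T * (1 / 2) ^ k) + T * (1 / 2) ^ k)

/-- Geometric control, uniform in space, of the successive dyadic mollifications of the occupation
measure of `y` on dyadic intervals. -/
def DyadicControl (y : ℝ → E) (T γ η q : ℝ) : Prop :=
  ∀ n k j : ℕ, j < 2 ^ k → ∀ x,
    |smoothOcc y ((1 / 2) ^ n) (dyadicIoc T k j) x -
      smoothOcc y ((1 / 2) ^ (n + 1)) (dyadicIoc T k j) x| ≤ η * q ^ n * ((1 / 2) ^ k) ^ γ

lemma smoothOcc_nonneg (y : ℝ → E) {a : ℝ} (ha : 0 < a) (S : Set ℝ) (x : E) :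
    0 ≤ smoothOcc y a S x :=
  integral_nonneg fun _ => heatKernel_nonneg ha _

variable [FiniteDimensional ℝ E] [BorelSpace E] {y : ℝ → E} {T γ η q : ℝ}

lemma smoothOcc_union (hy : Measurable y) {a : ℝ} (ha : 0 < a) {r s t : ℝ} (hrs : r ≤ s)
    (hst : s ≤ t) (x : E) :
    smoothOcc y a (Ioc r t) x = smoothOcc y a (Ioc r s) x + smoothOcc y a (Ioc s t) x := by
  rw [smoothOcc, ← Ioc_union_Ioc_eq_Ioc hrs hst, setIntegral_union _ measurableSet_Ioc
    (integrableOn_heatKernel_sub hy ha (by simp) x) (integrableOn_heatKernel_sub hy ha (by simp) x)]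
  · rfl
  · exact Ioc_disjoint_Ioc_of_le le_rfl

lemma smoothOcc_mono (hy : Measurable y) {a : ℝ} (ha : 0 < a) {S S' : Set ℝ} (hS : S ⊆ S')
    (hS' : volume S' ≠ ∞) (x : E) : smoothOcc y a S x ≤ smoothOcc y a S' x :=
  setIntegral_mono_set (integrableOn_heatKernel_sub hy ha hS' x)
    (Eventually.of_forall fun _ => heatKernel_nonneg ha _) hS.eventuallyLE

lemma smoothOcc_Ioc_le (hy : Measurable y) {a : ℝ} (ha : 0 < a) {r t : ℝ} (hrt : r ≤ t) (x : E) :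
    smoothOcc y a (Ioc r t) x ≤ heatBound E a * (t - r) := by
  calc smoothOcc y a (Ioc r t) x ≤ ∫ _s in Ioc r t, heatBound E a :=
        integral_mono (integrableOn_heatKernel_sub hy ha (by simp) x)
          (integrableOn_const (by simp)) fun s => heatKernel_le ha _
    _ = heatBound E a * (t - r) := by simp [hrt, mul_comm]

lemma DyadicControl.smoothOcc_dyadicIoc_le (hy : Measurable y) (hT : 0 < T) (hγ1 : γ ≤ 1)
    (hη : 0 < η) (hq0 : 0 < q) (hq1 : q < 1) (h : DyadicControl y T γ η q) {k j : ℕ}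
    (hj : j < 2 ^ k) (n : ℕ) (x : E) :
    smoothOcc y ((1 / 2) ^ n) (dyadicIoc T k j) x ≤
      (heatBound E 1 * T + η / (1 - q)) * ((1 / 2) ^ k) ^ γ := by
  have hk0 : (0 : ℝ) < (1 / 2) ^ k := by positivity
  have hk1 : (1 / 2 : ℝ) ^ k ≤ 1 := pow_le_one₀ (by norm_num) (by norm_num)
  have h1q : 0 < 1 - q := by linarith
  have hind : ∀ n, smoothOcc y ((1 / 2) ^ n) (dyadicIoc T k j) x ≤
      (heatBound E 1 * T + η * ∑ i ∈ Finset.range n, q ^ i) * ((1 / 2) ^ k) ^ γ := by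
    intro n
    induction n with
    | zero =>
      have h0 := smoothOcc_Ioc_le (r := j * (T * (1 / 2) ^ k))
        (t := j * (T * (1 / 2) ^ k) + T * (1 / 2) ^ k) hy one_pos
        (le_add_of_nonneg_right (by positivity)) x
      have hle : (1 / 2 : ℝ) ^ k ≤ ((1 / 2) ^ k) ^ γ := by
        simpa using Real.rpow_le_rpow_of_exponent_ge hk0 hk1 hγ1
      have hb : 0 ≤ heatBound E 1 := heatBound_nonneg one_pos
      rw [pow_zero]
      refine h0.trans ?_
      rw [add_sub_cancel_left, ← mul_assoc]
      simp only [Finset.range_zero, Finset.sum_empty, mul_zero, add_zero]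
      gcongr
    | succ n ih =>
      have := (abs_le.1 (h n k j hj x)).1
      rw [Finset.sum_range_succ]
      linarith
  refine (hind n).trans ?_
  gcongr
  rw [div_eq_mul_inv]
  gcongr
  have := Summable.sum_le_tsum (Finset.range n) (fun i _ => by positivity)
    (summable_geometric_of_lt_one hq0.le hq1)
  rwa [tsum_geometric_of_lt_one hq0.le hq1] at this

lemma DyadicControl.exists_smoothOcc_Ioc_le (hy : Measurable y) (hT : 0 < T) (hγ0 : 0 < γ)
    (hγ1 : γ ≤ 1) (hη : 0 < η) (hq0 : 0 < q) (hq1 : q < 1) (h : DyadicControl y T γ η q) :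
    ∃ A : ℝ, 0 < A ∧ ∀ (n : ℕ) (x : E) (a b : ℝ), 0 ≤ a → a ≤ b → b ≤ T →
      smoothOcc y ((1 / 2) ^ n) (Ioc a b) x ≤ A * (b - a) ^ γ := by
  have h1q : 0 < 1 - q := by linarith
  have hb0 : 0 ≤ heatBound E 1 := heatBound_nonneg one_pos
  set A := heatBound E 1 * T + η / (1 - q) with hA
  have hA0 : 0 < A := by positivity
  refine ⟨4 * A / T ^ γ, by positivity, ?_⟩
  intro n x a b ha hab hbT
  rcases hab.eq_or_lt with rfl | hab'
  · simp [smoothOcc, Real.zero_rpow hγ0.ne']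
  have hba : 0 < b - a := sub_pos.2 hab'
  obtain ⟨k, hk1, hk2⟩ := exists_nat_pow_near_of_lt_one (x := (b - a) / T) (y := (1 / 2 : ℝ))
    (by positivity) ((div_le_one hT).2 (by linarith)) (by norm_num) (by norm_num)
  set s : ℝ := (1 / 2) ^ k with hs
  have hs0 : 0 < s := by positivity
  have h2k : (2 : ℝ) ^ k * s = 1 := by simp [hs]
  rw [div_le_iff₀ hT, mul_comm] at hk2
  have hTs : 0 < T * s := by positivity
  have hTk : T = 2 ^ k * (T * s) := by linear_combination -T * h2k
  set j := ⌊a / (T * s)⌋₊ with hj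
  have hj1 : j * (T * s) ≤ a := by
    rw [← le_div_iff₀ hTs]; exact Nat.floor_le (by positivity)
  have hj2 : a < j * (T * s) + T * s := by
    have := Nat.lt_floor_add_one (a / (T * s))
    rw [div_lt_iff₀ hTs] at this
    linarith
  have hjk : j < 2 ^ k := by
    have h1 : (j : ℝ) * (T * s) < 2 ^ k * (T * s) := by linarith
    exact_mod_cast lt_of_mul_lt_mul_right h1 hTs.le
  have hn0 : (0 : ℝ) < (1 / 2) ^ n := by positivity
  have hsγ : s ^ γ ≤ 2 * ((b - a) / T) ^ γ := by
    have h1 : s ≤ 2 * ((b - a) / T) := by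
      rw [pow_succ] at hk1
      linarith
    calc s ^ γ ≤ (2 * ((b - a) / T)) ^ γ := by gcongr
      _ = 2 ^ γ * ((b - a) / T) ^ γ := Real.mul_rpow (by norm_num) (by positivity)
      _ ≤ 2 * ((b - a) / T) ^ γ := by
        gcongr
        simpa using Real.rpow_le_rpow_of_exponent_le (by norm_num : (1 : ℝ) ≤ 2) hγ1
  have hmain : smoothOcc y ((1 / 2) ^ n) (Ioc a b) x ≤ A * s ^ γ + A * s ^ γ := by
    have hd0 := h.smoothOcc_dyadicIoc_le hy hT hγ1 hη hq0 hq1 hjk n x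
    have hp : 0 ≤ A * s ^ γ := by positivity
    by_cases hj' : j + 1 < 2 ^ k
    · have hd1 := h.smoothOcc_dyadicIoc_le hy hT hγ1 hη hq0 hq1 hj' n x
      have hsub := smoothOcc_mono hy hn0 (S := Ioc a b)
        (S' := Ioc (j * (T * s)) (j * (T * s) + T * s + T * s))
        (Ioc_subset_Ioc hj1 (by linarith)) (by simp) x
      rw [smoothOcc_union hy hn0 (r := j * (T * s)) (s := j * (T * s) + T * s)
        (t := j * (T * s) + T * s + T * s) (by linarith) (by linarith)] at hsub
      have e : dyadicIoc T k (j + 1) = Ioc (j * (T * s) + T * s) (j * (T * s) + T * s + T * s) := by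
        rw [dyadicIoc, ← hs]
        push_cast
        congr 1 <;> ring
      rw [e] at hd1
      exact hsub.trans (add_le_add hd0 hd1)
    · have hjeq : (j : ℝ) + 1 = 2 ^ k := by
        exact_mod_cast (by omega : j + 1 = 2 ^ k)
      have hbj : b ≤ j * (T * s) + T * s := by
        rw [← hjeq] at hTk
        linarith
      have hsub := smoothOcc_mono hy hn0 (S := Ioc a b) (S' := dyadicIoc T k j)
        (Ioc_subset_Ioc hj1 hbj) (by simp [dyadicIoc]) x
      linarith
  calc smoothOcc y ((1 / 2) ^ n) (Ioc a b) x ≤ A * s ^ γ + A * s ^ γ := hmain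
    _ ≤ A * (2 * ((b - a) / T) ^ γ) + A * (2 * ((b - a) / T) ^ γ) := by gcongr
    _ = 4 * A / T ^ γ * (b - a) ^ γ := by
      rw [Real.div_rpow hba.le hT.le]
      ring

lemma DyadicControl.abs_smoothOcc_sub_le (hy : Measurable y) (hT : 0 < T) (hγ0 : 0 < γ)
    (hη : 0 < η) (hq0 : 0 < q) (h : DyadicControl y T γ η q) (k n : ℕ) {j : ℕ}
    (hj : j ≤ 2 ^ k) (x : E) :
    |smoothOcc y ((1 / 2) ^ n) (Ioc 0 (j * (T * (1 / 2) ^ k))) x -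
      smoothOcc y ((1 / 2) ^ (n + 1)) (Ioc 0 (j * (T * (1 / 2) ^ k))) x| ≤ j * (η * q ^ n) := by
  induction j with
  | zero => simp [smoothOcc]
  | succ j ih =>
    have hjk : j < 2 ^ k := hj
    have e : ((j + 1 : ℕ) : ℝ) * (T * (1 / 2) ^ k) = j * (T * (1 / 2) ^ k) + T * (1 / 2) ^ k := by
      push_cast; ring
    have hle : (j : ℝ) * (T * (1 / 2) ^ k) ≤ j * (T * (1 / 2) ^ k) + T * (1 / 2) ^ k :=
      le_add_of_nonneg_right (by positivity)
    have h1 := h n k j hjk x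
    have hkγ : ((1 / 2 : ℝ) ^ k) ^ γ ≤ 1 :=
      Real.rpow_le_one (by positivity) (pow_le_one₀ (by norm_num) (by norm_num)) hγ0.le
    have h2 : η * q ^ n * ((1 / 2 : ℝ) ^ k) ^ γ ≤ η * q ^ n :=
      mul_le_of_le_one_right (by positivity) hkγ
    have hu : ∀ m : ℕ, smoothOcc y ((1 / 2) ^ m)
        (Ioc 0 (j * (T * (1 / 2) ^ k) + T * (1 / 2) ^ k)) x =
          smoothOcc y ((1 / 2) ^ m) (Ioc 0 (j * (T * (1 / 2) ^ k))) x +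
            smoothOcc y ((1 / 2) ^ m) (dyadicIoc T k j) x := fun m =>
      smoothOcc_union hy (by positivity) (by positivity) hle x
    rw [e, hu, hu, add_sub_add_comm]
    refine (abs_add_le _ _).trans ?_
    push_cast
    rw [add_mul, one_mul]
    exact add_le_add (ih hjk.le) (h1.trans h2)

lemma DyadicControl.uniformCauchySeqOn (hy : Measurable y) (hT : 0 < T) (hγ0 : 0 < γ)
    (hγ1 : γ ≤ 1) (hη : 0 < η) (hq0 : 0 < q) (hq1 : q < 1) (h : DyadicControl y T γ η q) :
    UniformCauchySeqOn (fun (n : ℕ) (p : E × ℝ) => smoothOcc y ((1 / 2) ^ n) (Ioc 0 p.2) p.1)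
      atTop (univ ×ˢ Icc 0 T) := by
  obtain ⟨A, hA0, hA⟩ := h.exists_smoothOcc_Ioc_le hy hT hγ0 hγ1 hη hq0 hq1
  have h1q : 0 < 1 - q := by linarith
  have key : ∀ (k n i : ℕ) (x : E) (t : ℝ), t ∈ Icc 0 T →
      |smoothOcc y ((1 / 2) ^ n) (Ioc 0 t) x - smoothOcc y ((1 / 2) ^ (n + i)) (Ioc 0 t) x| ≤
        2 * (A * (T * (1 / 2) ^ k) ^ γ) + 2 ^ k * η / (1 - q) * q ^ n := by
    intro k n i x t ht
    set s : ℝ := (1 / 2) ^ k with hs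
    have hs0 : 0 < s := by positivity
    have hTs : 0 < T * s := by positivity
    have h2k : (2 : ℝ) ^ k * s = 1 := by simp [hs]
    set j := ⌊t / (T * s)⌋₊ with hj
    have hj1 : j * (T * s) ≤ t := by
      rw [← le_div_iff₀ hTs]; exact Nat.floor_le (div_nonneg ht.1 hTs.le)
    have hj2 : t < j * (T * s) + T * s := by
      have := Nat.lt_floor_add_one (t / (T * s))
      rw [div_lt_iff₀ hTs] at this
      linarith
    have hjk : j ≤ 2 ^ k := by
      have h1 : (j : ℝ) * (T * s) ≤ 2 ^ k * (T * s) := by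
        have : (2 : ℝ) ^ k * (T * s) = T := by linear_combination T * h2k
        linarith [ht.2]
      exact_mod_cast le_of_mul_le_mul_right h1 hTs
    have hj0 : 0 ≤ j * (T * s) := by positivity
    have hinc : ∀ m : ℕ, smoothOcc y ((1 / 2) ^ m) (Ioc (j * (T * s)) t) x ≤ A * (T * s) ^ γ := by
      intro m
      refine (hA m x _ t hj0 hj1 ht.2).trans ?_
      gcongr
      linarith
    have hpos : ∀ m : ℕ, 0 ≤ smoothOcc y ((1 / 2) ^ m) (Ioc (j * (T * s)) t) x := fun m =>
      smoothOcc_nonneg y (by positivity) _ _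
    have hdy : |smoothOcc y ((1 / 2) ^ n) (Ioc 0 (j * (T * s))) x -
        smoothOcc y ((1 / 2) ^ (n + i)) (Ioc 0 (j * (T * s))) x| ≤
          2 ^ k * η * q ^ n * ∑ l ∈ Finset.range i, q ^ l := by
      induction i with
      | zero => simp
      | succ i ih =>
        have hstep := h.abs_smoothOcc_sub_le hy hT hγ0 hη hq0 k (n + i) hjk x
        have hjk' : (j : ℝ) ≤ 2 ^ k := by exact_mod_cast hjk
        have : (j : ℝ) * (η * q ^ (n + i)) ≤ 2 ^ k * (η * q ^ (n + i)) := by gcongr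
        rw [Finset.sum_range_succ, mul_add]
        refine (abs_sub_le _ (smoothOcc y ((1 / 2) ^ (n + i)) (Ioc 0 (j * (T * s))) x) _).trans ?_
        refine add_le_add ih ((hstep.trans this).trans_eq ?_)
        rw [pow_add]; ring
    have hgeo : ∑ l ∈ Finset.range i, q ^ l ≤ (1 - q)⁻¹ := by
      have := Summable.sum_le_tsum (Finset.range i) (fun i _ => by positivity)
        (summable_geometric_of_lt_one hq0.le hq1)
      rwa [tsum_geometric_of_lt_one hq0.le hq1] at this
    have hdy' : 2 ^ k * η * q ^ n * ∑ l ∈ Finset.range i, q ^ l ≤ 2 ^ k * η / (1 - q) * q ^ n := by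
      calc _ ≤ 2 ^ k * η * q ^ n * (1 - q)⁻¹ := by gcongr
        _ = _ := by ring
    rw [smoothOcc_union hy (by positivity) hj0 hj1, smoothOcc_union hy (by positivity) hj0 hj1]
    have := abs_le.1 (hdy.trans hdy')
    have h1 := hinc n
    have h2 := hinc (n + i)
    have h3 := hpos n
    have h4 := hpos (n + i)
    rw [abs_le]
    constructor <;> linarith
  rw [Metric.uniformCauchySeqOn_iff]
  intro ε hε
  have hlim1 : Tendsto (fun k : ℕ => 2 * (A * (T * (1 / 2) ^ k) ^ γ)) atTop (nhds 0) := by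
    have h0 : Tendsto (fun k : ℕ => T * (1 / 2 : ℝ) ^ k) atTop (nhds 0) := by
      simpa using (tendsto_pow_atTop_nhds_zero_of_lt_one (r := (1 / 2 : ℝ)) (by norm_num)
        (by norm_num)).const_mul T
    have := ((h0.rpow_const (p := γ) (Or.inr hγ0.le)).const_mul A).const_mul 2
    simpa [Real.zero_rpow hγ0.ne'] using this
  obtain ⟨k, hk⟩ := (hlim1.eventually (gt_mem_nhds (by positivity : 0 < ε / 4))).exists
  have hlim2 : Tendsto (fun n : ℕ => 2 ^ k * η / (1 - q) * q ^ n) atTop (nhds 0) := by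
    simpa using (tendsto_pow_atTop_nhds_zero_of_lt_one hq0.le hq1).const_mul (2 ^ k * η / (1 - q))
  obtain ⟨N, hN⟩ := (hlim2.eventually (gt_mem_nhds (by positivity : 0 < ε / 4))).exists
  refine ⟨N, fun m hm n hn p hp => ?_⟩
  obtain ⟨i, rfl⟩ := Nat.exists_eq_add_of_le hm
  obtain ⟨i', rfl⟩ := Nat.exists_eq_add_of_le hn
  have h1 := key k N i p.1 p.2 hp.2
  have h2 := key k N i' p.1 p.2 hp.2
  rw [abs_le] at h1 h2
  rw [Real.dist_eq, abs_lt]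
  constructor <;> linarith

lemma continuousOn_smoothOcc (hy : Measurable y) {a : ℝ} (ha : 0 < a) :
    ContinuousOn (fun p : E × ℝ => smoothOcc y a (Ioc 0 p.2) p.1) (univ ×ˢ Icc 0 T) := by
  have hx : ∀ t, Continuous fun x => smoothOcc y a (Ioc 0 t) x := by
    intro t
    have hm := (continuous_heatKernel (V := E) a).measurable
    refine continuous_of_dominated (bound := fun _ => heatBound E a)
      (fun x => Measurable.aestronglyMeasurable (by fun_prop)) (fun x => ?_)
      (integrableOn_const (by simp)) (Eventually.of_forall fun s => ?_)
    · refine Eventually.of_forall fun s => ?_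
      rw [Real.norm_of_nonneg (heatKernel_nonneg ha _)]
      exact heatKernel_le ha _
    · exact (continuous_heatKernel a).comp (continuous_id.sub continuous_const)
  have ht : ∀ x, LipschitzOnWith (Real.toNNReal (heatBound E a))
      (fun t => smoothOcc y a (Ioc 0 t) x) (Icc 0 T) := by
    intro x
    refine LipschitzOnWith.of_dist_le_mul fun s hs t ht => ?_
    rw [Real.coe_toNNReal _ (heatBound_nonneg ha)]
    wlog hst : s ≤ t generalizing s t
    · rw [dist_comm, dist_comm s]
      exact this t ht s hs (le_of_not_ge hst)
    rw [smoothOcc_union hy ha hs.1 hst, Real.dist_eq, Real.dist_eq, abs_sub_comm s,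
      abs_of_nonneg (sub_nonneg.2 hst), sub_add_cancel_left, abs_neg,
      abs_of_nonneg (smoothOcc_nonneg y ha _ _)]
    exact smoothOcc_Ioc_le hy ha hst x
  have := continuousOn_prod_of_continuousOn_lipschitzOnWith
    (fun p : ℝ × E => smoothOcc y a (Ioc 0 p.1) p.2) (s := Icc 0 T) (t := univ) _
    (fun t _ => (hx t).continuousOn) (fun x _ => ht x)
  exact this.comp continuous_swap.continuousOn fun p hp => ⟨hp.2, hp.1⟩

end DyadicIncrement

section LocalTime

variable {E : Type*} [NormedAddCommGroup E] [InnerProductSpace ℝ E] [MeasurableSpace E]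

/-- The limit of the dyadic mollifications of the occupation density of `y` on `(0, t]`. -/
def occLimit (y : ℝ → E) (x : E) (t : ℝ) : ℝ :=
  limUnder atTop fun n : ℕ => smoothOcc y ((1 / 2) ^ n) (Ioc 0 t) x

variable [FiniteDimensional ℝ E] [BorelSpace E] {y : ℝ → E} {T γ η q : ℝ}

lemma DyadicControl.tendsto_occLimit (hy : Measurable y) (hT : 0 < T) (hγ0 : 0 < γ)
    (hγ1 : γ ≤ 1) (hη : 0 < η) (hq0 : 0 < q) (hq1 : q < 1) (h : DyadicControl y T γ η q)
    {t : ℝ} (ht : t ∈ Icc 0 T) (x : E) :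
    Tendsto (fun n : ℕ => smoothOcc y ((1 / 2) ^ n) (Ioc 0 t) x) atTop (nhds (occLimit y x t)) :=
  tendsto_nhds_limUnder (cauchySeq_tendsto_of_complete
    ((h.uniformCauchySeqOn hy hT hγ0 hγ1 hη hq0 hq1).cauchySeq (x := (x, t)) ⟨mem_univ _, ht⟩))

lemma DyadicControl.continuousOn_occLimit (hy : Measurable y) (hT : 0 < T) (hγ0 : 0 < γ)
    (hγ1 : γ ≤ 1) (hη : 0 < η) (hq0 : 0 < q) (hq1 : q < 1) (h : DyadicControl y T γ η q) :
    ContinuousOn (fun p : E × ℝ => occLimit y p.1 p.2) (univ ×ˢ Icc 0 T) :=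
  ((h.uniformCauchySeqOn hy hT hγ0 hγ1 hη hq0 hq1).tendstoUniformlyOn_of_tendsto
    fun p hp => h.tendsto_occLimit hy hT hγ0 hγ1 hη hq0 hq1 hp.2 p.1).continuousOn
      (Frequently.of_forall fun _ => continuousOn_smoothOcc hy (by positivity))

lemma DyadicControl.exists_abs_occLimit_sub_le (hy : Measurable y) (hT : 0 < T) (hγ0 : 0 < γ)
    (hγ1 : γ ≤ 1) (hη : 0 < η) (hq0 : 0 < q) (hq1 : q < 1) (h : DyadicControl y T γ η q) :
    ∃ A : ℝ, 0 < A ∧ ∀ s ∈ Icc 0 T, ∀ t ∈ Icc 0 T, ∀ x,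
      |occLimit y x t - occLimit y x s| ≤ A * |t - s| ^ γ := by
  obtain ⟨A, hA0, hA⟩ := h.exists_smoothOcc_Ioc_le hy hT hγ0 hγ1 hη hq0 hq1
  refine ⟨A, hA0, fun s hs t ht x => ?_⟩
  wlog hst : s ≤ t generalizing s t
  · rw [abs_sub_comm, abs_sub_comm t]
    exact this t ht s hs (le_of_not_ge hst)
  refine le_of_tendsto ((h.tendsto_occLimit hy hT hγ0 hγ1 hη hq0 hq1 ht x).sub
    (h.tendsto_occLimit hy hT hγ0 hγ1 hη hq0 hq1 hs x)).abs (Eventually.of_forall fun n => ?_)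
  have hn : (0 : ℝ) < (1 / 2) ^ n := by positivity
  rw [smoothOcc_union hy hn hs.1 hst, add_sub_cancel_left, abs_of_nonneg (sub_nonneg.2 hst),
    abs_of_nonneg (smoothOcc_nonneg y hn _ _)]
  exact hA n x s t hs.1 hst ht.2

lemma DyadicControl.occLimit_nonneg (hy : Measurable y) (hT : 0 < T) (hγ0 : 0 < γ)
    (hγ1 : γ ≤ 1) (hη : 0 < η) (hq0 : 0 < q) (hq1 : q < 1) (h : DyadicControl y T γ η q)
    {t : ℝ} (ht : t ∈ Icc 0 T) (x : E) : 0 ≤ occLimit y x t :=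
  ge_of_tendsto' (h.tendsto_occLimit hy hT hγ0 hγ1 hη hq0 hq1 ht x)
    fun _ => smoothOcc_nonneg y (by positivity) _ _

lemma integral_smoothOcc_mul (hy : Measurable y) {a : ℝ} (ha : 0 < a) {f : E → ℝ}
    (hf : Integrable f) (hfm : Measurable f) (t : ℝ) :
    ∫ x, smoothOcc y a (Ioc 0 t) x * f x =
      ∫ s in Ioc 0 t, ∫ x, f x * heatKernel a (x - y s) := by
  have hm := (continuous_heatKernel (V := E) a).measurable
  rw [integral_integral_swap]
  · simp_rw [smoothOcc, ← integral_mul_const, mul_comm]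
  · refine ((hf.norm.mul_const (heatBound E a)).comp_snd (volume.restrict (Ioc 0 t))).mono'
      (Measurable.aestronglyMeasurable (by unfold Function.uncurry; fun_prop))
      (Eventually.of_forall fun p => ?_)
    rw [Function.uncurry, norm_mul, Real.norm_of_nonneg (heatKernel_nonneg ha _)]
    exact mul_le_mul_of_nonneg_left (heatKernel_le ha _) (norm_nonneg _)

lemma abs_integral_mul_heatKernel_le {a C : ℝ} (ha : 0 < a) {f : E → ℝ} (hfC : ∀ x, |f x| ≤ C)
    (z : E) : |∫ x, f x * heatKernel a (x - z)| ≤ C := by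
  have hi : Integrable fun x : E => C * heatKernel a (x - z) :=
    ((integrable_heatKernel ha).comp_sub_right z).const_mul C
  calc |∫ x, f x * heatKernel a (x - z)| ≤ ∫ x, C * heatKernel a (x - z) := by
        rw [← Real.norm_eq_abs]
        refine norm_integral_le_of_norm_le hi (Eventually.of_forall fun x => ?_)
        rw [norm_mul, Real.norm_of_nonneg (heatKernel_nonneg ha _), Real.norm_eq_abs]
        exact mul_le_mul_of_nonneg_right (hfC x) (heatKernel_nonneg ha _)
    _ = C := by
        rw [integral_const_mul, integral_sub_right_eq_self (fun x : E => heatKernel a x) z,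
          integral_heatKernel ha, mul_one]

lemma DyadicControl.map_restrict_eq_withDensity (hy : Measurable y) (hT : 0 < T) (hγ0 : 0 < γ)
    (hγ1 : γ ≤ 1) (hη : 0 < η) (hq0 : 0 < q) (hq1 : q < 1) (h : DyadicControl y T γ η q)
    {t : ℝ} (ht : t ∈ Icc 0 T) :
    Measure.map y (volume.restrict (Icc 0 t)) =
      volume.withDensity fun x => ENNReal.ofReal (occLimit y x t) := by
  have hL := fun x => h.tendsto_occLimit hy hT hγ0 hγ1 hη hq0 hq1 ht x
  have hLc : Continuous fun x => occLimit y x t := by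
    rw [← continuousOn_univ]
    exact (h.continuousOn_occLimit hy hT hγ0 hγ1 hη hq0 hq1).comp (f := fun x => (x, t))
      (by fun_prop) fun x _ => ⟨mem_univ _, ht⟩
  have : IsLocallyFiniteMeasure
      ((volume : Measure E).withDensity fun x => ENNReal.ofReal (occLimit y x t)) :=
    IsLocallyFiniteMeasure.withDensity_ofReal hLc
  refine Measure.ext_of_integral_eq_on_compactlySupported fun f => ?_
  have hfc : Continuous f := f.continuous
  have hfi : Integrable f := hfc.integrable_of_hasCompactSupport f.hasCompactSupport
  obtain ⟨C, hC⟩ := f.hasCompactSupport.exists_bound_of_continuous hfc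
  rw [integral_map hy.aemeasurable hfc.aestronglyMeasurable, integral_Icc_eq_integral_Ioc,
    integral_withDensity_eq_integral_toReal_smul (by fun_prop) (by simp)]
  simp_rw [ENNReal.toReal_ofReal (h.occLimit_nonneg hy hT hγ0 hγ1 hη hq0 hq1 ht _), smul_eq_mul]
  obtain ⟨A, hA0, hA⟩ := h.exists_smoothOcc_Ioc_le hy hT hγ0 hγ1 hη hq0 hq1
  have hm : ∀ a, Measurable (heatKernel a : E → ℝ) := fun a => (continuous_heatKernel a).measurable
  have hs : ∀ n : ℕ, (0 : ℝ) < (1 / 2) ^ n := fun n => by positivity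
  have hs0 : Tendsto (fun n : ℕ => (1 / 2 : ℝ) ^ n) atTop (nhds 0) :=
    tendsto_pow_atTop_nhds_zero_of_lt_one (by norm_num) (by norm_num)
  have h1 : Tendsto (fun n : ℕ => ∫ x, smoothOcc y ((1 / 2) ^ n) (Ioc 0 t) x * f x) atTop
      (nhds (∫ x, occLimit y x t * f x)) := by
    refine tendsto_integral_of_dominated_convergence (fun x => A * (t - 0) ^ γ * ‖f x‖)
      (fun n => ?_) (hfi.norm.const_mul _) (fun n => Eventually.of_forall fun x => ?_)
      (Eventually.of_forall fun x => (hL x).mul_const _)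
    · have hc : Continuous fun x => smoothOcc y ((1 / 2) ^ n) (Ioc 0 t) x := by
        rw [← continuousOn_univ]
        exact (continuousOn_smoothOcc (T := T) hy (hs n)).comp (f := fun x => (x, t))
          (by fun_prop) fun x _ => ⟨mem_univ _, ht⟩
      exact (hc.mul hfc).aestronglyMeasurable
    · rw [norm_mul, Real.norm_of_nonneg (smoothOcc_nonneg y (hs n) _ _)]
      exact mul_le_mul_of_nonneg_right (hA n x 0 t le_rfl ht.1 ht.2) (norm_nonneg _)
  have h2 : Tendsto (fun n : ℕ => ∫ s in Ioc 0 t, ∫ x, f x * heatKernel ((1 / 2) ^ n) (x - y s))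
      atTop (nhds (∫ s in Ioc 0 t, f (y s))) := by
    refine tendsto_integral_of_dominated_convergence (fun _ => C) (fun n => ?_)
      (integrableOn_const (by simp))
      (fun n => Eventually.of_forall fun s => abs_integral_mul_heatKernel_le (hs n) hC _)
      (Eventually.of_forall fun s => tendsto_heatKernel_integral hfi hfc hs hs0 (y s))
    have hmn := hm ((1 / 2) ^ n)
    have hfm := hfc.measurable
    exact (StronglyMeasurable.integral_prod_right
      (Measurable.stronglyMeasurable (by fun_prop))).aestronglyMeasurable
  refine tendsto_nhds_unique h2 ?_
  simpa only [integral_smoothOcc_mul hy (hs _) hfi hfc.measurable] using h1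

end LocalTime

/-- Let `α ∈ (0,1/2]`, `d ≤ ⌊1/α⌋ − 1`, `Y` `α`-LND on `[0,T]` with `Y_0 = 0` a.s.
Then there is a jointly continuous version `L(ξ,t,ω)` of the local time of `Y`, which for
every `0 < γ < 1 − dα` is a.s. `γ`-Hölder continuous in `t`, uniformly in `ξ`. -/
theorem jointly_continuous_local_time_of_LND
    {Ω : Type*} [MeasurableSpace Ω] (P : Measure Ω) [IsProbabilityMeasure P]
    (α : ℝ) (hα0 : 0 < α) (hα : α ≤ 1 / 2)
    (d : ℕ) (hd1 : 1 ≤ d) (hd : (d : ℤ) ≤ ⌊(1 : ℝ) / α⌋ - 1)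
    (T : ℝ) (hT : 0 < T)
    (Y : ℝ → Ω → EuclideanSpace ℝ (Fin d))
    (hmeas : Measurable (Function.uncurry Y))
    (hY0 : ∀ᵐ ω ∂P, Y 0 ω = 0)
    (hLND : IsLND P d Y T α) :
    ∃ L : EuclideanSpace ℝ (Fin d) → ℝ → Ω → ℝ,
      -- (i) a.s. joint continuity on ℝ^d × [0,T]
      (∀ᵐ ω ∂P,
        ContinuousOn (fun q : EuclideanSpace ℝ (Fin d) × ℝ => L q.1 q.2 ω)
          (Set.univ ×ˢ Set.Icc 0 T)) ∧
      -- (ii) for each t ∈ [0,T], a.s. L(·,t,ω) is a Lebesgue density of the occupation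
      -- measure of s ↦ Y_s(ω) on [0,t]
      (∀ t ∈ Set.Icc (0 : ℝ) T, ∀ᵐ ω ∂P,
        (∀ᵐ ξ ∂(volume : Measure (EuclideanSpace ℝ (Fin d))), 0 ≤ L ξ t ω) ∧
        Measure.map (fun s => Y s ω) (volume.restrict (Set.Icc 0 t)) =
          volume.withDensity (fun ξ => ENNReal.ofReal (L ξ t ω))) ∧
      -- (iii) a.s. uniform-in-ξ Hölder continuity in t of every order γ < 1 − dα
      (∀ γ : ℝ, 0 < γ → γ < 1 - d * α →
        ∀ᵐ ω ∂P, ∃ η : ℝ, 0 < η ∧ ∃ δ : ℝ, 0 < δ ∧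
          ∀ s ∈ Set.Icc (0 : ℝ) T, ∀ t ∈ Set.Icc (0 : ℝ) T, |t - s| < δ →
            ∀ ξ : EuclideanSpace ℝ (Fin d),
              |L ξ t ω - L ξ s ω| ≤ η * |t - s| ^ γ) := by
  have hdα : d * α < 1 := by
    have h1 : ((d + 1 : ℤ) : ℝ) ≤ 1 / α := Int.le_floor.1 (by linarith)
    rw [le_div_iff₀ hα0] at h1
    push_cast at h1
    linarith
  have hdα0 : 0 ≤ d * α := by positivity
  have hy : ∀ ω, Measurable fun s => Y s ω := fun ω => hmeas.comp measurable_prodMk_right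
  have hγ0 : 0 < (1 - d * α) / 2 := by linarith
  have hγ1 : (1 - d * α) / 2 ≤ 1 := by linarith
  have hdy := hLND.ae_exists_dyadic_bound hα0 hT hmeas hγ0 (by linarith)
  refine ⟨fun x t ω => occLimit (fun s => Y s ω) x t, ?_, fun t ht => ?_, fun γ hγ hγ' => ?_⟩
  · filter_upwards [hdy] with ω ⟨η, hη, q, hq0, hq1, h⟩
    have hc : DyadicControl (fun s => Y s ω) T ((1 - d * α) / 2) η q := h
    exact hc.continuousOn_occLimit (hy ω) hT hγ0 hγ1 hη hq0 hq1
  · filter_upwards [hdy] with ω ⟨η, hη, q, hq0, hq1, h⟩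
    have hc : DyadicControl (fun s => Y s ω) T ((1 - d * α) / 2) η q := h
    exact ⟨Eventually.of_forall fun x => hc.occLimit_nonneg (hy ω) hT hγ0 hγ1 hη hq0 hq1 ht x,
      hc.map_restrict_eq_withDensity (hy ω) hT hγ0 hγ1 hη hq0 hq1 ht⟩
  · filter_upwards [hLND.ae_exists_dyadic_bound hα0 hT hmeas hγ hγ'] with
      ω ⟨η, hη, q, hq0, hq1, h⟩
    have hc : DyadicControl (fun s => Y s ω) T γ η q := h
    obtain ⟨A, hA0, hA⟩ :=
      hc.exists_abs_occLimit_sub_le (hy ω) hT hγ (by linarith) hη hq0 hq1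
    exact ⟨A, hA0, 1, one_pos, fun s hs t ht _ x => hA s hs t ht x⟩
end
end

section
/- Let α∈(0,1/2], let d ≤ ⌊1/α⌋−1, suppose that Y is α-LND on [0,T], that Y_0=0 almost surely, and that Y has continuous sample paths. Then almost surely every coordinate function of Y is nowhere Hölder continuous of order greater than α: for P-almost every ω, for every l∈{1,…,d}, every t₀∈[0,T] and every γ>α, there do not exist a constant C>0 and a neighborhood I of t₀ in [0,T] such that |Y_l(t,ω)−Y_l(t₀,ω)| ≤ C·|t−t₀|^γ for all t∈I. (Abstract form of Corollary 1.2, where the solution of the stochastic heat equation satisfies the hypotheses with α=1/4 and d≤3.) -/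
open MeasureTheory Filter Set
open scoped ENNReal NNReal RealInnerProductSpace

noncomputable section

/-- The reciprocal square root of the modulus of a standard Gaussian variable is integrable. -/
lemma integrable_sqrt_abs_inv_gaussianReal :
    Integrable (fun x : ℝ => √(|x|⁻¹)) (ProbabilityTheory.gaussianReal 0 1) := by
  rw [ProbabilityTheory.gaussianReal_of_var_ne_zero _ one_ne_zero,
    integrable_withDensity_iff_integrable_smul' (ProbabilityTheory.measurable_gaussianPDF 0 1)
      (ae_of_all _ fun _ => ProbabilityTheory.gaussianPDF_lt_top)]
  have hf := integrable_rpow_mul_exp_neg_mul_sq (b := 1 / 2) (by norm_num)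
    (s := -(1 / 2)) (by norm_num)
  refine ((hf.add hf.comp_neg).const_mul (√(2 * Real.pi))⁻¹).congr ?_
  have h0 : ∀ᵐ x : ℝ, x ≠ 0 := by simp [ae_iff]
  have hpos : ∀ x : ℝ, 0 < x →
      x ^ (-(1 / 2) : ℝ) = √(|x|⁻¹) ∧ (-x) ^ (-(1 / 2) : ℝ) = 0 := by
    intro x hx
    constructor
    · rw [abs_of_pos hx, Real.sqrt_eq_rpow, Real.rpow_neg hx.le, Real.inv_rpow hx.le]
    · rw [Real.rpow_def_of_neg (by linarith), neg_mul, Real.cos_neg,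
        show (1 / 2 : ℝ) * Real.pi = Real.pi / 2 by ring, Real.cos_pi_div_two, mul_zero]
  filter_upwards [h0] with x hx
  rw [ProbabilityTheory.toReal_gaussianPDF, ProbabilityTheory.gaussianPDFReal]
  have he : Real.exp (-(1 / 2) * x ^ 2) = Real.exp (-(x - 0) ^ 2 / (2 * ((1 : ℝ≥0) : ℝ))) := by
    congr 1; push_cast; ring
  simp only [Pi.add_apply, neg_sq, he, smul_eq_mul, NNReal.coe_one, mul_one]
  rcases lt_or_gt_of_ne hx with h | h
  · obtain ⟨h1, h2⟩ := hpos (-x) (by linarith)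
    rw [neg_neg] at h2
    rw [h1, h2, abs_neg]; ring
  · obtain ⟨h1, h2⟩ := hpos x h
    rw [h1, h2]; ring

/-- The characteristic function of the standard Gaussian law. -/
lemma integral_cexp_gaussianReal (z : ℝ) :
    ∫ g : ℝ, Complex.exp (Complex.I * ((g * z : ℝ) : ℂ)) ∂(ProbabilityTheory.gaussianReal 0 1)
      = ((Real.exp (-(z ^ 2) / 2) : ℝ) : ℂ) := by
  have h := ProbabilityTheory.charFun_gaussianReal (μ := 0) (v := 1) z
  rw [charFun_apply_real] at h
  rw [show (fun g : ℝ => Complex.exp (Complex.I * ((g * z : ℝ) : ℂ))) =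
    fun g : ℝ => Complex.exp (z * g * Complex.I) by
      funext g; congr 1; push_cast; ring, h]
  push_cast
  congr 1
  simp
  ring

/-- The standard Gaussian law does not charge the origin. -/
lemma ae_gaussianReal_ne_zero : ∀ᵐ x ∂(ProbabilityTheory.gaussianReal 0 1), x ≠ 0 := by
  have h : ∀ᵐ x : ℝ, x ≠ 0 := by simp [ae_iff]
  exact (ProbabilityTheory.gaussianReal_absolutelyContinuous 0 one_ne_zero).ae_le h

/-- A small ball estimate: decay of the characteristic function of a random vector bounds the
probability that all its coordinates are small. -/
lemma measureReal_forall_abs_le_of_charFun_bound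
    {Ω : Type*} [MeasurableSpace Ω] (P : Measure Ω) [IsProbabilityMeasure P] {N : ℕ}
    (Z : Fin N → Ω → ℝ) (hZ : ∀ j, Measurable (Z j)) {c b ε : ℝ} (hc : 0 ≤ c) (hb : 0 < b)
    (hε : 0 < ε)
    (hφ : ∀ g : Fin N → ℝ, (∀ j, g j ≠ 0) →
      ‖∫ ω, Complex.exp (Complex.I * ((∑ j, g j * Z j ω : ℝ) : ℂ)) ∂P‖ ≤
        c * ∏ j, |g j|⁻¹ * b⁻¹) :
    P.real {ω | ∀ j, |Z j ω| ≤ ε} ≤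
      (√c * (Real.exp (1 / 2) * ∫ x, √(|x|⁻¹) ∂(ProbabilityTheory.gaussianReal 0 1)) ^ N) *
        √(ε / b) ^ N := by
  set G := ProbabilityTheory.gaussianReal 0 1
  set π : Measure (Fin N → ℝ) := Measure.pi fun _ => G with hπ
  set S := {ω | ∀ j, |Z j ω| ≤ ε} with hS
  have hSm : MeasurableSet S := by
    rw [hS, Set.ofPred_forall]
    exact MeasurableSet.iInter fun j =>
      measurableSet_le ((hZ j).abs) measurable_const
  have hF_meas : Measurable fun ω => ∏ j, Real.exp (-((Z j ω / ε) ^ 2) / 2) := by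
    fun_prop
  have hF_int : Integrable (fun ω => ∏ j, Real.exp (-((Z j ω / ε) ^ 2) / 2)) P := by
    refine (integrable_const (1 : ℝ)).mono' hF_meas.aestronglyMeasurable (ae_of_all _ fun ω => ?_)
    rw [Real.norm_of_nonneg (by positivity)]
    refine Finset.prod_le_one (fun _ _ => by positivity) fun j _ => Real.exp_le_one_iff.2 ?_
    have := sq_nonneg (Z j ω / ε)
    linarith
  have hS_le : P.real S ≤
      Real.exp (1 / 2) ^ N * ∫ ω, ∏ j, Real.exp (-((Z j ω / ε) ^ 2) / 2) ∂P := by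
    rw [← integral_indicator_one hSm, ← integral_const_mul]
    refine integral_mono ((integrable_const (1 : ℝ)).indicator hSm) (hF_int.const_mul _) ?_
    intro ω
    by_cases hω : ω ∈ S
    · simp only [indicator_of_mem hω, Pi.one_apply]
      have hconst : Real.exp (1 / 2) ^ N = ∏ _j : Fin N, Real.exp (1 / 2) := by simp
      rw [hconst, ← Finset.prod_mul_distrib]
      refine Finset.one_le_prod fun j _ => ?_
      rw [← Real.exp_add]
      refine Real.one_le_exp ?_
      have h1 : |Z j ω / ε| ≤ 1 := by
        rw [abs_div, abs_of_pos hε]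
        exact (div_le_one hε).2 (hω j)
      have h2 := (sq_le_one_iff_abs_le_one _).2 h1
      linarith
    · simp only [indicator_of_notMem hω]
      positivity
  have hmeas2 : Measurable (Function.uncurry fun (ω : Ω) (g : Fin N → ℝ) =>
      Complex.exp (Complex.I * ((∑ j, g j / ε * Z j ω : ℝ) : ℂ))) := by
    unfold Function.uncurry
    fun_prop
  have hnorm : ∀ (ω : Ω) (g : Fin N → ℝ),
      ‖Complex.exp (Complex.I * ((∑ j, g j / ε * Z j ω : ℝ) : ℂ))‖ = 1 := fun ω g => by
    rw [mul_comm, Complex.norm_exp_ofReal_mul_I]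
  have hfubini : ((∫ ω, ∏ j, Real.exp (-((Z j ω / ε) ^ 2) / 2) ∂P : ℝ) : ℂ) =
      ∫ g, ∫ ω, Complex.exp (Complex.I * ((∑ j, g j / ε * Z j ω : ℝ) : ℂ)) ∂P ∂π := by
    rw [← integral_integral_swap, ← integral_complex_ofReal]
    · refine integral_congr_ae (ae_of_all _ fun ω => ?_)
      simp only
      rw [Complex.ofReal_prod]
      simp_rw [← integral_cexp_gaussianReal]
      rw [← integral_fintype_prod_eq_prod]
      refine integral_congr_ae (ae_of_all _ fun g => ?_)
      simp only
      rw [← Complex.exp_sum, ← Finset.mul_sum, ← Complex.ofReal_sum]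
      congr 4
      funext j
      ring
    · refine (integrable_const (1 : ℝ)).mono' hmeas2.aestronglyMeasurable
        (ae_of_all _ fun p => ?_)
      exact (hnorm p.1 p.2).le
  have hint : Integrable (fun g : Fin N → ℝ => ∏ j, √(|g j|⁻¹)) π :=
    Integrable.fintype_prod (f := fun _ x => √(|x|⁻¹))
      fun _ => integrable_sqrt_abs_inv_gaussianReal
  have hne : ∀ᵐ g ∂π, ∀ j, g j ≠ 0 := by
    rw [ae_all_iff]
    exact fun j => (Measure.quasiMeasurePreserving_eval (fun _ : Fin N => G) j).ae
      ae_gaussianReal_ne_zero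
  have hgauss_le : ∫ ω, ∏ j, Real.exp (-((Z j ω / ε) ^ 2) / 2) ∂P ≤
      (√c * √(ε / b) ^ N) * (∫ x, √(|x|⁻¹) ∂G) ^ N := by
    have h1 : ∫ ω, ∏ j, Real.exp (-((Z j ω / ε) ^ 2) / 2) ∂P =
        ‖∫ g, ∫ ω, Complex.exp (Complex.I * ((∑ j, g j / ε * Z j ω : ℝ) : ℂ)) ∂P ∂π‖ := by
      rw [← hfubini, Complex.norm_real, Real.norm_of_nonneg]
      exact integral_nonneg fun ω => by positivity
    have h2 : (∫ x, √(|x|⁻¹) ∂G) ^ N = ∫ g : Fin N → ℝ, ∏ j, √(|g j|⁻¹) ∂π := by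
      rw [hπ, integral_fintype_prod_eq_pow (fun x : ℝ => √(|x|⁻¹)), Fintype.card_fin]
    rw [h1, h2, ← integral_const_mul]
    refine norm_integral_le_of_norm_le (hint.const_mul _) ?_
    filter_upwards [hne] with g hg
    set q := ‖∫ ω, Complex.exp (Complex.I * ((∑ j, g j / ε * Z j ω : ℝ) : ℂ)) ∂P‖
    have hq0 : 0 ≤ q := norm_nonneg _
    have hq1 : q ≤ 1 := by
      refine (norm_integral_le_of_norm_le_const (C := 1)
        (ae_of_all _ fun ω => (hnorm ω g).le)).trans ?_
      simp
    have hq2 : q ≤ c * ∏ j, |g j / ε|⁻¹ * b⁻¹ :=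
      hφ (fun j => g j / ε) fun j => div_ne_zero (hg j) hε.ne'
    have hq3 : q ≤ √q := Real.le_sqrt_of_sq_le (by nlinarith)
    refine hq3.trans ((Real.sqrt_le_sqrt hq2).trans (le_of_eq ?_))
    have h3 : ∏ j, |g j / ε|⁻¹ * b⁻¹ = (ε / b) ^ N * ∏ j, |g j|⁻¹ := by
      have hconst : (ε / b) ^ N = ∏ _j : Fin N, (ε / b) := by
        rw [Finset.prod_const, Finset.card_univ, Fintype.card_fin]
      rw [hconst, ← Finset.prod_mul_distrib]
      refine Finset.prod_congr rfl fun j _ => ?_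
      rw [abs_div, abs_of_pos hε, inv_div]
      ring
    have h4 : √(∏ j, |g j|⁻¹) = ∏ j, √(|g j|⁻¹) := by
      simp_rw [Real.sqrt_eq_rpow]
      rw [Real.finsetProd_rpow _ _ fun _ _ => by positivity]
    have h5 : √((ε / b) ^ N) = √(ε / b) ^ N := by
      rw [Real.sqrt_eq_iff_mul_self_eq (by positivity) (by positivity), ← mul_pow,
        Real.mul_self_sqrt (by positivity)]
    rw [h3, Real.sqrt_mul hc, Real.sqrt_mul (by positivity), h4, h5, mul_assoc]
  calc P.real S ≤ Real.exp (1 / 2) ^ N * ∫ ω, ∏ j, Real.exp (-((Z j ω / ε) ^ 2) / 2) ∂P := hS_le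
    _ ≤ Real.exp (1 / 2) ^ N * ((√c * √(ε / b) ^ N) * (∫ x, √(|x|⁻¹) ∂G) ^ N) := by gcongr
    _ = _ := by rw [mul_pow]; ring

/-- An `α`-LND process has coordinates whose consecutive increments over an equidistant grid have a
jointly decaying characteristic function. -/
lemma IsLND.charFun_increments_le {Ω : Type*} [MeasurableSpace Ω] {P : Measure Ω}
    [IsProbabilityMeasure P] {d : ℕ} {Y : ℝ → Ω → EuclideanSpace ℝ (Fin d)} {T α : ℝ}
    (hY : ∀ t, Measurable (Y t)) (hLND : IsLND P d Y T α) (l : Fin d) {N : ℕ} (hN : 1 ≤ N) :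
    ∃ c : ℝ, 0 < c ∧ ∀ a h : ℝ, 0 < a → 0 < h → a + N * h ≤ T →
      ∀ g : Fin N → ℝ, (∀ j, g j ≠ 0) →
        ‖∫ ω, Complex.exp (Complex.I * ((∑ j : Fin N,
          g j * (Y (a + ((j : ℕ) + 1 : ℝ) * h) ω l - Y (a + (j : ℕ) * h) ω l) : ℝ) : ℂ)) ∂P‖ ≤
          c * ∏ j, |g j|⁻¹ * (h ^ α)⁻¹ := by
  obtain ⟨c, hc, H⟩ := hLND (N + 1) (by omega)
    (Fin.cons (fun _ => 0) fun _ l' => if l' = l then 1 else 0)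
  refine ⟨c, hc, fun a h ha hh haT g hg => ?_⟩
  set t : Fin (N + 1 + 1) → ℝ := Fin.cons 0 fun j : Fin (N + 1) => a + (j : ℕ) * h with ht
  have ht_mono : StrictMono t := by
    rw [Fin.strictMono_iff_lt_succ]
    intro i
    refine Fin.cases ?_ (fun j => ?_) i
    · simp [ht, ha]
    · rw [Fin.castSucc_succ]
      simp only [ht, Fin.cons_succ, Fin.val_castSucc, Fin.val_succ]
      push_cast
      nlinarith
  let v : ℝ → Fin (N + 1) → EuclideanSpace ℝ (Fin d) := fun δ =>
    Fin.cons (WithLp.toLp 2 fun _ => δ)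
      fun j => WithLp.toLp 2 fun l' => if l' = l then g j else δ
  have hbound : ∀ δ : ℝ, δ ≠ 0 →
      ‖∫ ω, Complex.exp (Complex.I * ((∑ j : Fin (N + 1),
        (⟪v δ j, Y (t j.succ) ω - Y (t j.castSucc) ω⟫ : ℝ) : ℝ) : ℂ)) ∂P‖ ≤
      c * ∏ j, |g j|⁻¹ * (h ^ α)⁻¹ := by
    intro δ hδ
    have h1 := H (v δ) ?_ t (by simp [ht]) ht_mono ?_
    · push_cast at h1 ⊢
      refine h1.trans (le_of_eq ?_)
      congr 1
      rw [Fin.prod_univ_succ]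
      simp only [Fin.cons_zero, pow_zero, Nat.cast_zero, mul_zero, Real.rpow_zero, inv_one,
        mul_one, Finset.prod_const_one, one_mul, Fin.cons_succ]
      refine Finset.prod_congr rfl fun j _ => ?_
      rw [Finset.prod_eq_single l]
      · rw [Fin.castSucc_succ]
        simp only [v, ht, Fin.cons_succ, Fin.val_castSucc, Fin.val_succ, if_true]
        push_cast
        rw [pow_one, mul_one]
        congr 3
        ring
      · intro l' _ hl'
        simp [hl']
      · simp
    · intro j l'
      refine Fin.cases ?_ (fun j => ?_) j
      · simpa [v] using hδ
      · simp only [v, Fin.cons_succ]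
        split_ifs
        · exact hg j
        · exact hδ
    · rw [← Fin.succ_last]
      simpa [ht] using haT
  have hδ_lim : Tendsto (fun n : ℕ => 1 / ((n : ℝ) + 1)) atTop (nhds 0) :=
    tendsto_one_div_add_atTop_nhds_zero_nat
  have hlim : Tendsto (fun n : ℕ => ∫ ω, Complex.exp (Complex.I * ((∑ j : Fin (N + 1),
        (⟪v (1 / ((n : ℝ) + 1)) j, Y (t j.succ) ω - Y (t j.castSucc) ω⟫ : ℝ) : ℝ) : ℂ)) ∂P) atTop
      (nhds (∫ ω, Complex.exp (Complex.I * ((∑ j : Fin (N + 1),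
        (⟪v 0 j, Y (t j.succ) ω - Y (t j.castSucc) ω⟫ : ℝ) : ℝ) : ℂ)) ∂P)) := by
    refine tendsto_integral_of_dominated_convergence (fun _ => (1 : ℝ)) (fun n => ?_)
      (integrable_const _) (fun n => ae_of_all _ fun ω => ?_) (ae_of_all _ fun ω => ?_)
    · refine Measurable.aestronglyMeasurable ?_
      have := hY
      fun_prop
    · rw [mul_comm, Complex.norm_exp_ofReal_mul_I]
    · have hcts : Continuous fun δ : ℝ => Complex.exp (Complex.I * ((∑ j : Fin (N + 1),
          (⟪v δ j, Y (t j.succ) ω - Y (t j.castSucc) ω⟫ : ℝ) : ℝ) : ℂ)) := by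
        have hv : ∀ j, Continuous fun δ => v δ j := by
          intro j
          refine Fin.cases ?_ (fun j => ?_) j
          · simp only [v, Fin.cons_zero]
            fun_prop
          · simp only [v, Fin.cons_succ]
            refine (PiLp.continuous_toLp 2 _).comp (continuous_pi fun l' => ?_)
            split_ifs <;> fun_prop
        fun_prop
      exact (hcts.tendsto 0).comp hδ_lim
  have hle := le_of_tendsto hlim.norm
    (Eventually.of_forall fun n : ℕ => hbound (1 / ((n : ℝ) + 1)) (by positivity))
  refine le_of_eq_of_le ?_ hle
  congr 1
  refine integral_congr_ae (ae_of_all _ fun ω => ?_)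
  simp only
  congr 3
  rw [Fin.sum_univ_succ]
  have h0 : v 0 0 = 0 := by
    ext l'
    simp [v]
  rw [h0, inner_zero_left, zero_add]
  refine Finset.sum_congr rfl fun j _ => ?_
  rw [Fin.castSucc_succ, PiLp.inner_apply, Finset.sum_eq_single l]
  · simp only [v, ht, Fin.cons_succ, Fin.val_castSucc, Fin.val_succ, if_true]
    push_cast
    simp [mul_comm]
  · intro l' _ hl'
    simp [v, hl']
  · simp

/-- Probability that `N` consecutive increments of a coordinate are all small. -/
lemma IsLND.measureReal_increments_le {Ω : Type*} [MeasurableSpace Ω] {P : Measure Ω}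
    [IsProbabilityMeasure P] {d : ℕ} {Y : ℝ → Ω → EuclideanSpace ℝ (Fin d)} {T α : ℝ}
    (hY : ∀ t, Measurable (Y t)) (hLND : IsLND P d Y T α) (l : Fin d) {N : ℕ} (hN : 1 ≤ N) :
    ∃ C : ℝ, 0 ≤ C ∧ ∀ a h ε : ℝ, 0 < a → 0 < h → a + N * h ≤ T → 0 < ε →
      P.real {ω | ∀ j : Fin N,
          |Y (a + ((j : ℕ) + 1 : ℝ) * h) ω l - Y (a + (j : ℕ) * h) ω l| ≤ ε} ≤
        C * √(ε / h ^ α) ^ N := by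
  obtain ⟨c, hc, H⟩ := hLND.charFun_increments_le hY l hN
  refine ⟨√c * (Real.exp (1 / 2) *
    ∫ x, √(|x|⁻¹) ∂(ProbabilityTheory.gaussianReal 0 1)) ^ N, ?_, fun a h ε ha hh haT hε => ?_⟩
  · have : 0 ≤ ∫ x, √(|x|⁻¹) ∂(ProbabilityTheory.gaussianReal 0 1) :=
      integral_nonneg fun x => Real.sqrt_nonneg _
    positivity
  · refine measureReal_forall_abs_le_of_charFun_bound P
      (fun j ω => Y (a + ((j : ℕ) + 1 : ℝ) * h) ω l - Y (a + (j : ℕ) * h) ω l)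
      (fun j => ?_) hc.le (by positivity) hε (H a h ha hh haT)
    have := hY
    fun_prop

/-- Every point of `[0,T]` is close to a block of `N + 1` consecutive points of the regular grid,
the block avoiding the origin. -/
lemma exists_grid_block_near {T t₀ : ℝ} (hT : 0 < T) (ht₀ : t₀ ∈ Icc 0 T) {N n : ℕ}
    (hn : N + 1 ≤ n) :
    ∃ i : ℕ, i + 1 + N ≤ n ∧ ∀ j : ℕ, j ≤ N →
      |((i : ℝ) + 1) * (T / n) + j * (T / n) - t₀| ≤ (N + 1) * (T / n) := by
  have hn0 : (0 : ℝ) < n := by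
    have : 0 < n := by omega
    exact_mod_cast this
  have hh : 0 < T / n := by positivity
  set h := T / n with hh_def
  set x := t₀ / h with hx
  have hx0 : 0 ≤ x := div_nonneg ht₀.1 hh.le
  have hxn : x ≤ n := by
    rw [hx, div_le_iff₀ hh, hh_def, mul_div_cancel₀ _ hn0.ne']
    exact ht₀.2
  have hxt : t₀ = x * h := by rw [hx, div_mul_cancel₀ _ hh.ne']
  have hfl := Nat.floor_le hx0
  have hfl' := Nat.lt_floor_add_one x
  obtain ⟨i, hi, hlow, hupp⟩ : ∃ i : ℕ, i + 1 + N ≤ n ∧ x - 1 ≤ (i : ℝ) + N ∧ (i : ℝ) ≤ x := by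
    rcases le_total (⌊x⌋₊ + 1 + N) n with hle | hle
    · have hN0 : (0 : ℝ) ≤ N := N.cast_nonneg
      exact ⟨⌊x⌋₊, hle, by linarith, hfl⟩
    · obtain ⟨i, hi⟩ := Nat.exists_eq_add_of_le hn
      have hi' : (n : ℝ) = N + 1 + i := by exact_mod_cast hi
      have hif : (i : ℝ) ≤ ⌊x⌋₊ := by
        have : i ≤ ⌊x⌋₊ := by omega
        exact_mod_cast this
      exact ⟨i, by omega, by linarith, by linarith⟩
  refine ⟨i, hi, fun j hj => ?_⟩
  have hj' : (j : ℝ) ≤ N := by exact_mod_cast hj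
  have hj0 : (0 : ℝ) ≤ j := j.cast_nonneg
  rw [hxt, show ((i : ℝ) + 1) * h + j * h - x * h = ((i : ℝ) + 1 + j - x) * h by ring, abs_mul,
    abs_of_pos hh]
  refine mul_le_mul_of_nonneg_right (abs_le.2 ⟨by linarith, by linarith⟩) hh.le

/-- Almost surely, a coordinate of an `α`-LND process has no point of `γ`-Hölder regularity with
prescribed constant and radius, when `γ > α`. -/
lemma IsLND.measure_exists_Holder_point_eq_zero {Ω : Type*} [MeasurableSpace Ω] {P : Measure Ω}
    [IsProbabilityMeasure P] {d : ℕ} {Y : ℝ → Ω → EuclideanSpace ℝ (Fin d)} {T α : ℝ}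
    (hT : 0 < T) (hα : 0 < α) (hY : ∀ t, Measurable (Y t)) (hLND : IsLND P d Y T α) (l : Fin d)
    {γ M δ : ℝ} (hγ : α < γ) (hM : 0 < M) (hδ : 0 < δ) :
    P {ω | ∃ t₀ ∈ Icc 0 T, ∀ t ∈ Icc 0 T, |t - t₀| < δ →
      |Y t ω l - Y t₀ ω l| ≤ M * |t - t₀| ^ γ} = 0 := by
  set A := {ω | ∃ t₀ ∈ Icc 0 T, ∀ t ∈ Icc 0 T, |t - t₀| < δ →
      |Y t ω l - Y t₀ ω l| ≤ M * |t - t₀| ^ γ}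
  obtain ⟨N, hNgt⟩ := exists_nat_gt (1 / ((γ - α) / 2))
  have hγα : 0 < (γ - α) / 2 := by linarith
  have hs : 1 < (γ - α) / 2 * N := by
    rw [div_lt_iff₀ hγα] at hNgt
    linarith
  set s := (γ - α) / 2 * N with hs_def
  have hN : 1 ≤ N := by
    rcases Nat.eq_zero_or_pos N with h0 | h0
    · rw [hs_def, h0] at hs
      norm_num at hs
    · exact h0
  obtain ⟨C, hC, H⟩ := hLND.measureReal_increments_le hY l hN
  set B := 2 * (M * ((N : ℝ) + 1) ^ γ) with hB
  have hB0 : 0 < B := by positivity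
  have hbound : ∀ᶠ n : ℕ in atTop,
      P.real A ≤ (C * √B ^ N * T ^ s) * (n : ℝ) ^ (-(s - 1)) := by
    have hsmall : ∀ᶠ n : ℕ in atTop, ((N : ℝ) + 1) * (T / n) < δ := by
      have h1 : Tendsto (fun n : ℕ => ((N : ℝ) + 1) * (T / n)) atTop (nhds (((N : ℝ) + 1) * 0)) :=
        (tendsto_const_div_atTop_nhds_zero_nat T).const_mul _
      rw [mul_zero] at h1
      exact h1.eventually_lt_const hδ
    filter_upwards [hsmall, eventually_ge_atTop (N + 1)] with n hnδ hnN
    have hn0 : (0 : ℝ) < n := by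
      have : 0 < n := by omega
      exact_mod_cast this
    set h := T / n with hh_def
    have hh : 0 < h := by positivity
    have hnh : n * h = T := by rw [hh_def, mul_div_cancel₀ _ hn0.ne']
    set ε := B * h ^ γ with hε_def
    let E : ℕ → Set Ω := fun i => {ω | ∀ j : Fin N,
      |Y (((i : ℝ) + 1) * h + ((j : ℕ) + 1 : ℝ) * h) ω l
        - Y (((i : ℝ) + 1) * h + (j : ℕ) * h) ω l| ≤ ε}
    have hgrid : ∀ i : ℕ, i + 1 + N ≤ n → ∀ j : ℕ, j ≤ N →
        ((i : ℝ) + 1) * h + j * h ∈ Icc 0 T := by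
      intro i hi j hj
      refine ⟨by positivity, ?_⟩
      have : ((i : ℝ) + 1 + j) ≤ n := by exact_mod_cast (by omega : i + 1 + j ≤ n)
      rw [← hnh, ← add_mul]
      exact mul_le_mul_of_nonneg_right this hh.le
    have hsub : A ⊆ ⋃ i ∈ (Finset.range n).filter (fun i => i + 1 + N ≤ n), E i := by
      rintro ω ⟨t₀, ht₀, hω⟩
      obtain ⟨i, hi, hnear⟩ := exists_grid_block_near hT ht₀ hnN
      refine mem_biUnion (x := i) (by simp; omega) ?_
      have hpt : ∀ j : ℕ, j ≤ N →
          |Y (((i : ℝ) + 1) * h + j * h) ω l - Y t₀ ω l| ≤ ε / 2 := by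
        intro j hj
        refine (hω _ (hgrid i hi j hj) ((hnear j hj).trans_lt hnδ)).trans ?_
        have h1 := Real.rpow_le_rpow (abs_nonneg _) (hnear j hj) (hα.trans hγ).le
        rw [Real.mul_rpow (by positivity) hh.le] at h1
        calc _ ≤ M * (((N : ℝ) + 1) ^ γ * h ^ γ) := mul_le_mul_of_nonneg_left h1 hM.le
          _ = ε / 2 := by rw [hε_def, hB]; ring
      intro j
      have h1 := hpt (j + 1) (by omega)
      have h2 := hpt j (by omega)
      push_cast at h1
      rw [abs_le] at h1 h2 ⊢
      constructor <;> linarith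
    have hE : ∀ i ∈ (Finset.range n).filter (fun i => i + 1 + N ≤ n),
        P.real (E i) ≤ C * √(ε / h ^ α) ^ N := by
      intro i hi
      exact H _ h ε (by positivity) hh (hgrid i (Finset.mem_filter.1 hi).2 N le_rfl).2
        (by positivity)
    have hpow : √(ε / h ^ α) ^ N = √B ^ N * h ^ s := by
      rw [hε_def, mul_div_assoc, ← Real.rpow_sub hh, Real.sqrt_mul hB0.le, mul_pow,
        Real.sqrt_eq_rpow (h ^ (γ - α)), ← Real.rpow_mul hh.le, ← Real.rpow_natCast (h ^ _),
        ← Real.rpow_mul hh.le, hs_def]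
      congr 2
      ring
    calc P.real A
        ≤ P.real (⋃ i ∈ (Finset.range n).filter (fun i => i + 1 + N ≤ n), E i) :=
          measureReal_mono hsub (measure_ne_top _ _)
      _ ≤ ∑ i ∈ (Finset.range n).filter (fun i => i + 1 + N ≤ n), P.real (E i) :=
          measureReal_biUnion_finset_le _ _
      _ ≤ ((Finset.range n).filter (fun i => i + 1 + N ≤ n)).card • (C * √(ε / h ^ α) ^ N) :=
          Finset.sum_le_card_nsmul _ _ _ hE
      _ ≤ n * (C * √(ε / h ^ α) ^ N) := by
          rw [nsmul_eq_mul]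
          refine mul_le_mul_of_nonneg_right ?_ (by positivity)
          exact_mod_cast (Finset.card_filter_le _ _).trans (Finset.card_range n).le
      _ = _ := by
          rw [hpow, hh_def, Real.div_rpow hT.le hn0.le, neg_sub, Real.rpow_sub hn0, Real.rpow_one]
          ring
  have hlim : Tendsto (fun n : ℕ => (C * √B ^ N * T ^ s) * (n : ℝ) ^ (-(s - 1))) atTop
      (nhds ((C * √B ^ N * T ^ s) * 0)) :=
    ((tendsto_rpow_neg_atTop (by linarith)).comp tendsto_natCast_atTop_atTop).const_mul _
  rw [mul_zero] at hlim
  have hle : P.real A ≤ 0 := ge_of_tendsto hlim hbound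
  exact (measureReal_eq_zero_iff).1 (le_antisymm hle measureReal_nonneg)

/-- Let `α ∈ (0,1/2]`, `d ≤ ⌊1/α⌋ − 1`, `Y` `α`-LND on `[0,T]` with `Y_0 = 0` a.s. and
continuous sample paths. Then almost surely every coordinate function of `Y` is nowhere
Hölder continuous of any order greater than `α`. -/
theorem coordinates_nowhere_Holder_of_LND
    {Ω : Type*} [MeasurableSpace Ω] (P : Measure Ω) [IsProbabilityMeasure P]
    (α : ℝ) (hα0 : 0 < α) (hα : α ≤ 1 / 2)
    (d : ℕ) (hd1 : 1 ≤ d) (hd : (d : ℤ) ≤ ⌊(1 : ℝ) / α⌋ - 1)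
    (T : ℝ) (hT : 0 < T)
    (Y : ℝ → Ω → EuclideanSpace ℝ (Fin d))
    (hmeas : Measurable (Function.uncurry Y))
    (hY0 : ∀ᵐ ω ∂P, Y 0 ω = 0)
    (hcont : ∀ ω, ContinuousOn (fun s => Y s ω) (Set.Icc 0 T))
    (hLND : IsLND P d Y T α) :
    ∀ᵐ ω ∂P, ∀ l : Fin d, ∀ t₀ ∈ Set.Icc (0 : ℝ) T, ∀ γ : ℝ, α < γ →
      ¬ ∃ C : ℝ, 0 < C ∧ ∃ I ∈ nhdsWithin t₀ (Set.Icc (0 : ℝ) T),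
          ∀ t ∈ I, |Y t ω l - Y t₀ ω l| ≤ C * |t - t₀| ^ γ := by
  have hY : ∀ t, Measurable (Y t) := fun t => hmeas.comp measurable_prodMk_left
  have hae : ∀ᵐ ω ∂P, ∀ (l : Fin d) (p q M : ℕ), ω ∉ {ω | ∃ t₀ ∈ Icc 0 T, ∀ t ∈ Icc 0 T,
      |t - t₀| < 1 / ((q : ℝ) + 1) →
        |Y t ω l - Y t₀ ω l| ≤ ((M : ℝ) + 1) * |t - t₀| ^ (α + 1 / ((p : ℝ) + 1))} := by
    simp only [ae_all_iff]
    intro l p q M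
    have hp : (0 : ℝ) < 1 / ((p : ℝ) + 1) := by positivity
    exact measure_eq_zero_iff_ae_notMem.1 (hLND.measure_exists_Holder_point_eq_zero hT hα0 hY l
      (by linarith) (by positivity) (by positivity))
  filter_upwards [hae] with ω hω l t₀ ht₀ γ hγ
  rintro ⟨C, hC, I, hI, hHolder⟩
  obtain ⟨r, hr, hrI⟩ := Metric.mem_nhdsWithin_iff.1 hI
  obtain ⟨p, hp⟩ := exists_nat_one_div_lt (sub_pos.2 hγ)
  obtain ⟨q, hq⟩ := exists_nat_one_div_lt hr
  obtain ⟨M, hM⟩ := exists_nat_gt C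
  refine hω l p q M ⟨t₀, ht₀, fun t ht htq => ?_⟩
  have htI : t ∈ I := hrI ⟨by rw [Metric.mem_ball, Real.dist_eq]; exact htq.trans hq, ht⟩
  refine (hHolder t htI).trans ?_
  have hp0 : (0 : ℝ) < 1 / ((p : ℝ) + 1) := by positivity
  have hq1 : 1 / ((q : ℝ) + 1) ≤ 1 := by
    rw [div_le_one (by positivity)]
    linarith [q.cast_nonneg (α := ℝ)]
  refine mul_le_mul (by linarith) ?_ (by positivity) (by positivity)
  exact Real.rpow_le_rpow_of_exponent_ge' (abs_nonneg _) (htq.le.trans hq1) (by positivity)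
    (by linarith)
end
end

section
/- Let d ≤ 3 and suppose that Y satisfies the two-point (1/4)-LND condition on [0,T]. Then for every t∈[0,T] and every β with 0 ≤ β < (4−d)/2, one has E[ ∫_{ℝ^d} ‖ξ‖^{2β} · | ∫_0^t exp(i⟨ξ,Y_s⟩) ds |² dξ ] < ∞. -/
open MeasureTheory Filter Set
open scoped ENNReal NNReal RealInnerProductSpace FourierTransform

noncomputable section

/-- `Y` satisfies the two-point `α`-LND condition on `[0,T]`. -/
def TwoPointLND {Ω : Type*} [MeasurableSpace Ω] (P : Measure Ω) (d : ℕ)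
    (Y : ℝ → Ω → EuclideanSpace ℝ (Fin d)) (T α : ℝ) : Prop :=
  ∀ k : Fin d → ℕ, ∃ C : ℝ, 0 < C ∧
    ∀ r s : ℝ, 0 ≤ r → r < s → s ≤ T →
      ∀ ξ : EuclideanSpace ℝ (Fin d), (∀ l, ξ l ≠ 0) →
        ‖∫ ω, Complex.exp (Complex.I * ((⟪ξ, Y s ω - Y r ω⟫ : ℝ) : ℂ)) ∂P‖ ≤
          C * ∏ l : Fin d, (|ξ l| ^ k l)⁻¹ * ((s - r) ^ (α * (k l : ℝ)))⁻¹

/-- The second moment of `∫ f s ω ds` is controlled by the two-point correlations of `f`. -/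
lemma integral_norm_sq_integral_le {S Ω : Type*} [MeasurableSpace S] [MeasurableSpace Ω]
    (μ : Measure S) [IsFiniteMeasure μ] (P : Measure Ω) [IsFiniteMeasure P]
    {f : S → Ω → ℂ} (hf : Measurable (Function.uncurry f)) (hf1 : ∀ s ω, ‖f s ω‖ ≤ 1) :
    ∫ ω, ‖∫ s, f s ω ∂μ‖ ^ 2 ∂P ≤
      ∫ z, ‖∫ ω, f z.1 ω * (starRingEnd ℂ) (f z.2 ω) ∂P‖ ∂(μ.prod μ) := by
  have hsq (ω : Ω) : ((‖∫ s, f s ω ∂μ‖ ^ 2 : ℝ) : ℂ) =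
      ∫ z, f z.1 ω * (starRingEnd ℂ) (f z.2 ω) ∂(μ.prod μ) := by
    rw [integral_prod_mul (fun s => f s ω) (fun s => (starRingEnd ℂ) (f s ω)), integral_conj,
      Complex.mul_conj, Complex.normSq_eq_norm_sq]
  have hmeas : Measurable fun p : Ω × (S × S) => f p.2.1 p.1 * (starRingEnd ℂ) (f p.2.2 p.1) := by
    have h1 : Measurable fun p : Ω × (S × S) => f p.2.1 p.1 :=
      hf.comp (measurable_snd.fst.prodMk measurable_fst)
    have h2 : Measurable fun p : Ω × (S × S) => f p.2.2 p.1 :=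
      hf.comp (measurable_snd.snd.prodMk measurable_fst)
    exact h1.mul (Complex.continuous_conj.measurable.comp h2)
  have hint : Integrable (fun p : Ω × (S × S) => f p.2.1 p.1 * (starRingEnd ℂ) (f p.2.2 p.1))
      (P.prod (μ.prod μ)) := by
    refine Integrable.of_bound hmeas.aestronglyMeasurable 1 (ae_of_all _ fun p => ?_)
    rw [norm_mul, RCLike.norm_conj]
    exact mul_le_one₀ (hf1 _ _) (norm_nonneg _) (hf1 _ _)
  calc ∫ ω, ‖∫ s, f s ω ∂μ‖ ^ 2 ∂P
      ≤ ‖((∫ ω, ‖∫ s, f s ω ∂μ‖ ^ 2 ∂P : ℝ) : ℂ)‖ := by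
        rw [Complex.norm_real]; exact Real.le_norm_self _
    _ = ‖∫ z, ∫ ω, f z.1 ω * (starRingEnd ℂ) (f z.2 ω) ∂P ∂(μ.prod μ)‖ := by
        rw [← integral_complex_ofReal]
        simp_rw [hsq]
        rw [integral_integral_swap hint]
    _ ≤ _ := norm_integral_le_integral_norm _

/-- The Lorentzian `(1 + (a (s - r))²)⁻¹` has mass `O((1 + a)⁻¹)` on a bounded interval. -/
lemma setIntegral_inv_one_add_sq_le {a t : ℝ} (ha : 0 < a) (ht : 0 ≤ t) (r : ℝ) :
    ∫ s in Icc (0 : ℝ) t, (1 + (a * (s - r)) ^ 2)⁻¹ ≤ (t + Real.pi) * (1 + a)⁻¹ := by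
  have hI : Integrable fun s : ℝ => (1 + (a * (s - r)) ^ 2)⁻¹ :=
    (integrable_inv_one_add_sq.comp_mul_left' ha.ne').comp_sub_right r
  have hnn : ∀ s : ℝ, 0 ≤ (1 + (a * (s - r)) ^ 2)⁻¹ := fun s => by positivity
  have h1 : ∫ s in Icc (0 : ℝ) t, (1 + (a * (s - r)) ^ 2)⁻¹ ≤ t := by
    calc ∫ s in Icc (0 : ℝ) t, (1 + (a * (s - r)) ^ 2)⁻¹ ≤ ∫ s in Icc (0 : ℝ) t, (1 : ℝ) := by
          refine setIntegral_mono hI.integrableOn (by simp) fun s => ?_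
          exact inv_le_one_of_one_le₀ (by nlinarith [sq_nonneg (a * (s - r))])
      _ = t := by simp [ht]
  have h2 : a * ∫ s in Icc (0 : ℝ) t, (1 + (a * (s - r)) ^ 2)⁻¹ ≤ Real.pi := by
    have h : ∫ s : ℝ, (1 + (a * (s - r)) ^ 2)⁻¹ = a⁻¹ * Real.pi := by
      rw [integral_sub_right_eq_self (fun s : ℝ => (1 + (a * s) ^ 2)⁻¹) r,
        Measure.integral_comp_mul_left (fun s : ℝ => (1 + s ^ 2)⁻¹) a,
        integral_univ_inv_one_add_sq, abs_of_pos (inv_pos.2 ha), smul_eq_mul]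
    calc a * ∫ s in Icc (0 : ℝ) t, (1 + (a * (s - r)) ^ 2)⁻¹
        ≤ a * ∫ s : ℝ, (1 + (a * (s - r)) ^ 2)⁻¹ :=
          mul_le_mul_of_nonneg_left (setIntegral_le_integral hI (ae_of_all _ hnn)) ha.le
      _ = Real.pi := by rw [h]; field_simp
  rw [← div_eq_mul_inv, le_div_iff₀ (by positivity)]
  linarith

/-- The power mean inequality between the Euclidean norm and the eighth powers of the
coordinates. -/
lemma norm_pow_eight_le {d : ℕ} (ξ : EuclideanSpace ℝ (Fin d)) :
    ‖ξ‖ ^ 8 ≤ (d : ℝ) ^ 3 * ∑ l, |ξ l| ^ 8 := by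
  have h := pow_sum_le_card_mul_sum_pow (s := Finset.univ) (f := fun l => ξ l ^ 2)
    (fun l _ => sq_nonneg _) 3
  rw [Finset.card_univ, Fintype.card_fin] at h
  calc ‖ξ‖ ^ 8 = (∑ l, ξ l ^ 2) ^ (3 + 1) := by
        rw [← EuclideanSpace.real_norm_sq_eq]; ring
    _ ≤ (d : ℝ) ^ 3 * ∑ l, (ξ l ^ 2) ^ (3 + 1) := h
    _ = _ := by
        congr 1
        refine Finset.sum_congr rfl fun l _ => ?_
        rw [← sq_abs]; ring

/-- Under the two-point `1/4`-LND condition the two-point characteristic function has Lorentzian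
decay in the time increment, at scale `‖ξ‖⁻⁴`. -/
lemma TwoPointLND.exists_norm_integral_le {Ω : Type*} [MeasurableSpace Ω] {P : Measure Ω}
    [IsProbabilityMeasure P] {d : ℕ} {Y : ℝ → Ω → EuclideanSpace ℝ (Fin d)} {T : ℝ}
    (h : TwoPointLND P d Y T (1 / 4)) :
    ∃ M : ℝ, 0 ≤ M ∧ ∀ r ∈ Icc 0 T, ∀ s ∈ Icc 0 T, ∀ ξ : EuclideanSpace ℝ (Fin d),
      (∀ l, ξ l ≠ 0) →
        ‖∫ ω, Complex.exp (Complex.I * ((⟪ξ, Y s ω - Y r ω⟫ : ℝ) : ℂ)) ∂P‖ ≤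
          M * (1 + (‖ξ‖ ^ 4 * (s - r)) ^ 2)⁻¹ := by
  choose C hC0 hC using fun l : Fin d => h (Pi.single l 8)
  have hS : 0 ≤ ∑ l, C l := Finset.sum_nonneg fun l _ => (hC0 l).le
  refine ⟨1 + (d : ℝ) ^ 3 * ∑ l, C l, by positivity, fun r hr s hs ξ hξ => ?_⟩
  have hle1 (r s : ℝ) :
      ‖∫ ω, Complex.exp (Complex.I * ((⟪ξ, Y s ω - Y r ω⟫ : ℝ) : ℂ)) ∂P‖ ≤ 1 := by
    refine (norm_integral_le_of_norm_le_const (C := 1) (ae_of_all _ fun ω => ?_)).trans (by simp)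
    rw [mul_comm, Complex.norm_exp_ofReal_mul_I]
  have hlt {r s : ℝ} (hr : 0 ≤ r) (hrs : r < s) (hs : s ≤ T) :
      ‖∫ ω, Complex.exp (Complex.I * ((⟪ξ, Y s ω - Y r ω⟫ : ℝ) : ℂ)) ∂P‖ ≤
        (1 + (d : ℝ) ^ 3 * ∑ l, C l) * (1 + (‖ξ‖ ^ 4 * (s - r)) ^ 2)⁻¹ := by
    have hu : 0 < s - r := sub_pos.2 hrs
    set φ := ‖∫ ω, Complex.exp (Complex.I * ((⟪ξ, Y s ω - Y r ω⟫ : ℝ) : ℂ)) ∂P‖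
    have hl (l : Fin d) : φ * (s - r) ^ 2 * |ξ l| ^ 8 ≤ C l := by
      have hξl : 0 < |ξ l| := abs_pos.2 (hξ l)
      have hb := hC l r s hr hrs hs ξ hξ
      rw [Fintype.prod_eq_single l (fun m hm => by simp [hm])] at hb
      have hpow : (s - r) ^ ((1 / 4 : ℝ) * ((8 : ℕ) : ℝ)) = (s - r) ^ 2 := by
        rw [← Real.rpow_natCast]; norm_num
      rw [Pi.single_eq_same, hpow, ← mul_inv, ← div_eq_mul_inv, le_div_iff₀ (by positivity)] at hb
      linarith
    have hsum : φ * (‖ξ‖ ^ 4 * (s - r)) ^ 2 ≤ (d : ℝ) ^ 3 * ∑ l, C l := by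
      calc φ * (‖ξ‖ ^ 4 * (s - r)) ^ 2 = φ * (s - r) ^ 2 * ‖ξ‖ ^ 8 := by ring
        _ ≤ φ * (s - r) ^ 2 * ((d : ℝ) ^ 3 * ∑ l, |ξ l| ^ 8) := by
          gcongr; exact norm_pow_eight_le ξ
        _ = (d : ℝ) ^ 3 * ∑ l, φ * (s - r) ^ 2 * |ξ l| ^ 8 := by rw [← Finset.mul_sum]; ring
        _ ≤ _ := by gcongr with l; exact hl l
    rw [← div_eq_mul_inv, le_div_iff₀ (by positivity)]
    linarith [hle1 r s]
  rcases lt_trichotomy r s with hrs | rfl | hrs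
  · exact hlt hr.1 hrs hs.2
  · refine (hle1 r r).trans ?_
    simp only [sub_self, mul_zero, ne_eq, OfNat.ofNat_ne_zero, not_false_eq_true, zero_pow,
      add_zero, inv_one, mul_one, le_add_iff_nonneg_right]
    positivity
  · have hsymm : ∫ ω, Complex.exp (Complex.I * ((⟪ξ, Y s ω - Y r ω⟫ : ℝ) : ℂ)) ∂P =
        (starRingEnd ℂ) (∫ ω, Complex.exp (Complex.I * ((⟪ξ, Y r ω - Y s ω⟫ : ℝ) : ℂ)) ∂P) := by
      rw [← integral_conj]
      refine integral_congr_ae (ae_of_all _ fun ω => ?_)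
      beta_reduce
      rw [← Complex.exp_conj, map_mul, Complex.conj_I, Complex.conj_ofReal,
        ← neg_sub (Y r ω), inner_neg_right]
      push_cast
      ring_nf
    rw [hsymm, RCLike.norm_conj]
    convert hlt hs.1 hrs hr.2 using 4
    ring

/-- Under the two-point `1/4`-LND condition the occupation measure of `Y` has Fourier transform
of order `‖ξ‖⁻²` in mean square. -/
lemma TwoPointLND.exists_integral_norm_sq_le {Ω : Type*} [MeasurableSpace Ω] {P : Measure Ω}
    [IsProbabilityMeasure P] {d : ℕ} {Y : ℝ → Ω → EuclideanSpace ℝ (Fin d)} {T : ℝ}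
    (h : TwoPointLND P d Y T (1 / 4)) (hmeas : Measurable (Function.uncurry Y)) :
    ∃ M : ℝ, 0 ≤ M ∧ ∀ t : ℝ, 0 ≤ t → t ≤ T → ∀ ξ : EuclideanSpace ℝ (Fin d), 0 < ‖ξ‖ →
      (∀ l, ξ l ≠ 0) →
        ∫ ω, ‖∫ s in Icc (0 : ℝ) t, Complex.exp (Complex.I * ((⟪ξ, Y s ω⟫ : ℝ) : ℂ))‖ ^ 2 ∂P ≤
          M * t * (t + Real.pi) * (1 + ‖ξ‖ ^ 4)⁻¹ := by
  obtain ⟨M, hM0, hM⟩ := h.exists_norm_integral_le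
  refine ⟨M, hM0, fun t ht0 htT ξ hξ0 hξ => ?_⟩
  have hf : Measurable (Function.uncurry fun s ω =>
      Complex.exp (Complex.I * ((⟪ξ, Y s ω⟫ : ℝ) : ℂ))) := by
    have hY : Measurable fun p : ℝ × Ω => ⟪ξ, Y p.1 p.2⟫ := hmeas.const_inner
    change Measurable fun p : ℝ × Ω => Complex.exp (Complex.I * ((⟪ξ, Y p.1 p.2⟫ : ℝ) : ℂ))
    fun_prop
  refine (integral_norm_sq_integral_le (volume.restrict (Icc 0 t)) P hf fun s ω => ?_).trans ?_
  · rw [mul_comm, Complex.norm_exp_ofReal_mul_I]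
  have hcorr (z : ℝ × ℝ) (ω : Ω) : Complex.exp (Complex.I * ((⟪ξ, Y z.1 ω⟫ : ℝ) : ℂ)) *
      (starRingEnd ℂ) (Complex.exp (Complex.I * ((⟪ξ, Y z.2 ω⟫ : ℝ) : ℂ))) =
        Complex.exp (Complex.I * ((⟪ξ, Y z.1 ω - Y z.2 ω⟫ : ℝ) : ℂ)) := by
    rw [← Complex.exp_conj, map_mul, Complex.conj_I, Complex.conj_ofReal, ← Complex.exp_add,
      inner_sub_right]
    push_cast
    ring_nf
  simp_rw [hcorr]
  have hL : Integrable (fun z : ℝ × ℝ => M * (1 + (‖ξ‖ ^ 4 * (z.1 - z.2)) ^ 2)⁻¹)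
      ((volume.restrict (Icc 0 t)).prod (volume.restrict (Icc 0 t))) := by
    refine Integrable.of_bound (by fun_prop) M (ae_of_all _ fun z => ?_)
    rw [Real.norm_of_nonneg (by positivity)]
    exact mul_le_of_le_one_right hM0
      (inv_le_one_of_one_le₀ (by nlinarith [sq_nonneg (‖ξ‖ ^ 4 * (z.1 - z.2))]))
  calc _ ≤ ∫ z, M * (1 + (‖ξ‖ ^ 4 * (z.1 - z.2)) ^ 2)⁻¹
        ∂((volume.restrict (Icc 0 t)).prod (volume.restrict (Icc 0 t))) := by
        refine integral_mono_of_nonneg (ae_of_all _ fun z => norm_nonneg _) hL ?_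
        rw [Measure.prod_restrict]
        filter_upwards [ae_restrict_mem (measurableSet_Icc.prod measurableSet_Icc)] with z hz
        exact hM z.2 (Icc_subset_Icc_right htT hz.2) z.1 (Icc_subset_Icc_right htT hz.1) ξ hξ
    _ = ∫ r in Icc (0 : ℝ) t, M * ∫ s in Icc (0 : ℝ) t, (1 + (‖ξ‖ ^ 4 * (s - r)) ^ 2)⁻¹ := by
        rw [integral_prod_symm _ hL]
        simp_rw [integral_const_mul]
    _ ≤ ∫ r in Icc (0 : ℝ) t, M * ((t + Real.pi) * (1 + ‖ξ‖ ^ 4)⁻¹) := by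
        refine integral_mono_of_nonneg (ae_of_all _ fun r => ?_) (integrable_const _)
          (ae_of_all _ fun r => ?_)
        · exact mul_nonneg hM0 (integral_nonneg fun s => by positivity)
        · exact mul_le_mul_of_nonneg_left
            (setIntegral_inv_one_add_sq_le (by positivity) ht0 r) hM0
    _ = M * t * (t + Real.pi) * (1 + ‖ξ‖ ^ 4)⁻¹ := by
        simp [ht0]
        ring

/-- Almost every vector has all its coordinates nonzero. -/
lemma ae_forall_coord_ne_zero (d : ℕ) :
    ∀ᵐ ξ : EuclideanSpace ℝ (Fin d), ∀ l, ξ l ≠ 0 := by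
  rw [ae_all_iff]
  intro l
  have h : ∀ᵐ x : Fin d → ℝ, x l ≠ 0 := by
    have := (Measure.tendsto_eval_ae_ae (μ := fun _ : Fin d => (volume : Measure ℝ)) (i := l))
    exact this.eventually (Measure.ae_ne volume 0)
  exact (PiLp.volume_preserving_ofLp (Fin d)).quasiMeasurePreserving.ae h

/-- `‖ξ‖^p / (1 + ‖ξ‖⁴)` is integrable at infinity when `p + d < 4`. -/
lemma lintegral_norm_rpow_mul_inv_one_add_norm_pow_four_lt_top {d : ℕ} {p : ℝ} (hp0 : 0 ≤ p)
    (hp : p + d < 4) {M : ℝ} (hM : 0 ≤ M) :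
    ∫⁻ ξ : EuclideanSpace ℝ (Fin d), ENNReal.ofReal (‖ξ‖ ^ p * (M * (1 + ‖ξ‖ ^ 4)⁻¹)) < ⊤ := by
  have hI : Integrable fun ξ : EuclideanSpace ℝ (Fin d) => 8 * M * (1 + ‖ξ‖) ^ (-(4 - p)) :=
    (integrable_one_add_norm (by simp; linarith)).const_mul _
  refine lt_of_le_of_lt (lintegral_mono fun ξ => ENNReal.ofReal_le_ofReal ?_) hI.lintegral_lt_top
  have hx := norm_nonneg ξ
  set x := ‖ξ‖
  have h4 : (1 + x ^ 4)⁻¹ ≤ 8 * ((1 + x) ^ 4)⁻¹ := by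
    rw [← div_eq_mul_inv, inv_eq_one_div, div_le_div_iff₀ (by positivity) (by positivity)]
    nlinarith [sq_nonneg (x ^ 2 - 1), sq_nonneg (x - 1), mul_nonneg (sq_nonneg (x - 1)) hx,
      mul_nonneg (sq_nonneg (x - 1)) (sq_nonneg x)]
  calc x ^ p * (M * (1 + x ^ 4)⁻¹) ≤ (1 + x) ^ p * (M * (8 * ((1 + x) ^ 4)⁻¹)) := by
        gcongr
        linarith
    _ = 8 * M * (1 + x) ^ (-(4 - p)) := by
        rw [neg_sub, Real.rpow_sub (by positivity)]
        norm_cast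
        ring

/-- If `d ≤ 3` and `Y` satisfies the two-point `(1/4)`-LND condition on `[0,T]`, then for
every `t ∈ [0,T]` and every `0 ≤ β < (4−d)/2`,
`E[∫_{ℝ^d} ‖ξ‖^{2β} |∫_0^t exp(i⟨ξ,Y_s⟩) ds|² dξ] < ∞`. -/
theorem expectation_weighted_fourier_energy_finite
    {Ω : Type*} [MeasurableSpace Ω] (P : Measure Ω) [IsProbabilityMeasure P]
    (d : ℕ) (hd1 : 1 ≤ d) (hd3 : d ≤ 3) (T : ℝ) (hT : 0 < T)
    (Y : ℝ → Ω → EuclideanSpace ℝ (Fin d))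
    (hmeas : Measurable (Function.uncurry Y))
    (hLND : TwoPointLND P d Y T (1 / 4)) :
    ∀ t : ℝ, 0 ≤ t → t ≤ T → ∀ β : ℝ, 0 ≤ β → β < (4 - d) / 2 →
      ∫⁻ ω, ∫⁻ ξ : EuclideanSpace ℝ (Fin d),
        ENNReal.ofReal (‖ξ‖ ^ (2 * β) *
          ‖∫ s in Set.Icc (0 : ℝ) t,
              Complex.exp (Complex.I * ((⟪ξ, Y s ω⟫ : ℝ) : ℂ))‖ ^ 2) ∂volume ∂P < ⊤ := by
  intro t ht0 htT β hβ0 hβ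
  obtain ⟨M, hM0, hM⟩ := hLND.exists_integral_norm_sq_le hmeas
  have hG : Measurable fun p : (Ω × EuclideanSpace ℝ (Fin d)) × ℝ =>
      Complex.exp (Complex.I * ((⟪p.1.2, Y p.2 p.1.1⟫ : ℝ) : ℂ)) := by
    have hY : Measurable fun p : (Ω × EuclideanSpace ℝ (Fin d)) × ℝ => Y p.2 p.1.1 :=
      hmeas.comp (measurable_snd.prodMk measurable_fst.fst)
    have := (measurable_fst.snd : Measurable
      fun p : (Ω × EuclideanSpace ℝ (Fin d)) × ℝ => p.1.2).inner (𝕜 := ℝ) hY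
    fun_prop
  have hN : Measurable fun p : Ω × EuclideanSpace ℝ (Fin d) =>
      ‖∫ s in Icc (0 : ℝ) t, Complex.exp (Complex.I * ((⟪p.2, Y s p.1⟫ : ℝ) : ℂ))‖ :=
    (hG.stronglyMeasurable.integral_prod_right' (ν := volume.restrict (Icc 0 t))).norm.measurable
  have hNt (ω : Ω) (ξ : EuclideanSpace ℝ (Fin d)) :
      ‖∫ s in Icc (0 : ℝ) t, Complex.exp (Complex.I * ((⟪ξ, Y s ω⟫ : ℝ) : ℂ))‖ ≤ t := by
    refine (norm_integral_le_of_norm_le_const (C := 1) (ae_of_all _ fun s => ?_)).trans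
      (by simp [ht0])
    rw [mul_comm, Complex.norm_exp_ofReal_mul_I]
  rw [lintegral_lintegral_swap (by
    refine (ENNReal.measurable_ofReal.comp (Measurable.mul ?_ (hN.pow_const 2))).aemeasurable
    fun_prop)]
  refine lt_of_le_of_lt (lintegral_mono_ae ?_)
    (lintegral_norm_rpow_mul_inv_one_add_norm_pow_four_lt_top (d := d) (p := 2 * β) (by positivity)
      (by linarith) (M := M * t * (t + Real.pi)) (by positivity))
  filter_upwards [ae_forall_coord_ne_zero d] with ξ hξ
  have hξ0 : 0 < ‖ξ‖ := by
    refine norm_pos_iff.2 fun h => hξ ⟨0, hd1⟩ (by simp [h])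
  have hNint : Integrable (fun ω =>
      ‖∫ s in Icc (0 : ℝ) t, Complex.exp (Complex.I * ((⟪ξ, Y s ω⟫ : ℝ) : ℂ))‖ ^ 2) P := by
    refine Integrable.of_bound
      ((hN.comp (measurable_id.prodMk measurable_const)).pow_const 2).aestronglyMeasurable (t ^ 2)
      (ae_of_all _ fun ω => ?_)
    rw [Real.norm_of_nonneg (by positivity)]
    exact pow_le_pow_left₀ (norm_nonneg _) (hNt ω ξ) 2
  rw [← ofReal_integral_eq_lintegral_ofReal (hNint.const_mul _)
    (ae_of_all _ fun ω => by positivity), integral_const_mul]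
  refine ENNReal.ofReal_le_ofReal (mul_le_mul_of_nonneg_left ?_ (by positivity))
  exact hM t ht0 htT ξ hξ0 hξ
end
end
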